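/- (First Fundamental Theorem of Coinvariant Theory for O_q(GL_t).) Let K be a field, q ∈ K nonzero, and m, n, t arbitrary positive integers. The set of γ*_q-coinvariants in O_q(V) = O_q(M_{m,t}) ⊗ O_q(M_{t,n}) equals the image of μ*_q; that is, (O_q(M_{m,t}) ⊗ O_q(M_{t,n}))^{co O_q(GL_t)} = μ*_q(O_q(M_{m,n}^{≤t})). -/

import Mathlib

open scoped TensorProduct

noncomputable section

/-- The four defining relations of the quantized coordinate ring `O_q(M_{u,v})`, as a relation
on the free algebra on generators `X_{ij}`, `(i,j) ∈ Fin u × Fin v`. -/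
inductive QMRel (K : Type) [Field K] (q : K) (u v : ℕ) :
    FreeAlgebra K (Fin u × Fin v) → FreeAlgebra K (Fin u × Fin v) → Prop
  | row {i : Fin u} {j k : Fin v} (h : j < k) :
      QMRel K q u v (FreeAlgebra.ι K (i, j) * FreeAlgebra.ι K (i, k))
        (q • (FreeAlgebra.ι K (i, k) * FreeAlgebra.ι K (i, j)))
  | col {i k : Fin u} {j : Fin v} (h : i < k) :
      QMRel K q u v (FreeAlgebra.ι K (i, j) * FreeAlgebra.ι K (k, j))
        (q • (FreeAlgebra.ι K (k, j) * FreeAlgebra.ι K (i, j)))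
  | comm {i k : Fin u} {j l : Fin v} (h1 : i < k) (h2 : l < j) :
      QMRel K q u v (FreeAlgebra.ι K (i, j) * FreeAlgebra.ι K (k, l))
        (FreeAlgebra.ι K (k, l) * FreeAlgebra.ι K (i, j))
  | quantum {i k : Fin u} {j l : Fin v} (h1 : i < k) (h2 : j < l) :
      QMRel K q u v (FreeAlgebra.ι K (i, j) * FreeAlgebra.ι K (k, l))
        (FreeAlgebra.ι K (k, l) * FreeAlgebra.ι K (i, j) +
          (q - q⁻¹) • (FreeAlgebra.ι K (i, l) * FreeAlgebra.ι K (k, j)))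

/-- The quantized coordinate ring `O_q(M_{u,v})` of `u × v` matrices. -/
abbrev OqM (K : Type) [Field K] (q : K) (u v : ℕ) :=
  RingQuot (QMRel K q u v)

/-- The canonical generators `X_{ij}` of `O_q(M_{u,v})`. -/
def Xg (K : Type) [Field K] (q : K) {u v : ℕ} (i : Fin u) (j : Fin v) : OqM K q u v :=
  RingQuot.mkAlgHom K (QMRel K q u v) (FreeAlgebra.ι K (i, j))

/-- The number of inversions (the length) of a permutation of `Fin l`. -/
def invCount {l : ℕ} (σ : Equiv.Perm (Fin l)) : ℕ :=
  (Finset.univ.filter fun p : Fin l × Fin l => p.1 < p.2 ∧ σ p.2 < σ p.1).card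

/-- The `l × l` quantum minor of `O_q(M_{u,v})` with rows `R 0, …, R (l-1)` and columns
`C 0, …, C (l-1)`:  `[R|C] = Σ_σ (-q)^{ℓ(σ)} X_{R 0, C (σ 0)} ⋯ X_{R (l-1), C (σ (l-1))}`. -/
def qMinor (K : Type) [Field K] (q : K) {u v l : ℕ} (R : Fin l → Fin u) (C : Fin l → Fin v) :
    OqM K q u v :=
  ∑ σ : Equiv.Perm (Fin l),
    ((-q) ^ invCount σ) • (List.ofFn fun i : Fin l => Xg K q (R i) (C (σ i))).prod

/-- The relations killing all `(t+1) × (t+1)` quantum minors of `O_q(M_{m,n})`. -/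
inductive DetRel (K : Type) [Field K] (q : K) (m n t : ℕ) :
    OqM K q m n → OqM K q m n → Prop
  | minor (R : Fin (t + 1) → Fin m) (C : Fin (t + 1) → Fin n)
      (hR : StrictMono R) (hC : StrictMono C) :
      DetRel K q m n t (qMinor K q R C) 0

/-- `O_q(M_{m,n}^{≤ t}) = O_q(M_{m,n}) / I_{t+1}`, the quotient by the ideal generated by all
`(t+1) × (t+1)` quantum minors. -/
abbrev OqMle (K : Type) [Field K] (q : K) (m n t : ℕ) :=
  RingQuot (DetRel K q m n t)

/-- The quotient map `O_q(M_{m,n}) → O_q(M_{m,n}^{≤ t})`. -/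
def mkle (K : Type) [Field K] (q : K) (m n t : ℕ) :
    OqM K q m n →ₐ[K] OqMle K q m n t :=
  RingQuot.mkAlgHom K (DetRel K q m n t)

/-- The two-sided ideal of a `K`-algebra `R` generated by a subset `S`, as a set. -/
def tsSpan (K : Type) [Field K] (R : Type) [Ring R] [Algebra K R] (S : Set R) : Set R :=
  (Submodule.span K {x : R | ∃ a b : R, ∃ s ∈ S, x = a * s * b} : Submodule K R)

/-- The left `H`-comodule structure map `γ* : A ⊗ B → H ⊗ (A ⊗ B)` given on pure tensors by
`γ*(a ⊗ b) = Σ S(a₁) b₋₁ ⊗ a₀ ⊗ b₀`, built from a right coaction `ρ* : A → A ⊗ H`, a left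
coaction `λ* : B → H ⊗ B`, and the antipode `S` of `H`. -/
def gammaMap (K A B H : Type) [Field K] [Ring A] [Algebra K A] [Ring B] [Algebra K B]
    [Ring H] [HopfAlgebra K H]
    (ρ : A →ₐ[K] A ⊗[K] H) (lam : B →ₐ[K] H ⊗[K] B) :
    (A ⊗[K] B) →ₗ[K] H ⊗[K] (A ⊗[K] B) :=
  (TensorProduct.map
      ((LinearMap.mul' K H).comp
        (TensorProduct.map (HopfAlgebra.antipode (R := K)) LinearMap.id))
      LinearMap.id)
    ∘ₗ (TensorProduct.tensorTensorTensorComm K H A H B).toLinearMap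
    ∘ₗ (TensorProduct.map (TensorProduct.comm K A H).toLinearMap LinearMap.id)
    ∘ₗ (TensorProduct.map ρ.toLinearMap lam.toLinearMap)

/-- The quantum determinant `d_T` of `O_q(M_t)`. -/
def qdet (K : Type) [Field K] (q : K) (t : ℕ) : OqM K q t t :=
  qMinor K q (id : Fin t → Fin t) (id : Fin t → Fin t)

section QuantumMatrices

variable {K : Type} [Field K] {q : K}

/-- A `u × v` array in a `K`-algebra satisfying the standard quantum matrix relations. -/
structure IsQM {R : Type} [Ring R] [Algebra K R] (q : K) {u v : ℕ} (x : Fin u → Fin v → R) :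
    Prop where
  row : ∀ {i j k}, j < k → x i j * x i k = q • (x i k * x i j)
  col : ∀ {i k j}, i < k → x i j * x k j = q • (x k j * x i j)
  comm : ∀ {i k j l}, i < k → l < j → x i j * x k l = x k l * x i j
  quantum : ∀ {i k j l}, i < k → j < l →
    x i j * x k l = x k l * x i j + (q - q⁻¹) • (x i l * x k j)

theorem isQM_Xg (K : Type) [Field K] (q : K) (u v : ℕ) :
    IsQM q (Xg K q : Fin u → Fin v → OqM K q u v) where
  row h := by
    simpa [Xg] using RingQuot.mkAlgHom_rel K (QMRel.row (K := K) (q := q) (u := u) h)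
  col h := by
    simpa [Xg] using RingQuot.mkAlgHom_rel K (QMRel.col (K := K) (q := q) (v := v) h)
  comm h₁ h₂ := by
    simpa [Xg] using RingQuot.mkAlgHom_rel K (QMRel.comm (K := K) (q := q) h₁ h₂)
  quantum h₁ h₂ := by
    simpa [Xg] using RingQuot.mkAlgHom_rel K (QMRel.quantum (K := K) (q := q) h₁ h₂)

variable {R S : Type} [Ring R] [Algebra K R] [Ring S] [Algebra K S] {u v s : ℕ}

theorem IsQM.map {x : Fin u → Fin v → R} (hx : IsQM q x) (f : R →ₐ[K] S) :
    IsQM q fun i j => f (x i j) where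
  row h := by rw [← map_mul, hx.row h]; simp
  col h := by rw [← map_mul, hx.col h]; simp
  comm h₁ h₂ := by rw [← map_mul, hx.comm h₁ h₂]; simp
  quantum h₁ h₂ := by rw [← map_mul, hx.quantum h₁ h₂]; simp

theorem IsQM.transpose {x : Fin u → Fin v → R} (hx : IsQM q x) : IsQM q fun i j => x j i where
  row h := hx.col h
  col h := hx.row h
  comm h₁ h₂ := (hx.comm h₂ h₁).symm
  quantum {i k j l} h₁ h₂ := by rw [hx.quantum h₂ h₁, hx.comm (i := j) (k := l) h₂ h₁]

theorem sum_sum_eq_of_pairs {M : Type} [AddCommMonoid M] {f g : Fin s → Fin s → M}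
    (h₀ : ∀ a, f a a = g a a) (h₁ : ∀ a b, a < b → f a b + f b a = g a b + g b a) :
    ∑ a, ∑ b, f a b = ∑ a, ∑ b, g a b := by
  have key (f : Fin s → Fin s → M) : ∑ a, ∑ b, f a b =
      ∑ a, f a a + ∑ a, ∑ b, (if a < b then f a b + f b a else 0 : M) := by
    have e (a b : Fin s) : f a b = (if a = b then f a b else 0) +
        ((if a < b then f a b else 0) + if b < a then f a b else 0) := by
      rcases lt_trichotomy a b with h | h | h
      · simp [h, h.ne, h.not_gt]
      · simp [h]
      · simp [h, h.ne', h.not_gt]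
    calc ∑ a, ∑ b, f a b = ∑ a, ∑ b, ((if a = b then f a b else 0) +
        ((if a < b then f a b else 0) + if b < a then f a b else 0)) :=
          Finset.sum_congr rfl fun a _ => Finset.sum_congr rfl fun b _ => e a b
      _ = ∑ a, f a a + (∑ a, ∑ b, (if a < b then f a b else (0 : M)) +
          ∑ a, ∑ b, if b < a then f a b else (0 : M)) := by
        simp [Finset.sum_add_distrib]
      _ = _ := by
        rw [Finset.sum_comm (f := fun a b => if b < a then f a b else (0 : M))]
        congr 1
        simp only [← Finset.sum_add_distrib]
        refine Finset.sum_congr rfl fun a _ => Finset.sum_congr rfl fun b _ => ?_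
        split_ifs <;> simp
  rw [key f, key g]
  congr 1
  · exact Finset.sum_congr rfl fun a _ => h₀ a
  · refine Finset.sum_congr rfl fun a _ => Finset.sum_congr rfl fun b _ => ?_
    split_ifs with h
    · exact h₁ a b h
    · rfl

theorem IsQM.mul (hq : q ≠ 0) {x : Fin u → Fin s → R} {y : Fin s → Fin v → R} (hx : IsQM q x)
    (hy : IsQM q y) (hxy : ∀ i a b j, x i a * y b j = y b j * x i a) :
    IsQM q fun i j => ∑ a, x i a * y a j := by
  have swap (i j k l a b) : x i a * y a j * (x k b * y b l) =
      (x i a * x k b) * (y a j * y b l) := by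
    rw [mul_assoc, ← mul_assoc (y a j), ← hxy k b a j]; simp only [mul_assoc]
  have hx' {i a b} (h : a < b) : x i b * x i a = q⁻¹ • (x i a * x i b) := by
    rw [hx.row h, smul_smul, inv_mul_cancel₀ hq, one_smul]
  refine ⟨?_, ?_, ?_, ?_⟩
  · intro i j l h
    simp only [Finset.sum_mul_sum, Finset.smul_sum, swap]
    refine sum_sum_eq_of_pairs (fun a => ?_) fun a b hab => ?_
    · rw [hy.row h, mul_smul_comm]
    · rw [hx' hab, hy.quantum hab h, ← hy.comm hab h]
      simp only [mul_add, smul_mul_assoc, mul_smul_comm]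
      match_scalars <;> (field_simp; try ring)
  · intro i k j h
    simp only [Finset.sum_mul_sum, Finset.smul_sum, swap]
    refine sum_sum_eq_of_pairs (fun a => ?_) fun a b hab => ?_
    · rw [hx.col h, smul_mul_assoc]
    · rw [hx.quantum h hab, ← hx.comm h hab, hy.col hab]
      simp only [add_mul, smul_mul_assoc, mul_smul_comm]
      match_scalars <;> (field_simp; try ring)
  · intro i k j l h₁ h₂
    simp only [Finset.sum_mul_sum, swap]
    refine sum_sum_eq_of_pairs (fun a => ?_) fun a b hab => ?_
    · rw [hx.col h₁, hy.row h₂]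
      simp only [smul_mul_assoc, mul_smul_comm]
    · rw [hx.quantum h₁ hab, hx.comm h₁ hab, hy.quantum hab h₂, hy.comm hab h₂]
      simp only [mul_add, add_mul, smul_mul_assoc, mul_smul_comm]
      rw [← hx.comm h₁ hab]
      module
  · intro i k j l h₁ h₂
    simp only [Finset.sum_mul_sum, Finset.smul_sum, swap, ← Finset.sum_add_distrib]
    refine sum_sum_eq_of_pairs (fun a => ?_) fun a b hab => ?_
    · rw [hx.col h₁, hy.row h₂]
      simp only [smul_mul_assoc, mul_smul_comm]
      match_scalars
      field_simp
      ring
    · rw [hx.quantum h₁ hab, hx.comm h₁ hab, hy.quantum hab h₂, ← hy.comm hab h₂]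
      simp only [mul_add, add_mul, smul_mul_assoc, mul_smul_comm]
      match_scalars <;> (field_simp; try ring)

/-- The algebra morphism out of `O_q(M_{u,v})` determined by a quantum matrix. -/
def oqLift {x : Fin u → Fin v → R} (hx : IsQM q x) : OqM K q u v →ₐ[K] R :=
  RingQuot.liftAlgHom K ⟨FreeAlgebra.lift K fun p : Fin u × Fin v => x p.1 p.2, by
    rintro _ _ (h | h | ⟨h₁, h₂⟩ | ⟨h₁, h₂⟩)
    · simpa using hx.row h
    · simpa using hx.col h
    · simpa using hx.comm h₁ h₂
    · simpa using hx.quantum h₁ h₂⟩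

theorem oqLift_Xg {x : Fin u → Fin v → R} (hx : IsQM q x) (i j) :
    oqLift hx (Xg K q i j) = x i j := by
  rw [oqLift, Xg, RingQuot.liftAlgHom_mkAlgHom_apply]; simp

theorem OqM_hom_ext {f g : OqM K q u v →ₐ[K] R} (h : ∀ i j, f (Xg K q i j) = g (Xg K q i j)) :
    f = g := by
  refine RingQuot.ringQuot_ext' K f g (FreeAlgebra.hom_ext ?_)
  funext ⟨i, j⟩
  exact h i j

theorem OqM_induction {p : OqM K q u v → Prop} (one : p 1) (add : ∀ x y, p x → p y → p (x + y))
    (smul : ∀ (c : K) x, p x → p (c • x)) (mul : ∀ i j x, p x → p (Xg K q i j * x)) (x) : p x := by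
  let N : Submodule K (OqM K q u v) :=
    { carrier := {x | p x}
      add_mem' := add _ _
      zero_mem' := by simpa using smul 0 1 one
      smul_mem' := smul }
  have hN (y : FreeAlgebra K (Fin u × Fin v)) :
      ∀ z ∈ N, RingQuot.mkAlgHom K (QMRel K q u v) y * z ∈ N := by
    induction y using FreeAlgebra.induction with
    | grade0 r =>
      intro z hz
      rw [AlgHom.commutes, ← Algebra.smul_def]; exact N.smul_mem r hz
    | grade1 a => exact fun z hz => mul a.1 a.2 z hz
    | mul a b ha hb => intro z hz; rw [map_mul, mul_assoc]; exact ha _ (hb z hz)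
    | add a b ha hb => intro z hz; rw [map_add, add_mul]; exact N.add_mem (ha z hz) (hb z hz)
  obtain ⟨y, rfl⟩ := RingQuot.mkAlgHom_surjective K (QMRel K q u v) x
  exact (mul_one (RingQuot.mkAlgHom K (QMRel K q u v) y)) ▸ hN y 1 one

/-- The algebra `O_q(M_{u,v})`, with its presentation as a quotient hidden from unification. -/
def QMat (K : Type) [Field K] (q : K) (u v : ℕ) : Type := OqM K q u v

instance (u v : ℕ) : Ring (QMat K q u v) := inferInstanceAs (Ring (OqM K q u v))

instance (u v : ℕ) : Algebra K (QMat K q u v) := inferInstanceAs (Algebra K (OqM K q u v))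

/-- The canonical generators of `QMat K q u v`. -/
def Xm (K : Type) [Field K] (q : K) {u v : ℕ} (i : Fin u) (j : Fin v) : QMat K q u v :=
  Xg K q i j

/-- `QMat K q u v` is `O_q(M_{u,v})`. -/
def qmatEquiv (K : Type) [Field K] (q : K) (u v : ℕ) : OqM K q u v ≃ₐ[K] QMat K q u v :=
  AlgEquiv.refl

@[simp] theorem qmatEquiv_Xg (i : Fin u) (j : Fin v) :
    qmatEquiv K q u v (Xg K q i j) = Xm K q i j := rfl

theorem isQM_Xm (K : Type) [Field K] (q : K) (u v : ℕ) :
    IsQM q (Xm K q : Fin u → Fin v → QMat K q u v) := (isQM_Xg K q u v).map (qmatEquiv K q u v).toAlgHom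

/-- The algebra morphism out of `QMat K q u v` determined by a quantum matrix. -/
def qlift {x : Fin u → Fin v → R} (hx : IsQM q x) : QMat K q u v →ₐ[K] R :=
  (oqLift hx).comp (qmatEquiv K q u v).symm.toAlgHom

@[simp] theorem qlift_Xm {x : Fin u → Fin v → R} (hx : IsQM q x) (i j) :
    qlift hx (Xm K q i j) = x i j := oqLift_Xg hx i j

theorem QMat_hom_ext {f g : QMat K q u v →ₐ[K] R} (h : ∀ i j, f (Xm K q i j) = g (Xm K q i j)) :
    f = g := by
  have := OqM_hom_ext (f := f.comp (qmatEquiv K q u v).toAlgHom)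
    (g := g.comp (qmatEquiv K q u v).toAlgHom) h
  ext x
  exact congrArg (fun F : OqM K q u v →ₐ[K] R => F x) this

theorem QMat_induction {p : QMat K q u v → Prop} (one : p 1) (add : ∀ x y, p x → p y → p (x + y))
    (smul : ∀ (c : K) x, p x → p (c • x)) (mul : ∀ i j x, p x → p (Xm K q i j * x)) (x) : p x :=
  OqM_induction (p := fun y => p (qmatEquiv K q u v y)) one (fun _ _ => add _ _) (fun _ _ => smul _ _)
    (fun i j _ => mul i j _) x

end QuantumMatrices

section LaurentModel

variable {K : Type} [Field K]

/-- The exponent sequence `P` lowered by one on the interval `[r, j]`. -/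
def lowerOn (r j : ℕ) (P : ℕ → ℤ) (n : ℕ) : ℤ := P n - if r ≤ n ∧ n ≤ j then 1 else 0

/-- The structure constants of the action of quantum matrices on a quantum row, in terms of the
partial sums of exponents. -/
def rowCoeff (q : K) (r j : ℕ) (P : ℕ → ℤ) : K :=
  if r ≤ j then (if r = 0 then 1 else -q * (1 - q ^ (2 * (P (r - 1) - P r)))) * q ^ (P r - P j)
  else if r = j + 1 then q ^ (P j - P r) else 0

variable {q : K}

theorem rowCoeff_row (hq : q ≠ 0) {r j l : ℕ} (h : j < l) (P : ℕ → ℤ) :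
    rowCoeff q r l P * rowCoeff q r j (lowerOn r l P) =
      q * (rowCoeff q r j P * rowCoeff q r l (lowerOn r j P)) := by
  unfold rowCoeff lowerOn
  rcases r with _ | r <;> split_ifs <;> first
    | omega
    | (simp_all [zpow_sub₀, zpow_mul, mul_sub]; try (field_simp; try ring))

theorem rowCoeff_col (hq : q ≠ 0) {r s j : ℕ} (h : r < s) (P : ℕ → ℤ) :
    rowCoeff q s j P * rowCoeff q r j (lowerOn s j P) =
      q * (rowCoeff q r j P * rowCoeff q s j (lowerOn r j P)) := by
  unfold rowCoeff lowerOn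
  rcases r with _ | r <;> split_ifs <;> first
    | omega
    | (simp_all [zpow_sub₀, zpow_mul, mul_sub]; try (field_simp; try ring))

theorem rowCoeff_comm (hq : q ≠ 0) {r s j l : ℕ} (h : r < s) (h' : l < j) (P : ℕ → ℤ) :
    rowCoeff q s l P * rowCoeff q r j (lowerOn s l P) =
      rowCoeff q r j P * rowCoeff q s l (lowerOn r j P) := by
  unfold rowCoeff lowerOn
  rcases r with _ | r <;> split_ifs <;> first
    | omega
    | (simp_all [zpow_sub₀, zpow_mul, mul_sub]; try (field_simp; try ring))

theorem rowCoeff_of_le {r j : ℕ} (h : r ≤ j) (P : ℕ → ℤ) : rowCoeff q r j P =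
    (if r = 0 then 1 else -q * (1 - q ^ (2 * (P (r - 1) - P r)))) * q ^ (P r - P j) :=
  if_pos h

theorem rowCoeff_of_lt {r j : ℕ} (h : j + 1 < r) (P : ℕ → ℤ) : rowCoeff q r j P = 0 := by
  rw [rowCoeff, if_neg (by omega), if_neg (by omega)]

theorem rowCoeff_succ (j : ℕ) (P : ℕ → ℤ) : rowCoeff q (j + 1) j P = q ^ (P j - P (j + 1)) := by
  rw [rowCoeff, if_neg (by omega), if_pos rfl]

theorem rowCoeff_congr {r j : ℕ} {P P' : ℕ → ℤ} (h₀ : P (r - 1) - P r = P' (r - 1) - P' r)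
    (h₁ : P r - P j = P' r - P' j) : rowCoeff q r j P = rowCoeff q r j P' := by
  have h₂ : P j - P r = P' j - P' r := by omega
  simp only [rowCoeff, h₀, h₁, h₂]

theorem rowCoeff_quantum (hq : q ≠ 0) {r s j l : ℕ} (h : r < s) (h' : j < l) (P : ℕ → ℤ) :
    rowCoeff q s l P * rowCoeff q r j (lowerOn s l P) =
      rowCoeff q r j P * rowCoeff q s l (lowerOn r j P) +
        (q - q⁻¹) * (rowCoeff q s j P * rowCoeff q r l (lowerOn s j P)) := by
  rcases lt_trichotomy s (j + 1) with hs | rfl | hs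
  · rw [rowCoeff_of_le (r := r) (by omega), rowCoeff_of_le (r := r) (by omega),
      rowCoeff_of_le (r := r) (by omega), rowCoeff_of_le (r := s) (by omega),
      rowCoeff_of_le (r := s) (by omega), rowCoeff_of_le (r := s) (by omega)]
    simp only [if_neg (show s ≠ 0 by omega)]
    have e₁ : lowerOn s l P (r - 1) - lowerOn s l P r = P (r - 1) - P r := by
      simp only [lowerOn]; split_ifs <;> omega
    have e₂ : lowerOn s j P (r - 1) - lowerOn s j P r = P (r - 1) - P r := by
      simp only [lowerOn]; split_ifs <;> omega
    have e₃ : lowerOn r j P (s - 1) - lowerOn r j P s = P (s - 1) - P s := by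
      simp only [lowerOn]; split_ifs <;> omega
    have e₄ : lowerOn s l P r - lowerOn s l P j = P r - P j + 1 := by
      simp only [lowerOn]; split_ifs <;> omega
    have e₅ : lowerOn r j P s - lowerOn r j P l = P s - P l - 1 := by
      simp only [lowerOn]; split_ifs <;> omega
    have e₆ : lowerOn s j P r - lowerOn s j P l = P r - P j + (P s - P l) - (P s - P j) := by
      simp only [lowerOn]; split_ifs <;> omega
    rw [e₁, e₂, e₃, e₄, e₅, e₆, zpow_sub₀ hq (P r - P j + (P s - P l)), zpow_add₀ hq (P r - P j),
      zpow_add₀ hq (P r - P j), zpow_sub₀ hq (P s - P l), zpow_one]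
    generalize (if r = 0 then (1 : K) else -q * (1 - q ^ (2 * (P (r - 1) - P r)))) = A
    generalize -q * (1 - q ^ (2 * (P (s - 1) - P s))) = B
    have := zpow_ne_zero (P s - P j) hq
    field_simp
    ring
  · rw [rowCoeff_of_le (r := r) (by omega), rowCoeff_of_le (r := r) (by omega),
      rowCoeff_of_le (r := r) (by omega), rowCoeff_of_le (r := j + 1) (by omega),
      rowCoeff_of_le (r := j + 1) (by omega), rowCoeff_succ]
    simp only [if_neg (show j + 1 ≠ 0 by omega)]
    have e₁ : lowerOn (j + 1) l P (r - 1) - lowerOn (j + 1) l P r = P (r - 1) - P r := by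
      simp only [lowerOn]; split_ifs <;> omega
    have e₂ : lowerOn (j + 1) j P (r - 1) - lowerOn (j + 1) j P r = P (r - 1) - P r := by
      simp only [lowerOn]; split_ifs <;> omega
    have e₃ : lowerOn r j P (j + 1 - 1) - lowerOn r j P (j + 1) = P j - P (j + 1) - 1 := by
      simp only [lowerOn, Nat.add_sub_cancel]; split_ifs <;> omega
    have e₄ : lowerOn (j + 1) l P r - lowerOn (j + 1) l P j = P r - P j := by
      simp only [lowerOn]; split_ifs <;> omega
    have e₅ : lowerOn r j P (j + 1) - lowerOn r j P l = P (j + 1) - P l := by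
      simp only [lowerOn]; split_ifs <;> omega
    have e₆ : lowerOn (j + 1) j P r - lowerOn (j + 1) j P l =
        P r - P j + (P j - P (j + 1)) + (P (j + 1) - P l) := by
      simp only [lowerOn]; split_ifs <;> omega
    rw [e₁, e₂, e₃, e₄, e₅, e₆, zpow_add₀ hq (P r - P j + (P j - P (j + 1))),
      zpow_add₀ hq (P r - P j), Nat.add_sub_cancel, mul_comm 2 (P j - P (j + 1)),
      mul_comm 2 (P j - P (j + 1) - 1), zpow_mul q (P j - P (j + 1)),
      zpow_mul q (P j - P (j + 1) - 1), zpow_sub₀ hq (P j - P (j + 1)), zpow_one]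
    generalize (if r = 0 then (1 : K) else -q * (1 - q ^ (2 * (P (r - 1) - P r)))) = A
    generalize q ^ (P j - P (j + 1)) = B
    simp only [zpow_ofNat]
    field_simp
    ring
  · rw [rowCoeff_of_lt (r := s) (j := j) (by omega), zero_mul, mul_zero, add_zero, mul_comm]
    rcases lt_or_ge (j + 1) r with hr | hr
    · rw [rowCoeff_of_lt hr, rowCoeff_of_lt hr, zero_mul, zero_mul]
    · congr 1 <;> refine rowCoeff_congr ?_ ?_ <;> simp only [lowerOn] <;> split_ifs <;> omega

end LaurentModel
section RowMonomials

variable {K : Type} [Field K] {q : K} {R : Type} [Ring R] [Algebra K R] {v : ℕ}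

/-- The ordered monomial `x_0^{k_0} ⋯ x_{v-1}^{k_{v-1}}`. -/
def rowmon (x : Fin v → R) (k : Fin v → ℕ) : R := (List.ofFn fun j => x j ^ k j).prod

/-- The scalar produced by moving `x_c` into its place in an ordered monomial. -/
def insertCoeff (q : K) (c : Fin v) (k : Fin v → ℕ) : K :=
  q⁻¹ ^ ∑ l, if l < c then k l else 0

theorem insertCoeff_ne_zero (hq : q ≠ 0) (c : Fin v) (k : Fin v → ℕ) : insertCoeff q c k ≠ 0 :=
  pow_ne_zero _ (inv_ne_zero hq)

@[simp] theorem rowmon_zero (x : Fin v → R) : rowmon x 0 = 1 := by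
  simp [rowmon, List.ofFn_const]

theorem rowmon_succ (x : Fin (v + 1) → R) (k : Fin (v + 1) → ℕ) :
    rowmon x k = x 0 ^ k 0 * rowmon (fun j => x j.succ) fun j => k j.succ := by
  simp [rowmon, List.ofFn_succ]

theorem mul_rowmon (hq : q ≠ 0) {x : Fin v → R} (hx : ∀ {j l}, j < l → x j * x l = q • (x l * x j))
    (c : Fin v) (k : Fin v → ℕ) :
    x c * rowmon x k = insertCoeff q c k • rowmon x (k + Pi.single c 1) := by
  induction v with
  | zero => exact c.elim0
  | succ v ih =>
    rw [rowmon_succ, rowmon_succ]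
    refine Fin.cases ?_ (fun c => ?_) c
    · have : (fun j : Fin v => (k + Pi.single 0 1 : Fin (v + 1) → ℕ) j.succ) =
          fun j : Fin v => k j.succ := by
        funext j; simp
      rw [this, ← mul_assoc, ← pow_succ']
      simp [insertCoeff]
    · have hs (n : ℕ) : x c.succ * x 0 ^ n = q⁻¹ ^ n • (x 0 ^ n * x c.succ) := by
        induction n with
        | zero => simp
        | succ n ih =>
          have h1 : x c.succ * x 0 = q⁻¹ • (x 0 * x c.succ) := by
            rw [hx (Fin.succ_pos c), smul_smul, inv_mul_cancel₀ hq, one_smul]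
          rw [pow_succ, ← mul_assoc, ih, smul_mul_assoc, mul_assoc, h1, mul_smul_comm, smul_smul,
            ← pow_succ, mul_assoc]
      have h2 := ih (x := fun j => x j.succ) (fun h => hx (Fin.succ_lt_succ_iff.2 h)) c
        (fun j => k j.succ)
      have h3 : (fun j : Fin v => (k + Pi.single c.succ 1 : Fin (v + 1) → ℕ) j.succ) =
          (fun j : Fin v => k j.succ) + Pi.single c 1 := by
        funext j; simp [Pi.single_apply]
      rw [h3, ← mul_assoc, hs, smul_mul_assoc, mul_assoc, h2, mul_smul_comm, smul_smul]
      congr 1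
      simp [insertCoeff, Fin.sum_univ_succ, pow_add]

theorem rowExp_induction {p : (Fin v → ℕ) → Prop} (zero : p 0)
    (step : ∀ c k, p k → p (k + Pi.single c 1)) (k) : p k := by
  generalize hn : ∑ j, k j = n
  induction n generalizing k with
  | zero =>
    have : k = 0 := by
      funext j; exact (Finset.sum_eq_zero_iff.1 hn) j (Finset.mem_univ j)
    exact this ▸ zero
  | succ n ih =>
    obtain ⟨c, -, hc⟩ : ∃ c ∈ Finset.univ, k c ≠ 0 :=
      Finset.exists_ne_zero_of_sum_ne_zero (by omega)
    have hk : k = (k - Pi.single c 1) + Pi.single c 1 := by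
      refine (tsub_add_cancel_of_le fun j => ?_).symm
      by_cases h : j = c
      · subst h; simp; omega
      · simp [h]
    rw [hk]
    refine step c _ (ih _ ?_)
    rw [hk] at hn
    simpa [Finset.sum_add_distrib] using hn

theorem rowmon_step (hq : q ≠ 0) {x : Fin v → R}
    (hx : ∀ {j l}, j < l → x j * x l = q • (x l * x j)) (c : Fin v) (k : Fin v → ℕ) :
    rowmon x (k + Pi.single c 1) = (insertCoeff q c k)⁻¹ • (x c * rowmon x k) := by
  rw [mul_rowmon hq hx, smul_smul, inv_mul_cancel₀ (insertCoeff_ne_zero hq c k), one_smul]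

end RowMonomials

section RowRepresentation

variable {K : Type} [Field K] {q : K} {A : Type} [Ring A] [Algebra K A] {u v : ℕ}

theorem lowerOn_comm (r j s l : ℕ) (P : ℕ → ℤ) :
    lowerOn r j (lowerOn s l P) = lowerOn s l (lowerOn r j P) := by
  funext n; simp only [lowerOn]; ring

theorem lowerOn_exchange {r j s l : ℕ} (h₀ : r ≤ s) (h₁ : j ≤ l) (h₂ : s ≤ j + 1) (P : ℕ → ℤ) :
    lowerOn r j (lowerOn s l P) = lowerOn r l (lowerOn s j P) := by
  funext n; simp only [lowerOn]; split_ifs <;> omega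

/-- The operators of a quantum matrix acting on Laurent polynomials with coefficients in `A`. -/
def rowOp (A : Type) [Ring A] [Algebra K A] (q : K) (r j : ℕ) :
    Module.End K ((ℕ → ℤ) →₀ A) :=
  Finsupp.lsum K fun P => rowCoeff q r j P • Finsupp.lsingle (lowerOn r j P)

theorem rowOp_single (r j : ℕ) (P : ℕ → ℤ) (a : A) :
    rowOp A q r j (Finsupp.single P a) =
      rowCoeff q r j P • Finsupp.single (lowerOn r j P) a := by
  rw [rowOp, Finsupp.lsum_single]; rfl

theorem isQM_rowOp (hq : q ≠ 0) :
    IsQM q fun (r : Fin (v + 1)) (j : Fin v) => rowOp A q (r : ℕ) (j : ℕ) where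
  row {r j l} h := by
    refine Finsupp.lhom_ext fun P a => ?_
    simp only [Module.End.mul_apply, LinearMap.smul_apply, rowOp_single, map_smul, smul_smul]
    rw [rowCoeff_row hq (show (j : ℕ) < l from h), lowerOn_comm]
  col {r s j} h := by
    refine Finsupp.lhom_ext fun P a => ?_
    simp only [Module.End.mul_apply, LinearMap.smul_apply, rowOp_single, map_smul, smul_smul]
    rw [rowCoeff_col hq (show (r : ℕ) < s from h), lowerOn_comm]
  comm {r s j l} h h' := by
    refine Finsupp.lhom_ext fun P a => ?_
    simp only [Module.End.mul_apply, rowOp_single, map_smul, smul_smul]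
    rw [rowCoeff_comm hq (show (r : ℕ) < s from h) (show (l : ℕ) < j from h'), lowerOn_comm]
  quantum {r s j l} h h' := by
    refine Finsupp.lhom_ext fun P a => ?_
    have h : (r : ℕ) < s := h
    have h' : (j : ℕ) < l := h'
    simp only [Module.End.mul_apply, LinearMap.add_apply, LinearMap.smul_apply, rowOp_single,
      map_smul, smul_smul]
    rw [rowCoeff_quantum hq h h', lowerOn_comm s l, add_smul]
    congr 1
    by_cases hs : (s : ℕ) ≤ j + 1
    · rw [lowerOn_exchange h.le h'.le hs]
    · simp [rowCoeff_of_lt (r := s) (j := j) (by omega)]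

theorem IsQM.block {x : Fin u → Fin v → A} (hx : IsQM q x) :
    IsQM q (Fin.cons (Fin.cons 1 fun _ => 0) fun i => Fin.cons 0 (x i) :
      Fin (u + 1) → Fin (v + 1) → A) where
  row {i j k} h := by
    cases i using Fin.cases <;> cases j using Fin.cases <;> cases k using Fin.cases <;>
      simp_all [hx.row]
  col {i j k} h := by
    cases i using Fin.cases <;> cases j using Fin.cases <;> cases k using Fin.cases <;>
      simp_all [hx.col]
  comm {i j k l} h h' := by
    cases i using Fin.cases <;> cases j using Fin.cases <;> cases k using Fin.cases <;>
      cases l using Fin.cases <;> simp_all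
    exact hx.comm h h'
  quantum {i j k l} h h' := by
    cases i using Fin.cases <;> cases j using Fin.cases <;> cases k using Fin.cases <;>
      cases l using Fin.cases <;> simp_all
    exact hx.quantum h h'

theorem isQM_peel (hq : q ≠ 0) :
    IsQM q fun (i : Fin (u + 1)) (j : Fin v) => ∑ a, Algebra.lsmul K K ((ℕ → ℤ) →₀ QMat K q u v)
      ((Fin.cons (Fin.cons 1 fun _ => 0) fun i => Fin.cons 0 (Xm K q i) :
        Fin (u + 1) → Fin (v + 1) → QMat K q u v) i a) *
      rowOp (QMat K q u v) q (a : ℕ) (j : ℕ) := by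
  refine ((isQM_Xm K q u v).block.map _).mul hq (isQM_rowOp hq) fun i a b j => ?_
  refine Finsupp.lhom_ext fun P a => ?_
  simp only [Module.End.mul_apply, Algebra.lsmul_coe, rowOp_single, Finsupp.smul_single,
    smul_eq_mul, mul_smul_comm]

/-- The representation of `O_q(M_{u+1,v})` on Laurent polynomials over `O_q(M_{u,v})`. -/
def peelRep (u v : ℕ) (hq : q ≠ 0) :
    QMat K q (u + 1) v →ₐ[K] Module.End K ((ℕ → ℤ) →₀ QMat K q u v) :=
  qlift (isQM_peel hq)

theorem peelRep_zero (hq : q ≠ 0) (j : Fin v) :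
    peelRep u v hq (Xm K q 0 j) = rowOp (QMat K q u v) q 0 (j : ℕ) := by
  simp [peelRep, Fin.sum_univ_succ]

theorem peelRep_succ (hq : q ≠ 0) (i : Fin u) (j : Fin v) (a : QMat K q u v) :
    peelRep u v hq (Xm K q i.succ j) (Finsupp.single 0 a) =
      Finsupp.single 0 (Xm K q i j * a) := by
  have h (l : Fin v) : rowOp (QMat K q u v) q ((l.succ : Fin (v + 1)) : ℕ) (j : ℕ)
      (Finsupp.single 0 a) = if l = j then Finsupp.single 0 a else 0 := by
    rw [rowOp_single, Fin.val_succ]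
    rcases lt_trichotomy l j with h | h | h
    · have h' : (l : ℕ) < j := h
      rw [if_neg h.ne, rowCoeff_of_le (by omega)]
      simp
    · rw [if_pos h, h, rowCoeff_succ]
      have : lowerOn ((j : ℕ) + 1) j 0 = 0 := by
        funext n; simp only [lowerOn]; rw [if_neg (by omega)]; simp
      simp [this]
    · have h' : (j : ℕ) < l := h
      rw [if_neg h.ne', rowCoeff_of_lt (by omega), zero_smul]
  rw [peelRep, qlift_Xm, Fin.sum_univ_succ]
  simp [Module.End.mul_apply, h, -Finsupp.single_mul, -Fin.val_succ, Finsupp.smul_single]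

end RowRepresentation

section Peeling

variable {K : Type} [Field K] {q : K} {u v : ℕ}

/-- The inclusion of `O_q(M_{u,v})` into `O_q(M_{u+1,v})` avoiding the first row. -/
def inclRow : QMat K q u v →ₐ[K] QMat K q (u + 1) v :=
  qlift (x := fun i j => Xm K q i.succ j)
    { row := fun h => (isQM_Xm K q _ _).row h
      col := fun h => (isQM_Xm K q _ _).col (Fin.succ_lt_succ_iff.2 h)
      comm := fun h h' => (isQM_Xm K q _ _).comm (Fin.succ_lt_succ_iff.2 h) h'
      quantum := fun h h' => (isQM_Xm K q _ _).quantum (Fin.succ_lt_succ_iff.2 h) h' }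

@[simp] theorem inclRow_Xm (i : Fin u) (j : Fin v) :
    inclRow (Xm K q i j) = Xm K q i.succ j := qlift_Xm _ _ _

/-- Assembling an element of `O_q(M_{u+1,v})` from its coefficients along the monomials in the
first row. -/
def assemble : ((Fin v → ℕ) →₀ QMat K q u v) →ₗ[K] QMat K q (u + 1) v :=
  Finsupp.lsum K fun k => LinearMap.mulLeft K (rowmon (Xm K q 0) k) ∘ₗ inclRow.toLinearMap

@[simp] theorem assemble_single (k : Fin v → ℕ) (a : QMat K q u v) :
    assemble (Finsupp.single k a) = rowmon (Xm K q 0) k * inclRow a := by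
  simp [assemble]

theorem Xm_zero_mul_rowmon (hq : q ≠ 0) (c : Fin v) (k : Fin v → ℕ) :
    Xm K q (0 : Fin (u + 1)) c * rowmon (Xm K q 0) k =
      insertCoeff q c k • rowmon (Xm K q (0 : Fin (u + 1))) (k + Pi.single c 1) :=
  mul_rowmon hq (fun h => (isQM_Xm K q (u + 1) v).row h) c k

theorem rowmon_Xm_step (hq : q ≠ 0) (c : Fin v) (k : Fin v → ℕ) :
    rowmon (Xm K q (0 : Fin (u + 1))) (k + Pi.single c 1) =
      (insertCoeff q c k)⁻¹ • (Xm K q 0 c * rowmon (Xm K q 0) k) :=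
  rowmon_step hq (fun h => (isQM_Xm K q (u + 1) v).row h) c k

theorem Xm_zero_mul_mem_range (hq : q ≠ 0) (c : Fin v) {y : QMat K q (u + 1) v}
    (hy : y ∈ LinearMap.range (assemble (K := K) (q := q) (u := u) (v := v))) :
    Xm K q 0 c * y ∈ LinearMap.range (assemble (K := K) (q := q) (u := u) (v := v)) := by
  obtain ⟨f, rfl⟩ := hy
  induction f using Finsupp.induction_linear with
  | zero => simp
  | add f g hf hg => rw [map_add, mul_add]; exact Submodule.add_mem _ hf hg
  | single k a =>
    rw [assemble_single, ← mul_assoc, Xm_zero_mul_rowmon hq, smul_mul_assoc, ← assemble_single]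
    exact Submodule.smul_mem _ _ ⟨_, rfl⟩

theorem Xm_succ_mul_mem_range (hq : q ≠ 0) (k : Fin v → ℕ) :
    ∀ (i : Fin u) (j : Fin v) (a : QMat K q u v),
      Xm K q i.succ j * (rowmon (Xm K q 0) k * inclRow a) ∈
        LinearMap.range (assemble (K := K) (q := q) (u := u) (v := v)) := by
  induction k using rowExp_induction with
  | zero =>
    intro i j a
    refine ⟨Finsupp.single 0 (Xm K q i j * a), ?_⟩
    rw [assemble_single]
    simp
  | step c k ih =>
    intro i j a
    rw [rowmon_Xm_step hq, smul_mul_assoc, mul_smul_comm]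
    refine Submodule.smul_mem _ _ ?_
    have hX := isQM_Xm K q (u + 1) v
    have hi : (0 : Fin (u + 1)) < i.succ := Fin.succ_pos i
    have e (X Y Z : QMat K q (u + 1) v) : X * (Y * Z * inclRow a) = X * Y * (Z * inclRow a) := by
      simp only [mul_assoc]
    rw [e]
    rcases lt_trichotomy j c with h | rfl | h
    · rw [← hX.comm hi h, mul_assoc]
      exact Xm_zero_mul_mem_range hq _ (ih i j a)
    · have : Xm K q i.succ j * Xm K q 0 j = q⁻¹ • (Xm K q 0 j * Xm K q i.succ j) := by
        rw [hX.col hi, smul_smul, inv_mul_cancel₀ hq, one_smul]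
      rw [this, smul_mul_assoc, mul_assoc]
      exact Submodule.smul_mem _ _ (Xm_zero_mul_mem_range hq _ (ih i j a))
    · have : Xm K q i.succ j * Xm K q 0 c = Xm K q 0 c * Xm K q i.succ j -
          (q - q⁻¹) • (Xm K q 0 j * Xm K q i.succ c) := by
        rw [hX.quantum hi h, add_sub_cancel_right]
      rw [this, sub_mul, smul_mul_assoc, mul_assoc, mul_assoc]
      exact Submodule.sub_mem _ (Xm_zero_mul_mem_range hq _ (ih i j a))
        (Submodule.smul_mem _ _ (Xm_zero_mul_mem_range hq _ (ih i c a)))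

theorem assemble_surjective (hq : q ≠ 0) :
    Function.Surjective (assemble (K := K) (q := q) (u := u) (v := v)) := by
  intro x
  refine QMat_induction (p := fun x => x ∈ LinearMap.range assemble) ?_ ?_ ?_ ?_ x
  · exact ⟨Finsupp.single 0 1, by simp⟩
  · exact fun _ _ => Submodule.add_mem _
  · exact fun c _ => Submodule.smul_mem _ c
  · intro i j y hy
    refine Fin.cases (Xm_zero_mul_mem_range hq j hy) (fun i => ?_) i
    obtain ⟨f, rfl⟩ := hy
    induction f using Finsupp.induction_linear with
    | zero => simp
    | add f g hf hg => rw [map_add, mul_add]; exact Submodule.add_mem _ hf hg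
    | single k a => rw [assemble_single]; exact Xm_succ_mul_mem_range hq k i j a

/-- The exponent sequence corresponding to a monomial in a quantum row. -/
def rowExp (k : Fin v → ℕ) (n : ℕ) : ℤ := -∑ j : Fin v, if n ≤ j then (k j : ℤ) else 0

theorem rowExp_injective : Function.Injective (rowExp (v := v)) := by
  intro k k' h
  have key (k : Fin v → ℕ) (j : Fin v) : rowExp k (j + 1) - rowExp k j = k j := by
    simp only [rowExp, neg_sub_neg, ← Finset.sum_sub_distrib]
    rw [Finset.sum_eq_single j]
    · simp
    · intro b _ hb
      have : (b : ℕ) ≠ j := fun h => hb (Fin.ext h)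
      split_ifs <;> omega
    · simp
  funext j
  have := key k j
  rw [h, key k' j] at this
  exact_mod_cast this.symm

theorem rowExp_add_single (c : Fin v) (k : Fin v → ℕ) :
    rowExp (k + Pi.single c 1) = lowerOn 0 c (rowExp k) := by
  funext n
  simp only [rowExp, lowerOn]
  have (j : Fin v) : (if n ≤ j then (((k + Pi.single c 1 : Fin v → ℕ) j : ℕ) : ℤ) else 0) =
      (if n ≤ j then (k j : ℤ) else 0) + if j = c then (if n ≤ c then 1 else 0) else 0 := by
    by_cases h : j = c
    · subst h; by_cases h' : n ≤ j <;> simp [h']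
    · simp [h]
  simp only [this, Finset.sum_add_distrib, Finset.sum_ite_eq', Finset.mem_univ, if_true, zero_le,
    true_and]
  ring

theorem rowExp_zero_sub (c : Fin v) (k : Fin v → ℕ) :
    rowExp k 0 - rowExp k c = -((∑ l, if l < c then k l else 0 : ℕ) : ℤ) := by
  simp only [rowExp, neg_sub_neg, ← Finset.sum_sub_distrib, Nat.cast_sum, ← Finset.sum_neg_distrib]
  refine Finset.sum_congr rfl fun l _ => ?_
  by_cases h : l < c
  · have h' : ¬ (c : ℕ) ≤ l := not_le.2 h
    simp [h, h']
  · have h' : (c : ℕ) ≤ l := not_lt.1 h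
    simp [h, h']

theorem peelRep_inclRow (hq : q ≠ 0) (a : QMat K q u v) : ∀ b : QMat K q u v,
    peelRep u v hq (inclRow a) (Finsupp.single 0 b) = Finsupp.single 0 (a * b) := by
  refine QMat_induction (p := fun a => ∀ b : QMat K q u v,
    peelRep u v hq (inclRow a) (Finsupp.single 0 b) = Finsupp.single 0 (a * b)) ?_ ?_ ?_ ?_ a
  · simp [-Finsupp.single_mul]
  · intro x y hx hy b
    rw [map_add, map_add, LinearMap.add_apply, hx, hy, add_mul, Finsupp.single_add]
  · intro c x hx b
    rw [map_smul, map_smul, LinearMap.smul_apply, hx, smul_mul_assoc, Finsupp.smul_single]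
  · intro i j x hx b
    rw [map_mul, map_mul, Module.End.mul_apply, hx, inclRow_Xm, peelRep_succ, mul_assoc]

theorem peelRep_rowmon (hq : q ≠ 0) (k : Fin v → ℕ) (a : QMat K q u v) :
    peelRep u v hq (rowmon (Xm K q 0) k) (Finsupp.single 0 a) = Finsupp.single (rowExp k) a := by
  induction k using rowExp_induction with
  | zero =>
    have : rowExp (0 : Fin v → ℕ) = 0 := by funext n; simp [rowExp]
    simp [this]
  | step c k ih =>
    rw [rowmon_Xm_step hq, map_smul, map_mul, LinearMap.smul_apply, Module.End.mul_apply, ih,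
      peelRep_zero, rowOp_single, smul_smul, rowExp_add_single, rowCoeff_of_le (Nat.zero_le _),
      if_pos rfl, one_mul, rowExp_zero_sub, zpow_neg, zpow_natCast, ← inv_pow]
    rw [← insertCoeff, inv_mul_cancel₀ (insertCoeff_ne_zero hq c k), one_smul]

theorem assemble_injective (hq : q ≠ 0) :
    Function.Injective (assemble (K := K) (q := q) (u := u) (v := v)) := by
  have key (f) : peelRep u v hq (assemble f) (Finsupp.single 0 1) = Finsupp.mapDomain rowExp f := by
    induction f using Finsupp.induction_linear with
    | zero => simp
    | add f g hf hg => rw [map_add, map_add, LinearMap.add_apply, hf, hg, Finsupp.mapDomain_add]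
    | single k a =>
      rw [assemble_single, map_mul, Module.End.mul_apply, peelRep_inclRow, mul_one, peelRep_rowmon,
        Finsupp.mapDomain_single]
  intro f g h
  refine Finsupp.mapDomain_injective rowExp_injective ?_
  rw [← key, ← key, h]

variable [NeZero q]

/-- `O_q(M_{u+1,v})` is free over `O_q(M_{u,v})` on the monomials in the first row. -/
def peelEquiv : ((Fin v → ℕ) →₀ QMat K q u v) ≃ₗ[K] QMat K q (u + 1) v :=
  LinearEquiv.ofBijective assemble
    ⟨assemble_injective (NeZero.ne q), assemble_surjective (NeZero.ne q)⟩

/-- The coefficient of the monomial with exponent `k` in the first row. -/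
def rowPart (k : Fin v → ℕ) : QMat K q (u + 1) v →ₗ[K] QMat K q u v :=
  Finsupp.lapply k ∘ₗ peelEquiv.symm.toLinearMap

theorem rowPart_rowmon_mul (k l : Fin v → ℕ) (a : QMat K q u v) :
    rowPart k (rowmon (Xm K q 0) l * inclRow a) = if l = k then a else 0 := by
  have : rowmon (Xm K q 0) l * inclRow a = peelEquiv (Finsupp.single l a) :=
    (assemble_single l a).symm
  rw [this, rowPart]
  simp [Finsupp.single_apply]

theorem eq_of_rowPart {x y : QMat K q (u + 1) v} (h : ∀ k, rowPart k x = rowPart k y) : x = y :=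
  peelEquiv.symm.injective (Finsupp.ext h)

/-- An element is the sum of its row parts. -/
theorem sum_rowPart (x : QMat K q (u + 1) v) : ∃ s : Finset (Fin v → ℕ),
    (∀ k, rowPart k x ≠ 0 → k ∈ s) ∧ x = ∑ k ∈ s, rowmon (Xm K q 0) k * inclRow (rowPart k x) := by
  refine ⟨(peelEquiv.symm x).support, fun k hk => Finsupp.mem_support_iff.2 hk, ?_⟩
  conv_lhs => rw [← peelEquiv.apply_symm_apply x, ← Finsupp.sum_single (peelEquiv.symm x)]
  rw [Finsupp.sum, map_sum]
  exact Finset.sum_congr rfl fun k _ => assemble_single _ _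

end Peeling

section PBW

variable {K : Type} [Field K] {q : K} {v : ℕ}

/-- The ordered monomial with exponent matrix `a`. -/
def pbw : {u : ℕ} → (Fin u → Fin v → ℕ) → QMat K q u v
  | 0, _ => 1
  | _ + 1, a => rowmon (Xm K q 0) (a 0) * inclRow (pbw (Fin.tail a))

/-- The scalar of an element of `O_q(M_{0,v})`. -/
def qmatZero : QMat K q 0 v →ₐ[K] K :=
  qlift (x := fun i _ => i.elim0)
    { row := fun {i} => i.elim0
      col := fun {i} => i.elim0
      comm := fun {i} => i.elim0
      quantum := fun {i} => i.elim0 }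

theorem algebraMap_qmatZero (x : QMat K q 0 v) : algebraMap K _ (qmatZero x) = x := by
  refine QMat_induction (p := fun x => algebraMap K _ (qmatZero x) = x) ?_ ?_ ?_ ?_ x
  · simp
  · intro x y hx hy; rw [map_add, map_add, hx, hy]
  · intro c x hx; rw [map_smul, smul_eq_mul, map_mul, hx, Algebra.smul_def]
  · exact fun i => i.elim0

variable [NeZero q]

/-- The coordinate of an element at the ordered monomial with exponent matrix `a`. -/
def coord : {u : ℕ} → (Fin u → Fin v → ℕ) → QMat K q u v →ₗ[K] K
  | 0, _ => qmatZero.toLinearMap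
  | _ + 1, a => coord (Fin.tail a) ∘ₗ rowPart (a 0)

theorem coord_succ {u : ℕ} (a : Fin (u + 1) → Fin v → ℕ) (x : QMat K q (u + 1) v) :
    coord a x = coord (Fin.tail a) (rowPart (a 0) x) := rfl

theorem coord_pbw {u : ℕ} (a b : Fin u → Fin v → ℕ) :
    coord a (pbw b : QMat K q u v) = if b = a then 1 else 0 := by
  induction u with
  | zero => simp [coord, pbw, Subsingleton.elim b a]
  | succ u ih =>
    rw [coord_succ, pbw, rowPart_rowmon_mul]
    have : b = a ↔ b 0 = a 0 ∧ Fin.tail b = Fin.tail a := by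
      constructor
      · rintro rfl; exact ⟨rfl, rfl⟩
      · rintro ⟨h₀, h₁⟩; rw [← Fin.cons_self_tail a, ← Fin.cons_self_tail b, h₀, h₁]
    by_cases h : b 0 = a 0
    · simp [h, ih, this]
    · simp [h, this]

theorem eq_of_coord {u : ℕ} {x y : QMat K q u v} (h : ∀ a, coord a x = coord a y) : x = y := by
  induction u with
  | zero => rw [← algebraMap_qmatZero x, ← algebraMap_qmatZero y]; exact congrArg _ (h 0)
  | succ u ih =>
    refine eq_of_rowPart fun k => ih fun a => ?_
    have := h (Fin.cons k a)
    rwa [coord_succ, coord_succ, Fin.tail_cons, Fin.cons_zero] at this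

theorem pbw_mem_span {u : ℕ} (x : QMat K q u v) : x ∈ Submodule.span K (Set.range (pbw (q := q))) := by
  induction u with
  | zero =>
    rw [← algebraMap_qmatZero x, Algebra.algebraMap_eq_smul_one]
    exact Submodule.smul_mem _ _ (Submodule.subset_span ⟨0, rfl⟩)
  | succ u ih =>
    obtain ⟨s, -, hx⟩ := sum_rowPart x
    rw [hx]
    refine Submodule.sum_mem _ fun k _ => ?_
    have hs := Submodule.mem_map_of_mem
      (f := LinearMap.mulLeft K (rowmon (Xm K q 0) k) ∘ₗ inclRow.toLinearMap) (ih (rowPart k x))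
    rw [Submodule.map_span] at hs
    refine Submodule.span_mono ?_ hs
    rintro _ ⟨_, ⟨a, rfl⟩, rfl⟩
    exact ⟨Fin.cons k a, by simp [pbw]⟩

/-- The basis of ordered monomials of `O_q(M_{u,v})`. -/
def pbwBasis (K : Type) [Field K] (q : K) [NeZero q] (u v : ℕ) :
    Module.Basis (Fin u → Fin v → ℕ) K (QMat K q u v) :=
  Module.Basis.mk (v := pbw)
    (by
      rw [linearIndependent_iff]
      intro l hl
      ext a
      have := congrArg (coord a) hl
      rw [Finsupp.linearCombination_apply, Finsupp.sum, map_sum] at this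
      simpa [coord_pbw] using this)
    fun x _ => pbw_mem_span x

@[simp] theorem pbwBasis_apply {u : ℕ} (a : Fin u → Fin v → ℕ) : pbwBasis K q u v a = pbw a :=
  Module.Basis.mk_apply _ _ a

theorem pbwBasis_repr {u : ℕ} (x : QMat K q u v) (a) : (pbwBasis K q u v).repr x a = coord a x := by
  have : (pbwBasis K q u v).coord a = coord a := (pbwBasis K q u v).ext fun b => by
    rw [Module.Basis.coord_apply, Module.Basis.repr_self, pbwBasis_apply, coord_pbw,
      Finsupp.single_apply]
  exact congrArg (fun f : QMat K q u v →ₗ[K] K => f x) this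

end PBW

section Coactions

variable {K : Type} [Field K] {q : K} {R : Type} [Ring R] [Algebra K R] {u t : ℕ}

theorem isQM_coact (hq : q ≠ 0) {φ : Fin t → Fin t → R} (hφ : IsQM q φ) :
    IsQM q fun (i : Fin u) (j : Fin t) => ∑ k,
      (Algebra.TensorProduct.includeLeft (R := K) (S := K) (B := R) (Xm K q i k)) *
        Algebra.TensorProduct.includeRight (R := K) (A := QMat K q u t) (φ k j) :=
  ((isQM_Xm K q u t).map _).mul hq (hφ.map _) fun i a b j => by simp

/-- The matrix with diagonal `d` and superdiagonal `e`. -/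
def bidiag (d e : ℕ → R) (i k : Fin t) : R :=
  if (k : ℕ) = i then d i else if (k : ℕ) = i + 1 then e i else 0

theorem isQM_bidiag {d e : ℕ → R} (hd : ∀ i k, d i * d k = d k * d i)
    (he : ∀ i k, e i * e k = e k * e i) (h₀ : ∀ i, d i * e i = q • (e i * d i))
    (h₁ : ∀ i, e i * d (i + 1) = q • (d (i + 1) * e i))
    (h₂ : ∀ i k, k ≠ i → k ≠ i + 1 → e i * d k = d k * e i) :
    IsQM q (bidiag d e : Fin t → Fin t → R) where
  row {i j k} h := by
    have h : (j : ℕ) < k := h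
    simp only [bidiag]
    split_ifs <;> first | omega | simp [h₀]
  col {i k j} h := by
    have h : (i : ℕ) < k := h
    simp only [bidiag]
    split_ifs with h3 h4 h5 h6 h7 h8 <;> first | omega | simp | (rw [show (k : ℕ) = i + 1 by omega, h₁])
  comm {i k j l} h h' := by
    have h : (i : ℕ) < k := h
    have h' : (l : ℕ) < j := h'
    simp only [bidiag]
    split_ifs <;> first | omega | simp
  quantum {i k j l} h h' := by
    have h : (i : ℕ) < k := h
    have h' : (j : ℕ) < l := h'
    simp only [bidiag]
    split_ifs <;> first | omega | (simp [hd, he]; done) |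
      (simp [h₂ _ _ (show (k : ℕ) ≠ i by omega) (show (k : ℕ) ≠ i + 1 by omega)]) |
      (simp [h₂ _ _ (show (i : ℕ) ≠ k by omega) (show (i : ℕ) ≠ k + 1 by omega)])

variable [NeZero q]

/-- The coaction `X_{ij} ↦ ∑ X_{ik} ⊗ φ_{kj}` determined by a quantum matrix `φ`. -/
def coact {φ : Fin t → Fin t → R} (hφ : IsQM q φ) : QMat K q u t →ₐ[K] QMat K q u t ⊗[K] R :=
  qlift (isQM_coact (NeZero.ne q) hφ)

theorem coact_Xm {φ : Fin t → Fin t → R} (hφ : IsQM q φ) (i : Fin u) (j : Fin t) :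
    coact hφ (Xm K q i j) = ∑ k, Xm K q i k ⊗ₜ[K] φ k j := by
  simp [coact]

/-- The operator obtained from a coaction by evaluating a functional. -/
def coactOp {φ : Fin t → Fin t → R} (hφ : IsQM q φ) (f : R →ₗ[K] K) :
    QMat K q u t →ₗ[K] QMat K q u t :=
  (TensorProduct.rid K _).toLinearMap ∘ₗ f.lTensor _ ∘ₗ (coact hφ).toLinearMap

theorem coactOp_one {φ : Fin t → Fin t → R} (hφ : IsQM q φ) (f : R →ₗ[K] K) :
    coactOp hφ f (1 : QMat K q u t) = f 1 • 1 := by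
  simp [coactOp, Algebra.TensorProduct.one_def]

theorem coactOp_Xm_mul {φ : Fin t → Fin t → R} (hφ : IsQM q φ) (f : R →ₗ[K] K) (i : Fin u)
    (j : Fin t) (x : QMat K q u t) : coactOp hφ f (Xm K q i j * x) =
      ∑ k, Xm K q i k * coactOp hφ (f ∘ₗ LinearMap.mulLeft K (φ k j)) x := by
  have key (y : QMat K q u t) (r : R) (z : QMat K q u t ⊗[K] R) :
      TensorProduct.rid K _ (f.lTensor _ ((y ⊗ₜ[K] r) * z)) =
        y * TensorProduct.rid K _ ((f ∘ₗ LinearMap.mulLeft K r).lTensor _ z) := by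
    induction z using TensorProduct.induction_on with
    | zero => simp
    | tmul a b => simp
    | add a b ha hb => rw [mul_add, map_add, map_add, ha, hb, map_add, map_add, mul_add]
  simp only [coactOp, LinearMap.comp_apply, AlgHom.toLinearMap_apply, LinearEquiv.coe_coe, map_mul,
    coact_Xm, Finset.sum_mul, map_sum, key]

theorem coactOp_smul {φ : Fin t → Fin t → R} (hφ : IsQM q φ) (f : R →ₗ[K] K) (c : K)
    (x : QMat K q u t) : coactOp hφ (c • f) x = c • coactOp hφ f x := by
  simp [coactOp, LinearMap.lTensor_smul]

theorem coactOp_zero {φ : Fin t → Fin t → R} (hφ : IsQM q φ) (x : QMat K q u t) :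
    coactOp hφ 0 x = 0 := by
  simp [coactOp]

theorem coactOp_inclRow {φ : Fin t → Fin t → R} (hφ : IsQM q φ) (x : QMat K q u t) :
    ∀ f : R →ₗ[K] K, coactOp hφ f (inclRow x) = inclRow (coactOp hφ f x) := by
  refine QMat_induction (p := fun x => ∀ f : R →ₗ[K] K, coactOp hφ f (inclRow x) =
    inclRow (coactOp hφ f x)) ?_ ?_ ?_ ?_ x
  · intro f; rw [map_one inclRow, coactOp_one, coactOp_one, map_smul, map_one inclRow]
  · intro x y hx hy f; simp only [map_add, hx, hy]
  · intro c x hx f; simp only [map_smul, hx]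
  · intro i j x hx f
    rw [map_mul, inclRow_Xm, coactOp_Xm_mul, coactOp_Xm_mul, map_sum]
    exact Finset.sum_congr rfl fun k _ => by rw [map_mul, inclRow_Xm, hx]

end Coactions

section Raising

variable {K : Type} [Field K]

/-- The operators on sequences used to evaluate a bidiagonal quantum matrix:
multiplication by `q ^ (s * r)`. -/
def twistEnd (q : K) (s : ℤ) : Module.End K (ℤ → K) where
  toFun h r := q ^ (s * r) * h r
  map_add' _ _ := by funext r; simp [mul_add]
  map_smul' _ _ := by funext r; simp [mul_left_comm]

/-- The shift operator on sequences. -/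
def shiftEnd (K : Type) [Field K] : Module.End K (ℤ → K) where
  toFun h r := h (r - 1)
  map_add' _ _ := rfl
  map_smul' _ _ := rfl

/-- The functional reading off the `r`-th entry of the image of the basic sequence. -/
def slot (K : Type) [Field K] (r : ℤ) : Module.End K (ℤ → K) →ₗ[K] K :=
  LinearMap.proj r ∘ₗ LinearMap.applyₗ (Pi.single 0 1)

/-- The twist attached to the `i`-th diagonal entry. -/
def diagTwist (j i : ℕ) : ℤ := if i = j then 1 else if i = j + 1 then -1 else 0

/-- The superdiagonal entries of the `j`-th raising matrix. -/
def superEnd (K : Type) [Field K] (j i : ℕ) : Module.End K (ℤ → K) :=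
  if i = j then shiftEnd K else 0

theorem twistEnd_mul (q : K) (s s' : ℤ) : twistEnd q s * twistEnd q s' = twistEnd q s' * twistEnd q s := by
  ext h r; simp [twistEnd, mul_left_comm]

theorem slot_one (r : ℤ) : slot K r 1 = if r = 0 then 1 else 0 := by
  simp [slot, Pi.single_apply]

theorem slot_twist (q : K) (r s : ℤ) :
    slot K r ∘ₗ LinearMap.mulLeft K (twistEnd q s) = (q ^ (s * r)) • slot K r := by
  ext g; simp [slot, twistEnd]

theorem slot_shift (r : ℤ) :
    slot K r ∘ₗ LinearMap.mulLeft K (shiftEnd K) = slot K (r - 1) := by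
  ext g; simp [slot, shiftEnd]

variable {q : K} {u t : ℕ}

theorem isQM_raise (hq : q ≠ 0) (j : ℕ) :
    IsQM q (bidiag (fun i => twistEnd q (diagTwist j i)) (superEnd K j) :
      Fin t → Fin t → Module.End K (ℤ → K)) := by
  refine isQM_bidiag (fun _ _ => twistEnd_mul _ _ _) (fun i k => ?_) (fun i => ?_) (fun i => ?_)
    fun i k h h' => ?_
  · simp only [superEnd]; split_ifs <;> simp
  · by_cases h : i = j
    · ext g r
      simp only [superEnd, h, if_true, diagTwist, Module.End.mul_apply, LinearMap.smul_apply,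
        twistEnd, shiftEnd, LinearMap.coe_mk, AddHom.coe_mk, Pi.smul_apply, smul_eq_mul]
      rw [← mul_assoc, ← zpow_one_add₀ hq]
      ring_nf
    · simp [superEnd, h]
  · by_cases h : i = j
    · ext g r
      simp only [superEnd, h, if_true, diagTwist, Module.End.mul_apply, LinearMap.smul_apply,
        twistEnd, shiftEnd, LinearMap.coe_mk, AddHom.coe_mk, Pi.smul_apply, smul_eq_mul]
      rw [← mul_assoc, ← zpow_one_add₀ hq]
      simp only [Nat.succ_ne_self, if_false]
      ring_nf
    · simp [superEnd, h]
  · by_cases h₀ : i = j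
    · subst h₀
      ext g r
      simp [superEnd, diagTwist, h, h', twistEnd]
    · simp [superEnd, h₀]

variable [NeZero q]

/-- The `r`-th divided raising operator for the columns `j`, `j + 1`, up to normalization. -/
def raiseOp (j : ℕ) (r : ℤ) : QMat K q u t →ₗ[K] QMat K q u t :=
  coactOp (isQM_raise (NeZero.ne q) j) (slot K r)

/-- The `r`-th divided lowering operator for the columns `j`, `j + 1`, up to normalization. -/
def lowerOp (j : ℕ) (r : ℤ) : QMat K q u t →ₗ[K] QMat K q u t :=
  coactOp (isQM_raise (NeZero.ne q) j).transpose (slot K r)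

theorem raiseOp_one (j : ℕ) (r : ℤ) :
    raiseOp j r (1 : QMat K q u t) = if r = 0 then 1 else 0 := by
  rw [raiseOp, coactOp_one, slot_one]; split_ifs <;> simp

theorem lowerOp_one (j : ℕ) (r : ℤ) :
    lowerOp j r (1 : QMat K q u t) = if r = 0 then 1 else 0 := by
  rw [lowerOp, coactOp_one, slot_one]; split_ifs <;> simp

theorem raiseOp_inclRow (j : ℕ) (r : ℤ) (x : QMat K q u t) :
    raiseOp j r (inclRow x) = inclRow (raiseOp j r x) := coactOp_inclRow _ _ _

theorem coactOp_diag (i : Fin u) (j : ℕ) (c : Fin t) (r : ℤ) (x : QMat K q u t)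
    (φ : Fin t → Fin t → Module.End K (ℤ → K)) (hφ : IsQM q φ)
    (h : ∀ k, k ≠ c → φ k c = 0) (hc : φ c c = twistEnd q (diagTwist j c)) :
    coactOp hφ (slot K r) (Xm K q i c * x) =
      q ^ (diagTwist j c * r) • (Xm K q i c * coactOp hφ (slot K r) x) := by
  rw [coactOp_Xm_mul, Finset.sum_eq_single c]
  · rw [hc, slot_twist, coactOp_smul, mul_smul_comm]
  · intro k _ hk
    rw [h k hk]
    simp [coactOp_zero]
  · simp

theorem coactOp_two (i : Fin u) (j : ℕ) (c c' : Fin t) (hcc' : c ≠ c') (r : ℤ) (x : QMat K q u t)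
    (φ : Fin t → Fin t → Module.End K (ℤ → K)) (hφ : IsQM q φ)
    (h : ∀ k, k ≠ c → k ≠ c' → φ k c = 0) (hc : φ c c = twistEnd q (diagTwist j c))
    (hc' : φ c' c = shiftEnd K) :
    coactOp hφ (slot K r) (Xm K q i c * x) =
      q ^ (diagTwist j c * r) • (Xm K q i c * coactOp hφ (slot K r) x) +
        Xm K q i c' * coactOp hφ (slot K (r - 1)) x := by
  rw [coactOp_Xm_mul, Fintype.sum_eq_add c c' hcc']
  · rw [hc, hc', slot_twist, slot_shift, coactOp_smul, mul_smul_comm]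
  · intro k hk
    rw [h k hk.1 hk.2]
    simp [coactOp_zero]

theorem raiseOp_Xm_mul (i : Fin u) {j : ℕ} {c : Fin t} (hc : (c : ℕ) ≠ j + 1) (r : ℤ)
    (x : QMat K q u t) : raiseOp j r (Xm K q i c * x) =
      q ^ (diagTwist j c * r) • (Xm K q i c * raiseOp j r x) := by
  refine coactOp_diag i j c r x _ _ (fun k hk => ?_) (by simp [bidiag])
  have : (c : ℕ) ≠ k := fun h => hk (Fin.ext h.symm)
  simp only [bidiag, this, if_false, superEnd]
  split_ifs <;> first | rfl | omega

theorem raiseOp_Xm_succ_mul (i : Fin u) {j : ℕ} {c c' : Fin t} (hc : (c : ℕ) = j)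
    (hc' : (c' : ℕ) = j + 1) (r : ℤ) (x : QMat K q u t) : raiseOp j r (Xm K q i c' * x) =
      q ^ (-r) • (Xm K q i c' * raiseOp j r x) + Xm K q i c * raiseOp j (r - 1) x := by
  have := coactOp_two i j c' c (fun h => by simp [h, hc] at hc') r x _
    (isQM_raise (NeZero.ne q) j) (fun k hk hk' => ?_) (by simp [bidiag])
    (by simp [bidiag, superEnd, hc, hc'])
  · simpa [diagTwist, hc', raiseOp] using this
  · have h₁ : (c' : ℕ) ≠ k := fun h => hk (Fin.ext h.symm)
    have h₂ : (c : ℕ) ≠ k := fun h => hk' (Fin.ext h.symm)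
    simp only [bidiag, h₁, if_false, superEnd]
    split_ifs <;> first | rfl | omega

theorem lowerOp_Xm_mul (i : Fin u) {j : ℕ} {c : Fin t} (hc : (c : ℕ) ≠ j) (r : ℤ)
    (x : QMat K q u t) : lowerOp j r (Xm K q i c * x) =
      q ^ (diagTwist j c * r) • (Xm K q i c * lowerOp j r x) := by
  refine coactOp_diag i j c r x _ _ (fun k hk => ?_) (by simp [bidiag])
  have : (k : ℕ) ≠ c := fun h => hk (Fin.ext h)
  simp only [bidiag, this, if_false, superEnd]
  split_ifs <;> rfl

theorem lowerOp_Xm_self_mul (i : Fin u) {j : ℕ} {c c' : Fin t} (hc : (c : ℕ) = j)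
    (hc' : (c' : ℕ) = j + 1) (r : ℤ) (x : QMat K q u t) : lowerOp j r (Xm K q i c * x) =
      q ^ r • (Xm K q i c * lowerOp j r x) + Xm K q i c' * lowerOp j (r - 1) x := by
  have := coactOp_two i j c c' (fun h => by simp [← h, hc] at hc') r x _
    (isQM_raise (NeZero.ne q) j).transpose (fun k hk hk' => ?_) (by simp [bidiag])
    (by simp [bidiag, superEnd, hc, hc'])
  · simpa [diagTwist, hc, lowerOp] using this
  · have h₁ : (k : ℕ) ≠ c := fun h => hk (Fin.ext h)
    have h₂ : (k : ℕ) ≠ c' := fun h => hk' (Fin.ext h)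
    simp only [bidiag, h₁, if_false, superEnd]
    split_ifs <;> first | rfl | omega

theorem raiseOp_of_neg (j : ℕ) (x : QMat K q u t) : ∀ r : ℤ, r < 0 → raiseOp j r x = 0 := by
  refine QMat_induction (p := fun x => ∀ r : ℤ, r < 0 → raiseOp j r x = 0) ?_ ?_ ?_ ?_ x
  · intro r hr; rw [raiseOp_one, if_neg hr.ne]
  · intro x y hx hy r hr; rw [map_add, hx r hr, hy r hr, add_zero]
  · intro c x hx r hr; rw [map_smul, hx r hr, smul_zero]
  · intro i c x hx r hr
    by_cases hc : (c : ℕ) = j + 1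
    · rw [raiseOp_Xm_succ_mul i (c := ⟨j, by omega⟩) rfl hc, hx _ hr, hx _ (by omega)]; simp
    · rw [raiseOp_Xm_mul i hc, hx _ hr]; simp

theorem raiseOp_zero (j : ℕ) (x : QMat K q u t) : raiseOp j 0 x = x := by
  refine QMat_induction (p := fun x => raiseOp j 0 x = x) ?_ ?_ ?_ ?_ x
  · rw [raiseOp_one, if_pos rfl]
  · intro x y hx hy; rw [map_add, hx, hy]
  · intro c x hx; rw [map_smul, hx]
  · intro i c x hx
    by_cases hc : (c : ℕ) = j + 1
    · rw [raiseOp_Xm_succ_mul i (c := ⟨j, by omega⟩) rfl hc, hx, raiseOp_of_neg _ _ _ (by omega)]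
      simp
    · rw [raiseOp_Xm_mul i hc, hx]; simp

end Raising

section Weights

/-- Extension by zero of a finite sequence. -/
def extZero {t : ℕ} (k : Fin t → ℕ) (c : ℕ) : ℕ := if h : c < t then k ⟨c, h⟩ else 0

@[simp] theorem extZero_val {t : ℕ} (k : Fin t → ℕ) (c : Fin t) : extZero k c = k c := by
  simp [extZero]

theorem extZero_of_le {t : ℕ} (k : Fin t → ℕ) {c : ℕ} (h : t ≤ c) : extZero k c = 0 := by
  simp [extZero, h]

/-- The column sums of an exponent matrix. -/
def colsum {u t : ℕ} (a : Fin u → Fin t → ℕ) (c : ℕ) : ℕ := ∑ i, extZero (a i) c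

theorem colsum_zero {t : ℕ} (a : Fin 0 → Fin t → ℕ) (c : ℕ) : colsum a c = 0 := rfl

theorem colsum_succ {u t : ℕ} (a : Fin (u + 1) → Fin t → ℕ) (c : ℕ) :
    colsum a c = extZero (a 0) c + colsum (Fin.tail a) c := Fin.sum_univ_succ _

theorem colsum_of_le {u t : ℕ} (a : Fin u → Fin t → ℕ) {c : ℕ} (h : t ≤ c) : colsum a c = 0 :=
  Finset.sum_eq_zero fun i _ => extZero_of_le (a i) h

/-- The weight of an exponent matrix. -/
def weight {u t : ℕ} (a : Fin u → Fin t → ℕ) (c : ℕ) : ℤ := colsum a c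

variable {K : Type} [Field K] {q : K} {u t : ℕ}

/-- The translation operators on functions of a weight. -/
def weightShift (K : Type) [Field K] (c : ℕ) : Module.End K ((ℕ → ℤ) → K) where
  toFun h r := h (r - Pi.single c 1)
  map_add' _ _ := rfl
  map_smul' _ _ := rfl

open Classical in
/-- The functional reading off one weight. -/
def weightSlot (K : Type) [Field K] (μ : ℕ → ℤ) : Module.End K ((ℕ → ℤ) → K) →ₗ[K] K :=
  LinearMap.proj μ ∘ₗ LinearMap.applyₗ (Pi.single 0 1)

theorem isQM_torus (q : K) : IsQM q (bidiag (weightShift K) (fun _ => 0) :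
    Fin t → Fin t → Module.End K ((ℕ → ℤ) → K)) := by
  refine isQM_bidiag (fun i k => ?_) (fun i k => rfl) (fun i => ?_) (fun i => ?_)
    fun i k h h' => ?_
  · ext h r
    exact congrArg h (sub_right_comm _ _ _)
  all_goals simp

variable [NeZero q]

/-- The projection onto the component of weight `μ`. -/
def weightProj (μ : ℕ → ℤ) : QMat K q u t →ₗ[K] QMat K q u t :=
  coactOp (isQM_torus q) (weightSlot K μ)

open Classical in
theorem weightProj_one (μ : ℕ → ℤ) :
    weightProj μ (1 : QMat K q u t) = if μ = 0 then 1 else 0 := by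
  rw [weightProj, coactOp_one]
  simp [weightSlot, Pi.single_apply]

theorem weightProj_Xm_mul (μ : ℕ → ℤ) (i : Fin u) (c : Fin t) (x : QMat K q u t) :
    weightProj μ (Xm K q i c * x) = Xm K q i c * weightProj (μ - Pi.single (c : ℕ) 1) x := by
  rw [weightProj, coactOp_Xm_mul, Finset.sum_eq_single c]
  · have : weightSlot K μ ∘ₗ LinearMap.mulLeft K (bidiag (weightShift K) (fun _ => 0) c c) =
        weightSlot K (μ - Pi.single (c : ℕ) 1) := by
      ext g; simp [bidiag, weightSlot, weightShift]
    rw [this]; rfl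
  · intro k _ hk
    have : (c : ℕ) ≠ k := fun h => hk (Fin.ext h.symm)
    simp [bidiag, this, coactOp_zero]
  · simp

theorem weightProj_inclRow (μ : ℕ → ℤ) (x : QMat K q u t) :
    weightProj μ (inclRow x) = inclRow (weightProj μ x) := coactOp_inclRow _ _ _

theorem weightProj_rowmon_mul (k : Fin t → ℕ) :
    ∀ (μ : ℕ → ℤ) (x : QMat K q (u + 1) t), weightProj μ (rowmon (Xm K q 0) k * x) =
      rowmon (Xm K q 0) k * weightProj (μ - fun c => (extZero k c : ℤ)) x := by
  induction k using rowExp_induction with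
  | zero =>
    intro μ x
    have : (μ - fun c => (extZero (0 : Fin t → ℕ) c : ℤ)) = μ := by
      funext c; simp [extZero]
    rw [this]; simp
  | step c k ih =>
    intro μ x
    rw [rowmon_Xm_step (NeZero.ne q), smul_mul_assoc, mul_assoc, map_smul, weightProj_Xm_mul, ih,
      smul_mul_assoc, mul_assoc]
    congr 5
    rw [sub_sub]
    congr 1
    funext d
    by_cases h : d < t
    · by_cases h' : d = c
      · subst h'; simp [extZero, add_comm]
      · have : (⟨d, h⟩ : Fin t) ≠ c := fun e => h' (by rw [← e])
        simp [extZero, h, h', this]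
    · have : d ≠ c := by omega
      simp [extZero, h, this]

open Classical in
theorem weightProj_pbw (μ : ℕ → ℤ) (a : Fin u → Fin t → ℕ) :
    weightProj μ (pbw a : QMat K q u t) = if weight a = μ then pbw a else 0 := by
  induction u generalizing μ with
  | zero =>
    have : weight a = 0 := funext fun c => by simp [weight, colsum_zero]
    simp only [pbw, weightProj_one, this, eq_comm]
  | succ u ih =>
    have h : (weight (Fin.tail a) = μ - fun c => (extZero (a 0) c : ℤ)) ↔ weight a = μ := by
      simp only [funext_iff, weight, colsum_succ, Pi.sub_apply]
      exact forall_congr' fun c => by push_cast; constructor <;> intro h <;> linarith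
    rw [pbw, weightProj_rowmon_mul, weightProj_inclRow, ih, if_congr h rfl rfl]
    split_ifs <;> simp

open Classical in
theorem coord_weightProj (μ : ℕ → ℤ) (a : Fin u → Fin t → ℕ) (x : QMat K q u t) :
    coord a (weightProj μ x) = if weight a = μ then coord a x else 0 := by
  have : coord a ∘ₗ weightProj μ = (if weight a = μ then (1 : K) else 0) • coord (q := q) a := by
    refine (pbwBasis K q u t).ext fun b => ?_
    rw [pbwBasis_apply, LinearMap.comp_apply, weightProj_pbw, LinearMap.smul_apply, coord_pbw]
    by_cases h : b = a
    · subst h; by_cases hw : weight b = μ <;> simp [hw, coord_pbw]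
    · by_cases hw : weight b = μ <;> by_cases hw' : weight a = μ <;> simp [hw, hw', coord_pbw, h]
  have := LinearMap.congr_fun this x
  rw [LinearMap.comp_apply] at this
  rw [this]
  split_ifs <;> simp

/-- The predicate of being homogeneous of weight `μ`. -/
def HasWeight (μ : ℕ → ℤ) (x : QMat K q u t) : Prop := weightProj μ x = x

theorem hasWeight_iff (μ : ℕ → ℤ) (x : QMat K q u t) :
    HasWeight μ x ↔ ∀ a, coord a x ≠ 0 → weight a = μ := by
  classical
  constructor
  · intro h a ha
    by_contra h'
    rw [← h, coord_weightProj, if_neg h'] at ha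
    exact ha rfl
  · intro h
    refine eq_of_coord fun a => ?_
    rw [coord_weightProj]
    split_ifs with h'
    · rfl
    · exact (not_not.1 (mt (h a) h')).symm

theorem HasWeight.rowPart {μ : ℕ → ℤ} {x : QMat K q (u + 1) t} (h : HasWeight μ x)
    (k : Fin t → ℕ) : HasWeight (μ - fun c => (extZero k c : ℤ)) (rowPart k x) := by
  rw [hasWeight_iff] at h ⊢
  intro a ha
  have := h (Fin.cons k a) (by rwa [coord_succ, Fin.tail_cons, Fin.cons_zero])
  rw [← this]
  funext c
  simp [weight, colsum_succ]

/-- The simple root for the columns `j`, `j + 1`. -/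
def simpleRoot (j : ℕ) : ℕ → ℤ := Pi.single j 1 - Pi.single (j + 1) 1

theorem weightProj_lowerOp {j : ℕ} (hj : j + 1 < t) (x : QMat K q u t) : ∀ (r : ℤ) (μ : ℕ → ℤ),
    weightProj (μ - r • simpleRoot j) (lowerOp j r x) = lowerOp j r (weightProj μ x) := by
  classical
  refine QMat_induction (p := fun x => ∀ (r : ℤ) (μ : ℕ → ℤ),
    weightProj (μ - r • simpleRoot j) (lowerOp j r x) = lowerOp j r (weightProj μ x)) ?_ ?_ ?_ ?_ x
  · intro r μ
    rw [lowerOp_one, weightProj_one]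
    by_cases hr : r = 0
    · subst hr
      rw [if_pos rfl, weightProj_one, zero_smul, sub_zero]
      split_ifs <;> simp [lowerOp_one]
    · rw [if_neg hr, map_zero]
      split_ifs <;> simp [lowerOp_one, hr]
  · intro x y hx hy r μ; simp only [map_add, hx, hy]
  · intro c x hx r μ; simp only [map_smul, hx]
  · intro i c x hx r μ
    by_cases hc : (c : ℕ) = j
    · have e : μ - r • simpleRoot j - Pi.single (j + 1) 1 =
          μ - Pi.single (c : ℕ) 1 - (r - 1) • simpleRoot j := by
        rw [hc, sub_smul, one_smul]
        nth_rewrite 3 [simpleRoot]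
        abel
      rw [lowerOp_Xm_self_mul i hc (c' := ⟨j + 1, hj⟩) rfl, map_add, map_smul, weightProj_Xm_mul,
        weightProj_Xm_mul, weightProj_Xm_mul, lowerOp_Xm_self_mul i hc (c' := ⟨j + 1, hj⟩) rfl,
        ← hx, ← hx, sub_right_comm, e]
    · rw [lowerOp_Xm_mul i hc, map_smul, weightProj_Xm_mul, weightProj_Xm_mul, lowerOp_Xm_mul i hc,
        ← hx, sub_right_comm]

end Weights

section RowFormula

variable {t : ℕ}

/-- Changing the exponents in the columns `c` and `c'`. -/
def putTwo (c c' : Fin t) (k : Fin t → ℕ) (x y : ℕ) : Fin t → ℕ :=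
  Function.update (Function.update k c x) c' y

section

variable {c c' : Fin t} (k : Fin t → ℕ) (x y : ℕ)

theorem putTwo_left (h : c ≠ c') : putTwo c c' k x y c = x := by
  simp [putTwo, h]

theorem putTwo_right : putTwo c c' k x y c' = y := by
  simp [putTwo]

theorem putTwo_of_ne {d : Fin t} (h : d ≠ c) (h' : d ≠ c') : putTwo c c' k x y d = k d := by
  simp [putTwo, h, h']

theorem putTwo_self : putTwo c c' k (k c) (k c') = k := by
  simp [putTwo]

theorem putTwo_putTwo (x' y' : ℕ) : putTwo c c' (putTwo c c' k x y) x' y' = putTwo c c' k x' y' := by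
  funext d
  by_cases h' : d = c'
  · subst h'; simp only [putTwo_right]
  · by_cases h : d = c
    · subst h; simp only [putTwo_left _ _ _ h']
    · simp only [putTwo_of_ne _ _ _ h h']

theorem putTwo_add_left (h : c ≠ c') :
    putTwo c c' k x y + Pi.single c 1 = putTwo c c' k (x + 1) y := by
  funext d
  by_cases hd : d = c
  · subst hd; simp [putTwo_left _ _ _ h]
  · by_cases hd' : d = c'
    · subst hd'; simp [putTwo_right, hd]
    · simp [putTwo_of_ne _ _ _ hd hd', hd]

theorem putTwo_add_right : putTwo c c' k x y + Pi.single c' 1 = putTwo c c' k x (y + 1) := by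
  funext d
  by_cases hd' : d = c'
  · subst hd'; simp [putTwo_right]
  · by_cases hd : d = c
    · subst hd; simp [putTwo_left _ _ _ hd', hd']
    · simp [putTwo_of_ne _ _ _ hd hd', hd']

theorem putTwo_add_of_ne {d : Fin t} (h : d ≠ c) (h' : d ≠ c') :
    putTwo c c' k x y + Pi.single d 1 = putTwo c c' (k + Pi.single d 1) x y := by
  funext e
  by_cases hd' : e = c'
  · subst hd'; simp [putTwo_right, h'.symm]
  · by_cases hd : e = c
    · subst hd; simp [putTwo_left _ _ _ hd', h.symm]
    · simp [putTwo_of_ne _ _ _ hd hd']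

theorem sum_putTwo (h : c ≠ c') (d : Fin t) :
    (∑ l, if l < d then putTwo c c' k x y l else 0) =
      (∑ l, if l < d ∧ l ≠ c ∧ l ≠ c' then k l else 0) + (if c < d then x else 0) +
        (if c' < d then y else 0) := by
  have (l : Fin t) : (if l < d then putTwo c c' k x y l else 0) =
      (if l < d ∧ l ≠ c ∧ l ≠ c' then k l else 0) + (if l = c then (if c < d then x else 0) else 0) +
        (if l = c' then (if c' < d then y else 0) else 0) := by
    by_cases hd' : l = c'
    · subst hd'; simp [putTwo_right, h.symm]
    · by_cases hd : l = c
      · subst hd; simp [putTwo_left _ _ _ h, h]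
      · simp [putTwo_of_ne _ _ _ hd hd', hd, hd']
  simp [this, Finset.sum_add_distrib]

variable {K : Type} [Field K] {q : K}

theorem insertCoeff_putTwo_left (h : (c' : ℕ) = c + 1) :
    insertCoeff q c (putTwo c c' k x y) = insertCoeff q c k := by
  have hne : c ≠ c' := fun e => by rw [e] at h; omega
  have h' : ¬ c' < c := by rw [Fin.lt_def]; omega
  conv_rhs => rw [← putTwo_self (c := c) (c' := c') k]
  rw [insertCoeff, insertCoeff, sum_putTwo _ _ _ hne, sum_putTwo _ _ _ hne]
  simp [h']

theorem insertCoeff_putTwo_right (h : (c' : ℕ) = c + 1) :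
    insertCoeff q c' (putTwo c c' k x y) = insertCoeff q c k * q⁻¹ ^ x := by
  have hne : c ≠ c' := fun e => by rw [e] at h; omega
  have h₁ : c < c' := by rw [Fin.lt_def]; omega
  have h₂ : ¬ c' < c := by rw [Fin.lt_def]; omega
  conv_rhs => rw [← putTwo_self (c := c) (c' := c') k]
  rw [insertCoeff, insertCoeff, sum_putTwo _ _ _ hne, sum_putTwo _ _ _ hne]
  simp only [h₁, h₂, lt_irrefl, if_true, if_false, add_zero, ← pow_add]
  congr 2
  refine Finset.sum_congr rfl fun l _ => if_congr ?_ rfl rfl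
  refine and_congr_left fun hl => ?_
  have h₃ : (l : ℕ) ≠ c := fun e => hl.1 (Fin.ext e)
  rw [Fin.lt_def, Fin.lt_def]
  omega

theorem insertCoeff_putTwo_of_ne (h : (c' : ℕ) = c + 1) {d : Fin t} (hd' : d ≠ c')
    (hxy : x + y = k c + k c') : insertCoeff q d (putTwo c c' k x y) = insertCoeff q d k := by
  have hne : c ≠ c' := fun e => by rw [e] at h; omega
  have h₁ : c < d ↔ c' < d := by
    have h₃ : (d : ℕ) ≠ c' := fun e => hd' (Fin.ext e)
    rw [Fin.lt_def, Fin.lt_def]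
    omega
  conv_rhs => rw [← putTwo_self (c := c) (c' := c') k]
  rw [insertCoeff, insertCoeff, sum_putTwo _ _ _ hne, sum_putTwo _ _ _ hne, add_assoc, add_assoc]
  congr 2
  simp only [h₁]
  split_ifs <;> simp [hxy]

end

/-- The numerical coefficients in the action of the raising operators on a power. -/
def raiseCoeff {K : Type} [Field K] (q : K) : ℕ → ℕ → K
  | 0, 0 => 1
  | 0, _ + 1 => 0
  | k + 1, 0 => raiseCoeff q k 0
  | k + 1, i + 1 =>
    q ^ (2 * (i + 1)) * raiseCoeff q k (i + 1) + q ^ (4 * i + 2) * raiseCoeff q k i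

variable {K : Type} [Field K] {q : K}

theorem raiseCoeff_zero (k : ℕ) : raiseCoeff q k 0 = 1 := by
  induction k with
  | zero => rfl
  | succ k ih => exact ih

theorem raiseCoeff_of_lt {k i : ℕ} (h : k < i) : raiseCoeff q k i = 0 := by
  induction k generalizing i with
  | zero => obtain _ | i := i; · omega
            rfl
  | succ k ih =>
    obtain _ | i := i; · omega
    rw [raiseCoeff, ih (by omega), ih (by omega), mul_zero, mul_zero, add_zero]

variable {u : ℕ} [NeZero q]

theorem raiseOp_rowmon_mul {j : ℕ} {c c' : Fin t} (hc : (c : ℕ) = j) (hc' : (c' : ℕ) = j + 1)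
    (k : Fin t → ℕ) : ∀ (r : ℤ) (V : QMat K q (u + 1) t),
      raiseOp j r (rowmon (Xm K q 0) k * V) = ∑ i ∈ Finset.range (k c' + 1),
        (raiseCoeff q (k c') i * q ^ (k c * r - i * (r - k c' + i) - 2 * k c' * i)) •
          (rowmon (Xm K q 0) (putTwo c c' k (k c + k c' - i) i) * raiseOp j (r - k c' + i) V) := by
  have hq : q ≠ 0 := NeZero.ne q
  have hcc : (c' : ℕ) = c + 1 := by omega
  have hne : c ≠ c' := fun e => by rw [e] at hcc; omega
  induction k using rowExp_induction with
  | zero =>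
    intro r V
    have : putTwo c c' (0 : Fin t → ℕ) 0 0 = 0 := putTwo_self 0
    simp [raiseCoeff_zero, this]
  | step d k ih =>
    intro r V
    have hX (x y : ℕ) (W : QMat K q (u + 1) t) : Xm K q 0 d * (rowmon (Xm K q 0) (putTwo c c' k x y) * W) =
        insertCoeff q d (putTwo c c' k x y) •
          (rowmon (Xm K q 0) (putTwo c c' k x y + Pi.single d 1) * W) := by
      rw [← mul_assoc, Xm_zero_mul_rowmon hq, smul_mul_assoc]
    rw [rowmon_Xm_step hq, smul_mul_assoc, mul_assoc, map_smul,
      inv_smul_eq_iff₀ (insertCoeff_ne_zero hq d k), Finset.smul_sum]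
    by_cases hd' : d = c'
    · subst hd'
      have e₁ : (k + Pi.single d 1 : Fin t → ℕ) d = k d + 1 := by simp
      have e₂ : (k + Pi.single d 1 : Fin t → ℕ) c = k c := by simp [hne]
      have e₃ (x y : ℕ) : putTwo c d (k + Pi.single d 1) x y = putTwo c d k x y := by
        rw [← putTwo_self (c := c) (c' := d) k, putTwo_add_right, putTwo_putTwo, putTwo_putTwo]
      have e₄ : insertCoeff q d k = insertCoeff q c k * q⁻¹ ^ k c := by
        conv_lhs => rw [← putTwo_self (c := c) (c' := d) k]
        rw [insertCoeff_putTwo_right _ _ _ hcc]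
      rw [raiseOp_Xm_succ_mul _ hc hc', ih, ih, e₁, Finset.mul_sum, Finset.mul_sum,
        Finset.smul_sum]
      set M : ℕ → QMat K q (u + 1) t := fun i =>
        rowmon (Xm K q 0) (putTwo c d k (k c + k d + 1 - i) i) *
          raiseOp j (r - (k d : ℤ) - 1 + i) V with hM
      have h₁ : ∀ i ∈ Finset.range (k d + 1), q ^ (-r) • (Xm K q 0 d *
          ((raiseCoeff q (k d) i * q ^ (k c * r - i * (r - k d + i) - 2 * k d * i)) •
            (rowmon (Xm K q 0) (putTwo c d k (k c + k d - i) i) *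
              raiseOp j (r - k d + i) V))) =
          (insertCoeff q c k * raiseCoeff q (k d) i *
            q ^ (-r + (k c * r - i * (r - k d + i) - 2 * k d * i) - (k c + k d - i))) • M (i + 1) := by
        intro i hi
        have hi : i ≤ k d := by simpa [Nat.lt_succ_iff] using hi
        rw [mul_smul_comm, hX, insertCoeff_putTwo_right _ _ _ hcc, putTwo_add_right, smul_smul,
          smul_smul, hM]
        dsimp only
        rw [show k c + k d + 1 - (i + 1) = k c + k d - i by omega,
          show r - (k d : ℤ) - 1 + (i + 1 : ℕ) = r - k d + i by push_cast; ring,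
          zpow_sub₀ hq _ ((k c : ℤ) + k d - i), zpow_add₀ hq, show (k c : ℤ) + k d - i = (k c + k d - i : ℕ) by omega, zpow_natCast, inv_pow]
        congr 1
        ring
      have h₂ : ∀ i ∈ Finset.range (k d + 1), Xm K q 0 c *
          ((raiseCoeff q (k d) i * q ^ (k c * (r - 1) - i * (r - 1 - k d + i) - 2 * k d * i)) •
            (rowmon (Xm K q 0) (putTwo c d k (k c + k d - i) i) *
              raiseOp j (r - 1 - k d + i) V)) =
          (insertCoeff q c k * raiseCoeff q (k d) i *
            q ^ (k c * (r - 1) - i * (r - 1 - k d + i) - 2 * k d * i)) • M i := by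
        intro i hi
        have hi : i ≤ k d := by simpa [Nat.lt_succ_iff] using hi
        rw [mul_smul_comm, ← mul_assoc, Xm_zero_mul_rowmon hq, insertCoeff_putTwo_left _ _ _ hcc,
          putTwo_add_left _ _ _ hne, smul_mul_assoc, smul_smul, hM]
        dsimp only
        rw [show k c + k d + 1 - i = k c + k d - i + 1 by omega, sub_right_comm r 1]
        congr 1
        ring
      have h₃ : ∀ i ∈ Finset.range (k d + 1 + 1), insertCoeff q d k • ((raiseCoeff q (k d + 1) i *
          q ^ ((k + Pi.single d 1 : Fin t → ℕ) c * r - i * (r - (k d + 1 : ℕ) + i) -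
            2 * (k d + 1 : ℕ) * i)) • (rowmon (Xm K q 0) (putTwo c d (k + Pi.single d 1)
              ((k + Pi.single d 1 : Fin t → ℕ) c + (k d + 1) - i) i) *
                raiseOp j (r - (k d + 1 : ℕ) + i) V)) =
          (insertCoeff q c k * raiseCoeff q (k d + 1) i * q ^ (-(k c : ℤ) +
            (k c * r - i * (r - k d - 1 + i) - 2 * (k d + 1) * i))) • M i := by
        intro i hi
        rw [e₂, e₃, e₄, hM, smul_smul, ← add_assoc]
        push_cast
        rw [← sub_sub, zpow_add₀ hq, zpow_neg, zpow_natCast, inv_pow]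
        congr 1
        ring
      rw [Finset.sum_congr rfl h₁, Finset.sum_congr rfl h₂, Finset.sum_congr rfl h₃]
      have h₄ : (insertCoeff q c k * raiseCoeff q (k d) (k d + 1) *
          q ^ (k c * (r - 1) - (k d + 1 : ℕ) * (r - 1 - k d + (k d + 1 : ℕ)) -
            2 * k d * (k d + 1 : ℕ))) • M (k d + 1) = 0 := by
        rw [raiseCoeff_of_lt (Nat.lt_succ_self _), mul_zero, zero_mul, zero_smul]
      rw [← add_zero (∑ i ∈ Finset.range (k d + 1), (insertCoeff q c k * raiseCoeff q (k d) i *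
            q ^ (k c * (r - 1) - i * (r - 1 - k d + i) - 2 * k d * i)) • M i), ← h₄,
        ← Finset.sum_range_succ (fun i : ℕ => (insertCoeff q c k * raiseCoeff q (k d) i *
            q ^ (k c * (r - 1) - i * (r - 1 - k d + i) - 2 * k d * i)) • M i),
        Finset.sum_range_succ' _ (k d + 1), Finset.sum_range_succ' _ (k d + 1), ← add_assoc, ← Finset.sum_add_distrib]
      congr 1
      · refine Finset.sum_congr rfl fun i _ => ?_
        rw [← add_smul, raiseCoeff]
        congr 1
        rw [show -(k c : ℤ) + (k c * r - (i + 1 : ℕ) * (r - k d - 1 + (i + 1 : ℕ)) -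
          2 * (k d + 1) * (i + 1 : ℕ)) = -r + (k c * r - i * (r - k d + i) - 2 * k d * i) -
            (k c + k d - i) - (4 * i + 2 : ℕ) by push_cast; ring, zpow_sub₀ hq _ ((4 * i + 2 : ℕ) : ℤ)]
        rw [show (k c : ℤ) * (r - 1) - (i + 1 : ℕ) * (r - 1 - k d + (i + 1 : ℕ)) -
          2 * k d * (i + 1 : ℕ) = -r + (k c * r - i * (r - k d + i) - 2 * k d * i) -
            (k c + k d - i) - (4 * i + 2 : ℕ) + (2 * (i + 1) : ℕ) by push_cast; ring,
          zpow_add₀ hq _ ((2 * (i + 1) : ℕ) : ℤ), zpow_sub₀ hq _ ((4 * i + 2 : ℕ) : ℤ), zpow_natCast,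
          zpow_natCast]
        have := pow_ne_zero (4 * i + 2) hq
        field_simp
        ring
      · rw [raiseCoeff]
        congr 3
        push_cast
        ring
    · rw [raiseOp_Xm_mul _ (fun e => hd' (Fin.ext (by omega))), ih, Finset.mul_sum, Finset.smul_sum]
      have e' : (k + Pi.single d 1 : Fin t → ℕ) c' = k c' := by simp [Ne.symm hd']
      rw [e']
      refine Finset.sum_congr rfl fun i hi => ?_
      have hi : i ≤ k c' := by simpa [Nat.lt_succ_iff] using hi
      rw [mul_smul_comm, hX, smul_smul, smul_smul, smul_smul]
      by_cases hd : d = c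
      · subst hd
        rw [insertCoeff_putTwo_left _ _ _ hcc, putTwo_add_left _ _ _ hne]
        have e₁ : (k + Pi.single d 1 : Fin t → ℕ) d = k d + 1 := by simp
        have e₂ : putTwo d c' (k + Pi.single d 1) (k d + 1 + k c' - i) i =
            putTwo d c' k (k d + k c' - i + 1) i := by
          rw [← putTwo_self (c := d) (c' := c') k, putTwo_add_left _ _ _ hne, putTwo_putTwo,
            putTwo_putTwo, putTwo_self]
          congr 1
          omega
        rw [e₁, e₂, diagTwist, if_pos hc]
        congr 1
        rw [show (((k d + 1 : ℕ) : ℤ) * r - i * (r - k c' + i) - 2 * k c' * i) =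
          1 * r + (k d * r - i * (r - k c' + i) - 2 * k c' * i) by push_cast; ring, zpow_add₀ hq]
        ring
      · rw [insertCoeff_putTwo_of_ne _ _ _ hcc hd' (by omega), putTwo_add_of_ne _ _ _ hd hd']
        have e₁ : (k + Pi.single d 1 : Fin t → ℕ) c = k c := by simp [Ne.symm hd]
        rw [e₁, diagTwist, if_neg (fun e => hd (Fin.ext (by omega))),
          if_neg (fun e => hd' (Fin.ext (by omega))), zero_mul, zpow_zero, one_mul, mul_comm]

end RowFormula

section Slices

variable {K : Type} [Field K] {q : K} [NeZero q] {u t : ℕ}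

theorem putTwo_eq_iff {c c' : Fin t} (hne : c ≠ c') (k l : Fin t → ℕ) {i : ℕ}
    (hi : i ≤ k c + k c') : putTwo c c' k (k c + k c' - i) i = l ↔
      i = l c' ∧ k c' ≤ l c + l c' ∧ putTwo c c' l (l c + l c' - k c') (k c') = k := by
  constructor
  · rintro rfl
    rw [putTwo_left _ _ _ hne, putTwo_right, putTwo_putTwo]
    refine ⟨rfl, by omega, ?_⟩
    conv_rhs => rw [← putTwo_self (c := c) (c' := c') k]
    congr 1
    omega
  · rintro ⟨rfl, h, hk⟩
    have h₁ : k c = l c + l c' - k c' := by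
      conv_lhs => rw [← hk]
      exact putTwo_left _ _ _ hne
    rw [← hk, putTwo_putTwo, putTwo_left _ _ _ hne, putTwo_right]
    conv_rhs => rw [← putTwo_self (c := c) (c' := c') l]
    congr 1
    omega

theorem rowPart_raiseOp {j : ℕ} {c c' : Fin t} (hc : (c : ℕ) = j) (hc' : (c' : ℕ) = j + 1)
    (l : Fin t → ℕ) (R : ℤ) (v : QMat K q (u + 1) t) :
    rowPart l (raiseOp j (R - l c') v) = ∑ m ∈ Finset.range (l c + l c' + 1),
      (raiseCoeff q m (l c') * q ^ ((l c + l c') * R - l c' * (l c + l c' + R) - m * R)) •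
        raiseOp j (R - m) (rowPart (putTwo c c' l (l c + l c' - m) m) v) := by
  have hne : c ≠ c' := fun e => by rw [e] at hc; omega
  obtain ⟨s, w, rfl⟩ : ∃ (s : Finset (Fin t → ℕ)) (w : (Fin t → ℕ) → QMat K q u t),
      v = ∑ k ∈ s, rowmon (Xm K q 0) k * inclRow (w k) := by
    obtain ⟨s, -, h⟩ := sum_rowPart v
    exact ⟨s, _, h⟩
  simp only [map_sum, Finset.smul_sum]
  rw [Finset.sum_comm]
  refine Finset.sum_congr rfl fun k _ => ?_
  rw [raiseOp_rowmon_mul hc hc', map_sum]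
  simp only [map_smul, raiseOp_inclRow, rowPart_rowmon_mul]
  by_cases h : k c' ≤ l c + l c' ∧ putTwo c c' l (l c + l c' - k c') (k c') = k
  · have h₁ : k c + k c' = l c + l c' := by
      have : k c = l c + l c' - k c' := by
        conv_lhs => rw [← h.2]
        exact putTwo_left _ _ _ hne
      omega
    symm
    rw [Finset.sum_eq_single_of_mem (k c') (Finset.mem_range.2 (by omega)), if_pos h.2.symm]
    · symm
      by_cases hi : l c' ≤ k c'
      · rw [Finset.sum_eq_single_of_mem (l c') (Finset.mem_range.2 (by omega)),
          if_pos ((putTwo_eq_iff hne k l (by omega)).2 ⟨rfl, h⟩)]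
        · have e : (l c : ℤ) = k c + k c' - l c' := by omega
          rw [e]
          congr 2
          · ring_nf
          · ring_nf
        · intro i hi hne'
          have := Finset.mem_range.1 hi
          rw [if_neg fun e => hne' ((putTwo_eq_iff hne k l (by omega)).1 e).1, smul_zero]
      · rw [raiseCoeff_of_lt (by omega), zero_mul, zero_smul]
        refine Finset.sum_eq_zero fun i hi' => ?_
        have := Finset.mem_range.1 hi'
        rw [if_neg fun e => hi (by have := ((putTwo_eq_iff hne k l (by omega)).1 e).1; omega),
          smul_zero]
    · intro m _ hm
      rw [if_neg fun e => hm ?_, map_zero, smul_zero]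
      rw [e, putTwo_right]
  · rw [Finset.sum_eq_zero, Finset.sum_eq_zero]
    · intro m hm
      have hm := Finset.mem_range.1 hm
      rw [if_neg fun e => h ?_, map_zero, smul_zero]
      have : k c' = m := by rw [e, putTwo_right]
      rw [this]
      exact ⟨by omega, e.symm⟩
    · intro i hi
      have := Finset.mem_range.1 hi
      rw [if_neg fun e => h ((putTwo_eq_iff hne k l (by omega)).1 e).2, smul_zero]

end Slices

section HighestWeight

variable {K : Type} [Field K] {q : K}

theorem raiseCoeff_self_ne_zero (hq : q ≠ 0) (k : ℕ) : raiseCoeff q k k ≠ 0 := by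
  induction k with
  | zero => exact one_ne_zero
  | succ k ih =>
    rw [raiseCoeff, raiseCoeff_of_lt (Nat.lt_succ_self k), mul_zero, zero_add]
    exact mul_ne_zero (pow_ne_zero _ hq) ih

theorem eq_zero_of_sum_raiseCoeff_zero {M : Type*} [AddCommGroup M] [Module K M] (hq : q ≠ 0)
    {n : ℕ} {y : ℕ → M}
    (h : ∀ i ≤ n, ∑ s ∈ Finset.range (n + 1), raiseCoeff q s i • y s = 0) : ∀ s ≤ n, y s = 0 := by
  suffices ∀ d s, n - s = d → s ≤ n → y s = 0 from fun s => this _ s rfl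
  intro d
  induction d using Nat.strong_induction_on with
  | _ d ih =>
    intro s hd hs
    have := h s hs
    rw [Finset.sum_eq_single_of_mem s (Finset.mem_range.2 (by omega))] at this
    · exact (smul_eq_zero.1 this).resolve_left (raiseCoeff_self_ne_zero hq s)
    · intro s' hs' hne
      have hs' := Finset.mem_range.1 hs'
      rcases lt_or_gt_of_ne hne with h' | h'
      · rw [raiseCoeff_of_lt h', zero_smul]
      · rw [ih (n - s') (by omega) s' rfl (by omega), smul_zero]

/-- The square minors of the matrix of coefficients `raiseCoeff` on consecutive rows and the first
columns are invertible. -/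
theorem eq_zero_of_sum_raiseCoeff {M : Type*} [AddCommGroup M] [Module K M] (hq : q ≠ 0)
    (a : ℕ) {n : ℕ} {y : ℕ → M}
    (h : ∀ i ≤ n, ∑ s ∈ Finset.range (n + 1), raiseCoeff q (a + s) i • y s = 0) :
    ∀ s ≤ n, y s = 0 := by
  induction a with
  | zero => simp only [zero_add] at h; exact eq_zero_of_sum_raiseCoeff_zero hq h
  | succ a ih =>
    refine ih fun i => ?_
    induction i with
    | zero =>
      intro _
      have := h 0 (Nat.zero_le _)
      simpa only [raiseCoeff_zero] using this
    | succ i ih' =>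
      intro hi
      have h₁ := h (i + 1) hi
      simp only [Nat.add_right_comm a 1, raiseCoeff, add_smul, Finset.sum_add_distrib, mul_smul,
        ← Finset.smul_sum] at h₁
      rw [ih' (by omega), smul_zero, add_zero] at h₁
      exact (smul_eq_zero.1 h₁).resolve_left (pow_ne_zero _ hq)

variable [NeZero q] {u t : ℕ}

theorem raiseOp_rowPart_eq_zero {j : ℕ} {c c' : Fin t} (hc : (c : ℕ) = j) (hc' : (c' : ℕ) = j + 1)
    {v : QMat K q (u + 1) t} (k : Fin t → ℕ) {a b : ℕ} (hb : b ≤ k c + k c')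
    (hV : ∀ m ≤ k c + k c', rowPart (putTwo c c' k (k c + k c' - m) m) v ≠ 0 → a ≤ m ∧ m ≤ b)
    {d : ℤ} (hd : ∀ r > d, raiseOp j r v = 0) {R : ℤ} (hR : d + b - a < R) {m : ℕ}
    (hm : m ≤ k c + k c') :
    raiseOp j (R - m) (rowPart (putTwo c c' k (k c + k c' - m) m) v) = 0 := by
  have hq : q ≠ 0 := NeZero.ne q
  have hne : c ≠ c' := fun e => by rw [e] at hc; omega
  set P := k c + k c' with hP
  set V : ℕ → QMat K q u t := fun m => rowPart (putTwo c c' k (P - m) m) v with hVdef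
  by_cases hm0 : V m = 0
  · change raiseOp j (R - m) (V m) = 0
    rw [hm0, map_zero]
  obtain ⟨ham, hmb⟩ := hV m hm hm0
  have key : ∀ i ≤ b - a, ∑ s ∈ Finset.range (b - a + 1), raiseCoeff q (a + s) i •
      (q ^ (-((a + s : ℕ) * R)) • raiseOp j (R - (a + s : ℕ)) (V (a + s))) = 0 := by
    intro i hi
    have h := rowPart_raiseOp hc hc' (putTwo c c' k (P - i) i) R v
    rw [putTwo_right, putTwo_left _ _ _ hne, hd _ (by omega), map_zero,
      Nat.sub_add_cancel (by omega)] at h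
    have h' : ∑ m ∈ Finset.range (P + 1), raiseCoeff q m i •
        (q ^ (-(m * R)) • raiseOp j (R - m) (V m)) = 0 := by
      have hu : q ^ (P * R - i * (P + R)) ≠ 0 := zpow_ne_zero _ hq
      refine (smul_eq_zero.1 (?_ : q ^ (P * R - i * (P + R)) • _ = _)).resolve_left hu
      rw [h, Finset.smul_sum]
      refine Finset.sum_congr rfl fun m _ => ?_
      have : ((P - i : ℕ) : ℤ) + i = P := by omega
      rw [putTwo_putTwo, smul_smul, smul_smul, this, sub_eq_add_neg _ ((m : ℤ) * R),
        zpow_add₀ hq _ (-((m : ℤ) * R))]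
      congr 1
      ring
    refine (Eq.trans ?_ (Finset.sum_subset (s₁ := Finset.Ico a (b + 1)) ?_ ?_)).trans h'
    · rw [Finset.sum_Ico_eq_sum_range, show b + 1 - a = b - a + 1 by omega]
    · intro x hx
      rw [Finset.mem_Ico] at hx
      exact Finset.mem_range.2 (by omega)
    · intro x hx hx'
      rw [Finset.mem_range] at hx
      have : V x = 0 := by
        by_contra h0
        have := hV x (by omega) h0
        exact hx' (Finset.mem_Ico.2 (by omega))
      rw [this, map_zero, smul_zero, smul_zero]
  have := eq_zero_of_sum_raiseCoeff hq a key (m - a) (by omega)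
  rw [Nat.add_sub_cancel' ham] at this
  exact (smul_eq_zero.1 this).resolve_left (zpow_ne_zero _ hq)

theorem HasWeight.rowPart_putTwo {μ : ℕ → ℤ} {v : QMat K q (u + 1) t} (h : HasWeight μ v) {j : ℕ}
    {c c' : Fin t} (hc : (c : ℕ) = j) (hc' : (c' : ℕ) = j + 1) (k : Fin t → ℕ) (x y : ℕ) :
    ∃ ν, HasWeight ν (_root_.rowPart (putTwo c c' k x y) v) ∧ ν j = μ j - x ∧
      ν (j + 1) = μ (j + 1) - y := by
  have hne : c ≠ c' := fun e => by rw [e] at hc; omega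
  refine ⟨_, h.rowPart _, ?_, ?_⟩
  · subst hc
    simp [putTwo_left _ _ _ hne]
  · rw [← hc']
    simp [putTwo_right]

theorem exists_raiseOp_ne_zero {j : ℕ} (hj : j + 1 < t) {v : QMat K q u t} (hv : v ≠ 0)
    {μ : ℕ → ℤ} (hμ : HasWeight μ v) : ∃ r ≥ μ (j + 1) - μ j, raiseOp j r v ≠ 0 := by
  classical
  induction u generalizing μ with
  | zero =>
    refine ⟨0, ?_, by rwa [raiseOp_zero]⟩
    have : ∃ a, coord a v ≠ 0 := by
      by_contra! h
      exact hv (eq_of_coord fun a => by rw [h, map_zero])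
    obtain ⟨a, ha⟩ := this
    rw [← (hasWeight_iff _ _).1 hμ a ha]
    simp [weight, colsum_zero]
  | succ u ih =>
    by_contra! hcon
    obtain ⟨k, hk⟩ : ∃ k, rowPart k v ≠ 0 := by
      by_contra! h
      exact hv (eq_of_rowPart fun k => by rw [h, map_zero])
    let c : Fin t := ⟨j, by omega⟩
    let c' : Fin t := ⟨j + 1, hj⟩
    have hex : ∃ m, m ≤ k c + k c' ∧ rowPart (putTwo c c' k (k c + k c' - m) m) v ≠ 0 :=
      ⟨k c', by omega, by rwa [Nat.add_sub_cancel, putTwo_self]⟩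
    obtain ⟨ha, hav⟩ := Nat.find_spec hex
    set a := Nat.find hex
    obtain ⟨ν, hν, h₀, h₁⟩ := hμ.rowPart_putTwo (j := j) (c := c) (c' := c') rfl rfl k (k c + k c' - a) a
    obtain ⟨r, hr, hr'⟩ := ih hav hν
    refine hr' ?_
    have := raiseOp_rowPart_eq_zero (c := c) (c' := c') rfl rfl k (le_refl _)
      (fun m hm h => ⟨Nat.find_min' hex ⟨hm, h⟩, hm⟩) (d := μ (j + 1) - μ j - 1) (R := r + a)
      (fun r hr => hcon r (by omega)) (by omega) ha
    rwa [add_sub_cancel_right] at this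

/-- Exponent matrices encoding semistandard tableaux: the entry in position `(i, c)` counts the
boxes labelled by `i` in the row `c`. -/
def IsStd {t : ℕ} : {u : ℕ} → (Fin u → Fin t → ℕ) → Prop
  | 0, _ => True
  | _ + 1, a => IsStd (Fin.tail a) ∧ ∀ j, colsum a (j + 1) ≤ colsum (Fin.tail a) j

/-- A nonzero highest weight vector has a nonzero semistandard coordinate. -/
theorem exists_isStd_coord_ne_zero {v : QMat K q u t} (hv : v ≠ 0) {μ : ℕ → ℤ}
    (hμ : HasWeight μ v) (hE : ∀ j, j + 1 < t → ∀ r ≥ 1, raiseOp j r v = 0) :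
    ∃ a, IsStd a ∧ coord a v ≠ 0 := by
  classical
  induction u generalizing μ with
  | zero =>
    by_contra! h
    exact hv (eq_of_coord fun a => by rw [h a trivial, map_zero])
  | succ u ih =>
    obtain ⟨s, hs, -⟩ := sum_rowPart v
    obtain ⟨k₀, hk₀⟩ : ∃ k, rowPart k v ≠ 0 := by
      by_contra! h
      exact hv (eq_of_rowPart fun k => by rw [h, map_zero])
    obtain ⟨k, hk, hmax⟩ := (s.filter fun k => rowPart k v ≠ 0).exists_max_image
      (fun k => ∑ l : Fin t, (l : ℕ) * k l) ⟨k₀, Finset.mem_filter.2 ⟨hs _ hk₀, hk₀⟩⟩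
    have hk := (Finset.mem_filter.1 hk).2
    replace hmax : ∀ k', rowPart k' v ≠ 0 → (∑ l : Fin t, (l : ℕ) * k' l) ≤ ∑ l : Fin t, (l : ℕ) * k l :=
      fun k' h => hmax k' (Finset.mem_filter.2 ⟨hs _ h, h⟩)
    have hheight {c c' : Fin t} (hcc : (c' : ℕ) = c + 1) {m : ℕ} (hm : m ≤ k c + k c')
        (h : rowPart (putTwo c c' k (k c + k c' - m) m) v ≠ 0) : m ≤ k c' := by
      have hne : c ≠ c' := fun e => by rw [e] at hcc; omega
      have h₁ := hmax _ h
      have h₂ (k : Fin t → ℕ) : (∑ l : Fin t, (l : ℕ) * k l) =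
          (∑ l ∈ Finset.univ.erase c |>.erase c', (l : ℕ) * k l) + c' * k c' + c * k c := by
        rw [Finset.sum_erase_add _ _ (Finset.mem_erase.2 ⟨hne.symm, Finset.mem_univ _⟩),
          Finset.sum_erase_add _ _ (Finset.mem_univ _)]
      rw [h₂, h₂ k, putTwo_left _ _ _ hne, putTwo_right,
        Finset.sum_congr rfl fun l hl => by
          rw [putTwo_of_ne _ _ _ (Finset.ne_of_mem_erase (Finset.mem_of_mem_erase hl))
            (Finset.ne_of_mem_erase hl)], hcc] at h₁
      by_contra hlt
      obtain ⟨e, rfl⟩ : ∃ e, m = k c' + e + 1 := ⟨m - k c' - 1, by omega⟩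
      obtain ⟨f, hf⟩ : ∃ f, k c = f + e + 1 := ⟨k c - e - 1, by omega⟩
      rw [hf, show f + e + 1 + k c' - (k c' + e + 1) = f by omega] at h₁
      nlinarith
    have hinv : ∀ j, j + 1 < t → ∀ r ≥ 1, raiseOp j r (rowPart k v) = 0 := by
      intro j hj r hr
      let c : Fin t := ⟨j, by omega⟩
      let c' : Fin t := ⟨j + 1, hj⟩
      have h := rowPart_raiseOp (c := c) (c' := c') rfl rfl k (r + k c') v
      rw [add_sub_cancel_right, hE j hj r hr, map_zero,
        Finset.sum_eq_single_of_mem (k c') (Finset.mem_range.2 (by omega)), Nat.add_sub_cancel,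
        putTwo_self, add_sub_cancel_right, eq_comm, smul_eq_zero] at h
      · exact h.resolve_left (mul_ne_zero (raiseCoeff_self_ne_zero (NeZero.ne q) _)
          (zpow_ne_zero _ (NeZero.ne q)))
      · intro m hm hne
        have hm := Finset.mem_range.1 hm
        rcases lt_or_gt_of_ne hne with h' | h'
        · rw [raiseCoeff_of_lt h', zero_mul, zero_smul]
        · rw [not_not.1 (mt (hheight (c := c) (c' := c') rfl (by omega)) (by omega)), map_zero,
            smul_zero]
    obtain ⟨a, ha, hav⟩ := ih hk (hμ.rowPart k) hinv
    have hcoord : coord (Fin.cons k a : Fin (u + 1) → Fin t → ℕ) v ≠ 0 := by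
      rwa [coord_succ, Fin.tail_cons, Fin.cons_zero]
    have hw := (hasWeight_iff _ _).1 hμ _ hcoord
    refine ⟨Fin.cons k a, ⟨by rwa [Fin.tail_cons], fun j => ?_⟩, hcoord⟩
    by_cases hj : j + 1 < t
    · let c : Fin t := ⟨j, by omega⟩
      let c' : Fin t := ⟨j + 1, hj⟩
      have hex : ∃ m, m ≤ k c + k c' ∧ rowPart (putTwo c c' k (k c + k c' - m) m) v ≠ 0 :=
        ⟨k c', by omega, by rwa [Nat.add_sub_cancel, putTwo_self]⟩
      obtain ⟨hb, hbv⟩ := Nat.find_spec hex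
      set b := Nat.find hex
      obtain ⟨ν, hν, h₀, h₁⟩ := hμ.rowPart_putTwo (j := j) (c := c) (c' := c') rfl rfl k (k c + k c' - b) b
      obtain ⟨r, hr, hr'⟩ := exists_raiseOp_ne_zero hj hbv hν
      have h₂ : ¬ ((0 : ℤ) + k c' - b < r + b) := by
        intro hlt
        refine hr' ?_
        have := raiseOp_rowPart_eq_zero (c := c) (c' := c') rfl rfl k (by omega)
          (fun m hm h => ⟨Nat.find_min' hex ⟨hm, h⟩, hheight rfl hm h⟩) (d := 0) (R := r + b)
          (fun r hr => hE j hj r (by omega)) hlt hb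
        rwa [add_sub_cancel_right] at this
      have h₃ := congrFun hw j
      have h₄ := congrFun hw (j + 1)
      have h₅ := colsum_succ (Fin.cons k a : Fin (u + 1) → Fin t → ℕ) j
      rw [Fin.cons_zero, extZero_val k c] at h₅
      simp only [weight] at h₃ h₄
      omega
    · rw [colsum_of_le _ (by omega)]
      exact Nat.zero_le _

end HighestWeight

section Coinvariants

variable {K : Type} [Field K] {A B H : Type} [Ring A] [Algebra K A] [Ring B] [Algebra K B]
  [Ring H] [HopfAlgebra K H] (ρ : A →ₐ[K] A ⊗[K] H) (lam : B →ₐ[K] H ⊗[K] B)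

/-- The map `a ⊗ h ↦ ∑ a₀ ⊗ (a₁ ⊗ h)`. -/
def coactLeg : A ⊗[K] H →ₗ[K] A ⊗[K] (H ⊗[K] H) :=
  (TensorProduct.assoc K A H H).toLinearMap ∘ₗ ρ.toLinearMap.rTensor H

theorem gammaMap_tmul (a : A) (b : B) : gammaMap K A B H ρ lam (a ⊗ₜ b) =
    TensorProduct.map (LinearMap.mul' K H ∘ₗ TensorProduct.map (HopfAlgebra.antipode (R := K))
      LinearMap.id) LinearMap.id (TensorProduct.tensorTensorTensorComm K H A H B
        (TensorProduct.comm K A H (ρ a) ⊗ₜ lam b)) := rfl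

variable {ρ}

/-- The map `h ⊗ (a ⊗ b) ↦ ∑ (a₀ ⊗ a₁ h) ⊗ b`. -/
def untwist (ρ : A →ₐ[K] A ⊗[K] H) : H ⊗[K] (A ⊗[K] B) →ₗ[K] (A ⊗[K] H) ⊗[K] B :=
  ((LinearMap.mul' K H).lTensor A ∘ₗ coactLeg ρ ∘ₗ (TensorProduct.comm K H A).toLinearMap).rTensor B
    ∘ₗ (TensorProduct.assoc K H A B).symm.toLinearMap

/-- The map `a ⊗ (h ⊗ b) ↦ ∑ S(a₁) h ⊗ (a₀ ⊗ b)`. -/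
def retwist (ρ : A →ₐ[K] A ⊗[K] H) : A ⊗[K] (H ⊗[K] B) →ₗ[K] H ⊗[K] (A ⊗[K] B) :=
  TensorProduct.map (LinearMap.mul' K H ∘ₗ TensorProduct.map (HopfAlgebra.antipode (R := K))
      LinearMap.id) LinearMap.id ∘ₗ (TensorProduct.tensorTensorTensorComm K H A H B).toLinearMap ∘ₗ
    ((TensorProduct.comm K A H).toLinearMap ∘ₗ ρ.toLinearMap).rTensor (H ⊗[K] B)

theorem untwist_gammaMap (hcoassoc : ∀ a, coactLeg ρ (ρ a) = (Coalgebra.comul (R := K)).lTensor A (ρ a))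
    (hcounit : ∀ a, TensorProduct.rid K A ((Coalgebra.counit (R := K)).lTensor A (ρ a)) = a)
    (w : A ⊗[K] B) : untwist ρ (gammaMap K A B H ρ lam w) =
      (TensorProduct.assoc K A H B).symm (lam.toLinearMap.lTensor A w) := by
  have h₁ (x : A ⊗[K] H) (h : H) (b : B) : untwist ρ (TensorProduct.map (LinearMap.mul' K H ∘ₗ
      TensorProduct.map (HopfAlgebra.antipode (R := K)) LinearMap.id) LinearMap.id
        (TensorProduct.tensorTensorTensorComm K H A H B (TensorProduct.comm K A H x ⊗ₜ (h ⊗ₜ b)))) =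
      (LinearMap.mulRight K h ∘ₗ LinearMap.mul' K H ∘ₗ
        (HopfAlgebra.antipode (R := K)).lTensor H).lTensor A (coactLeg ρ x) ⊗ₜ b := by
    induction x using TensorProduct.induction_on with
    | zero => simp
    | add x y hx hy => simp only [map_add, TensorProduct.add_tmul, hx, hy]
    | tmul a g =>
      simp only [untwist, coactLeg, LinearMap.comp_apply, LinearEquiv.coe_coe,
        TensorProduct.comm_tmul, TensorProduct.tensorTensorTensorComm_tmul, TensorProduct.map_tmul,
        LinearMap.id_apply, LinearMap.mul'_apply, TensorProduct.assoc_symm_tmul,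
        LinearMap.rTensor_tmul, AlgHom.toLinearMap_apply]
      congr 1
      induction ρ a using TensorProduct.induction_on with
      | zero => simp
      | add x y hx hy => simp only [map_add, TensorProduct.add_tmul, hx, hy]
      | tmul a' g' => simp [mul_assoc]
  have h₂ (z : A ⊗[K] H) (h : H) : ((LinearMap.mulRight K h ∘ₗ LinearMap.mul' K H ∘ₗ
        (HopfAlgebra.antipode (R := K)).lTensor H).lTensor A
          ((Coalgebra.comul (R := K)).lTensor A z)) =
      TensorProduct.rid K A ((Coalgebra.counit (R := K)).lTensor A z) ⊗ₜ h := by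
    rw [← LinearMap.comp_apply, ← LinearMap.lTensor_comp, LinearMap.comp_assoc, LinearMap.comp_assoc,
      HopfAlgebra.mul_antipode_lTensor_comul]
    induction z using TensorProduct.induction_on with
    | zero => simp
    | add x y hx hy => simp only [map_add, TensorProduct.add_tmul, hx, hy]
    | tmul a g => simp [Algebra.algebraMap_eq_smul_one, TensorProduct.smul_tmul]
  induction w using TensorProduct.induction_on with
  | zero => simp
  | add x y hx hy => simp only [map_add, hx, hy]
  | tmul a b =>
    rw [gammaMap_tmul, LinearMap.lTensor_tmul, AlgHom.toLinearMap_apply]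
    induction lam b using TensorProduct.induction_on with
    | zero => simp
    | add x y hx hy => simp only [map_add, TensorProduct.tmul_add, hx, hy]
    | tmul h b => rw [h₁, hcoassoc, h₂, hcounit, TensorProduct.assoc_symm_tmul]

theorem untwist_one_tmul (w : A ⊗[K] B) :
    untwist ρ ((1 : H) ⊗ₜ[K] w) = ρ.toLinearMap.rTensor B w := by
  have h (z : A ⊗[K] H) : (LinearMap.mul' K H).lTensor A (TensorProduct.assoc K A H H (z ⊗ₜ 1)) =
      z := by
    induction z using TensorProduct.induction_on with
    | zero => simp
    | add x y hx hy => simp only [map_add, TensorProduct.add_tmul, hx, hy]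
    | tmul a g => simp
  induction w using TensorProduct.induction_on with
  | zero => simp
  | add x y hx hy => simp only [map_add, TensorProduct.tmul_add, hx, hy]
  | tmul a b => simp [untwist, coactLeg, h]

theorem gammaMap_eq_retwist (w : A ⊗[K] B) :
    gammaMap K A B H ρ lam w = retwist ρ (lam.toLinearMap.lTensor A w) := by
  induction w using TensorProduct.induction_on with
  | zero => simp
  | add x y hx hy => simp only [map_add, hx, hy]
  | tmul a b => rfl

theorem retwist_coact (hcoassoc : ∀ a, coactLeg ρ (ρ a) = (Coalgebra.comul (R := K)).lTensor A (ρ a))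
    (hcounit : ∀ a, TensorProduct.rid K A ((Coalgebra.counit (R := K)).lTensor A (ρ a)) = a)
    (w : A ⊗[K] B) :
    retwist ρ (TensorProduct.assoc K A H B (ρ.toLinearMap.rTensor B w)) = 1 ⊗ₜ w := by
  have h₁ (x : A ⊗[K] H) (b : B) : retwist ρ (TensorProduct.assoc K A H B (x ⊗ₜ b)) =
      TensorProduct.assoc K H A B (TensorProduct.comm K A H ((LinearMap.mul' K H ∘ₗ
        (HopfAlgebra.antipode (R := K)).rTensor H).lTensor A (coactLeg ρ x)) ⊗ₜ b) := by
    induction x using TensorProduct.induction_on with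
    | zero => simp
    | add x y hx hy => simp only [map_add, TensorProduct.add_tmul, hx, hy]
    | tmul a g =>
      simp only [retwist, coactLeg, LinearMap.comp_apply, LinearEquiv.coe_coe,
        TensorProduct.assoc_tmul, LinearMap.rTensor_tmul, AlgHom.toLinearMap_apply]
      induction ρ a using TensorProduct.induction_on with
      | zero => simp
      | add x y hx hy => simp only [map_add, TensorProduct.add_tmul, hx, hy]
      | tmul a' g' => simp
  have h₂ (z : A ⊗[K] H) : TensorProduct.comm K A H ((LinearMap.mul' K H ∘ₗ
        (HopfAlgebra.antipode (R := K)).rTensor H).lTensor A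
          ((Coalgebra.comul (R := K)).lTensor A z)) =
      1 ⊗ₜ TensorProduct.rid K A ((Coalgebra.counit (R := K)).lTensor A z) := by
    rw [← LinearMap.comp_apply, ← LinearMap.lTensor_comp, LinearMap.comp_assoc,
      HopfAlgebra.mul_antipode_rTensor_comul]
    induction z using TensorProduct.induction_on with
    | zero => simp
    | add x y hx hy => simp only [map_add, TensorProduct.tmul_add, hx, hy]
    | tmul a g => simp [Algebra.algebraMap_eq_smul_one]
  induction w using TensorProduct.induction_on with
  | zero => simp
  | add x y hx hy => simp only [map_add, TensorProduct.tmul_add, hx, hy]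
  | tmul a b =>
    rw [LinearMap.rTensor_tmul, AlgHom.toLinearMap_apply, h₁, hcoassoc, h₂, hcounit,
      TensorProduct.assoc_tmul]

theorem gammaMap_eq_iff (hcoassoc : ∀ a, coactLeg ρ (ρ a) = (Coalgebra.comul (R := K)).lTensor A (ρ a))
    (hcounit : ∀ a, TensorProduct.rid K A ((Coalgebra.counit (R := K)).lTensor A (ρ a)) = a)
    (w : A ⊗[K] B) : gammaMap K A B H ρ lam w = 1 ⊗ₜ w ↔
      TensorProduct.assoc K A H B (ρ.toLinearMap.rTensor B w) = lam.toLinearMap.lTensor A w := by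
  constructor
  · intro h
    have h₁ := untwist_gammaMap lam hcoassoc hcounit w
    rw [h, untwist_one_tmul] at h₁
    exact ((TensorProduct.assoc K A H B).symm_apply_eq.1 h₁.symm).symm
  · intro h
    rw [gammaMap_eq_retwist, ← h, retwist_coact hcoassoc hcounit]

end Coinvariants

section Invariants

variable {K : Type} [Field K] {q : K} {m n t : ℕ}

theorem isUnit_list_prod_ofFn {M : Type} [Monoid M] {t : ℕ} {x : Fin t → M} (h : ∀ i, IsUnit (x i)) :
    IsUnit (List.ofFn x).prod := by
  induction t with
  | zero => simp
  | succ t ih =>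
    rw [List.ofFn_succ, List.prod_cons]
    exact (h 0).mul (ih fun i => h _)

theorem exists_perm_apply_lt {σ : Equiv.Perm (Fin t)} (h : σ ≠ 1) : ∃ i, σ i < i := by
  by_contra! hle
  refine h (Equiv.ext fun i => Fin.ext ?_)
  have := (Finset.sum_eq_sum_iff_of_le (s := Finset.univ) (f := fun i : Fin t => (i : ℕ))
    (g := fun i => (σ i : ℕ)) fun i _ => hle i).1 (Equiv.sum_comp σ fun i => (i : ℕ)).symm
  exact (this i (Finset.mem_univ _)).symm

variable {R : Type} [Ring R] [Algebra K R]

theorem isUnit_oqLift_qdet {φ : Fin t → Fin t → R} (hφ : IsQM q φ) (hdiag : ∀ i, IsUnit (φ i i))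
    (h : ∀ σ : Equiv.Perm (Fin t), σ ≠ 1 → ∃ i, φ i (σ i) = 0) :
    IsUnit (oqLift hφ (qdet K q t)) := by
  have : oqLift hφ (qdet K q t) = (List.ofFn fun i => φ i i).prod := by
    rw [qdet, qMinor, map_sum, Finset.sum_eq_single 1]
    · rw [map_smul, map_list_prod, List.map_ofFn]
      have : invCount (1 : Equiv.Perm (Fin t)) = 0 := by
        rw [invCount, Finset.card_eq_zero, Finset.filter_eq_empty_iff]
        rintro p - ⟨h₁, h₂⟩
        exact lt_asymm h₁ h₂
      rw [this, pow_zero, one_smul]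
      congr 2
      funext i
      exact oqLift_Xg hφ _ _
    · intro σ _ hσ
      obtain ⟨i, hi⟩ := h σ hσ
      rw [map_smul, map_list_prod, List.map_ofFn, List.prod_eq_zero, smul_zero]
      rw [List.mem_ofFn]
      exact ⟨i, by rw [← hi]; exact oqLift_Xg hφ _ _⟩
    · simp
  rw [this]
  exact isUnit_list_prod_ofFn hdiag

theorem isUnit_weightShift (c : ℕ) : IsUnit (weightShift K c) := by
  have h (d e : ℤ) (hde : d + e = 0) (g : (ℕ → ℤ) → K) :
      (fun r => g (r - Pi.single c d - Pi.single c e)) = g := by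
    funext r
    rw [sub_sub, ← Pi.single_add, hde, Pi.single_zero, sub_zero]
  refine ⟨⟨weightShift K c, ⟨⟨fun g r => g (r - Pi.single c (-1)), fun _ _ => rfl⟩, fun _ _ => rfl⟩,
    ?_, ?_⟩, rfl⟩
  · ext g r; exact congrFun (h 1 (-1) (by norm_num) g) r
  · ext g r; exact congrFun (h (-1) 1 (by norm_num) g) r

theorem isUnit_twistEnd (hq : q ≠ 0) (s : ℤ) : IsUnit (twistEnd q s) := by
  have h (s : ℤ) : twistEnd q s * twistEnd q (-s) = 1 := by
    ext g r
    change q ^ (s * r) * (q ^ (-s * r) * g r) = g r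
    rw [← mul_assoc, ← zpow_add₀ hq, neg_mul, add_neg_cancel, zpow_zero, one_mul]
  exact ⟨⟨_, _, h s, by rw [twistEnd_mul, h]⟩, rfl⟩

theorem bidiag_self (d e : ℕ → R) (i : Fin t) : bidiag d e i i = d i := by simp [bidiag]

theorem bidiag_of_lt (d e : ℕ → R) {i k : Fin t} (h : k < i) : bidiag d e i k = 0 := by
  have h : (k : ℕ) < i := h
  simp only [bidiag]
  split_ifs <;> first | rfl | omega

theorem isUnit_qdet_bidiag {d e : ℕ → R} (hd : ∀ i, IsUnit (d i))
    (hφ : IsQM q (bidiag d e : Fin t → Fin t → R)) : IsUnit (oqLift hφ (qdet K q t)) := by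
  refine isUnit_oqLift_qdet _ (fun i => by rw [bidiag_self]; exact hd i) fun σ hσ => ?_
  obtain ⟨i, hi⟩ := exists_perm_apply_lt hσ
  exact ⟨i, bidiag_of_lt _ _ hi⟩

theorem isUnit_qdet_bidiag_transpose {d e : ℕ → R} (hd : ∀ i, IsUnit (d i))
    (hφ : IsQM q (fun i j => bidiag d e j i : Fin t → Fin t → R)) :
    IsUnit (oqLift hφ (qdet K q t)) := by
  refine isUnit_oqLift_qdet _ (fun i => by rw [bidiag_self]; exact hd i) fun σ hσ => ?_
  obtain ⟨i, hi⟩ := exists_perm_apply_lt (inv_ne_one.2 hσ)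
  exact ⟨σ⁻¹ i, by simpa using bidiag_of_lt d e hi⟩

variable [NeZero q]

/-- The coaction on the left factor of a tensor product. -/
def leftCoact {φ : Fin t → Fin t → R} (hφ : IsQM q φ) :
    QMat K q m t ⊗[K] QMat K q n t →ₐ[K] (QMat K q m t ⊗[K] QMat K q n t) ⊗[K] R :=
  ((Algebra.TensorProduct.assoc K K K _ _ _).symm.toAlgHom.comp
    (Algebra.TensorProduct.map (AlgHom.id K _) (Algebra.TensorProduct.comm K _ _).toAlgHom)).comp
      ((Algebra.TensorProduct.assoc K K K _ _ _).toAlgHom.comp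
        (Algebra.TensorProduct.map (coact hφ) (AlgHom.id K _)))

/-- The coaction on the right factor of a tensor product. -/
def rightCoact {φ : Fin t → Fin t → R} (hφ : IsQM q φ) :
    QMat K q m t ⊗[K] QMat K q n t →ₐ[K] (QMat K q m t ⊗[K] QMat K q n t) ⊗[K] R :=
  (Algebra.TensorProduct.assoc K K K _ _ _).symm.toAlgHom.comp
    (Algebra.TensorProduct.map (AlgHom.id K _) (coact hφ))

theorem leftCoact_tmul {φ : Fin t → Fin t → R} (hφ : IsQM q φ) (x : QMat K q m t)
    (y : QMat K q n t) : leftCoact hφ (x ⊗ₜ y) = (TensorProduct.assoc K _ _ _).symm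
      ((TensorProduct.comm K R _).toLinearMap.lTensor _
        (TensorProduct.assoc K _ _ _ (coact hφ x ⊗ₜ y))) :=
  rfl

theorem rightCoact_tmul {φ : Fin t → Fin t → R} (hφ : IsQM q φ) (x : QMat K q m t)
    (y : QMat K q n t) :
    rightCoact hφ (x ⊗ₜ y) = (TensorProduct.assoc K _ _ _).symm (x ⊗ₜ coact hφ y) :=
  rfl

theorem rid_lTensor_leftCoact {φ : Fin t → Fin t → R} (hφ : IsQM q φ) (f : R →ₗ[K] K)
    (w : QMat K q m t ⊗[K] QMat K q n t) :
    TensorProduct.rid K _ (f.lTensor _ (leftCoact hφ w)) = (coactOp hφ f).rTensor _ w := by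
  induction w using TensorProduct.induction_on with
  | zero => simp
  | add x y hx hy => simp only [map_add, hx, hy]
  | tmul x y =>
    rw [leftCoact_tmul, LinearMap.rTensor_tmul, coactOp, LinearMap.comp_apply, LinearMap.comp_apply,
      AlgHom.toLinearMap_apply, LinearEquiv.coe_coe]
    induction coact hφ x using TensorProduct.induction_on with
    | zero => simp
    | add x y hx hy => simp only [map_add, TensorProduct.add_tmul, hx, hy]
    | tmul x r => simp [TensorProduct.smul_tmul']

theorem rid_lTensor_rightCoact {φ : Fin t → Fin t → R} (hφ : IsQM q φ) (f : R →ₗ[K] K)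
    (w : QMat K q m t ⊗[K] QMat K q n t) :
    TensorProduct.rid K _ (f.lTensor _ (rightCoact hφ w)) = (coactOp hφ f).lTensor _ w := by
  induction w using TensorProduct.induction_on with
  | zero => simp
  | add x y hx hy => simp only [map_add, hx, hy]
  | tmul x y =>
    rw [rightCoact_tmul, LinearMap.lTensor_tmul, coactOp, LinearMap.comp_apply, LinearMap.comp_apply,
      AlgHom.toLinearMap_apply, LinearEquiv.coe_coe]
    induction coact hφ y using TensorProduct.induction_on with
    | zero => simp
    | add x y hx hy => simp only [map_add, TensorProduct.tmul_add, hx, hy]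
    | tmul x r => simp

/-- Invariance under the quantum matrix `φ`. -/
def IsBalanced {φ : Fin t → Fin t → R} (hφ : IsQM q φ) (w : QMat K q m t ⊗[K] QMat K q n t) : Prop :=
  leftCoact hφ w = rightCoact hφ.transpose w

theorem IsBalanced.coactOp_eq {φ : Fin t → Fin t → R} {hφ : IsQM q φ}
    {w : QMat K q m t ⊗[K] QMat K q n t} (h : IsBalanced hφ w) (f : R →ₗ[K] K) :
    (coactOp hφ f).rTensor _ w = (coactOp hφ.transpose f).lTensor _ w := by
  rw [← rid_lTensor_leftCoact, h, rid_lTensor_rightCoact]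

/-- Invariance under the diagonal torus and the raising and lowering operators. -/
structure IsInv (w : QMat K q m t ⊗[K] QMat K q n t) : Prop where
  torus (μ : ℕ → ℤ) : (weightProj μ).rTensor _ w = (weightProj μ).lTensor _ w
  raise (j : ℕ) (r : ℤ) : (raiseOp j r).rTensor _ w = (lowerOp j r).lTensor _ w
  lower (j : ℕ) (r : ℤ) : (lowerOp j r).rTensor _ w = (raiseOp j r).lTensor _ w

theorem IsInv.sub {w w' : QMat K q m t ⊗[K] QMat K q n t} (h : IsInv w) (h' : IsInv w') :
    IsInv (w - w') where
  torus μ := by rw [map_sub, map_sub, h.torus, h'.torus]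
  raise j r := by rw [map_sub, map_sub, h.raise, h'.raise]
  lower j r := by rw [map_sub, map_sub, h.lower, h'.lower]

theorem coactOp_congr {φ ψ : Fin t → Fin t → R} (h : φ = ψ) (hφ : IsQM q φ) (hψ : IsQM q ψ)
    (f : R →ₗ[K] K) : (coactOp hφ f : QMat K q m t →ₗ[K] QMat K q m t) = coactOp hψ f := by
  subst h; rfl

theorem isInv_of_balanced {w : QMat K q m t ⊗[K] QMat K q n t}
    (h : ∀ (R : Type) [Ring R] [Algebra K R] (φ : Fin t → Fin t → R) (hφ : IsQM q φ),
      IsUnit (oqLift hφ (qdet K q t)) → IsBalanced hφ w) : IsInv w where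
  torus μ := by
    have := (h _ _ (isQM_torus q) (isUnit_qdet_bidiag isUnit_weightShift _)).coactOp_eq
      (weightSlot K μ)
    rw [weightProj, this, weightProj]
    refine congrArg (fun f => LinearMap.lTensor _ f w) (coactOp_congr ?_ _ _ _)
    funext i j
    simp only [bidiag, ite_self]
    by_cases hij : (i : ℕ) = j <;> simp [hij, eq_comm]
  raise j r := (h _ _ (isQM_raise (NeZero.ne q) j)
    (isUnit_qdet_bidiag (fun _ => isUnit_twistEnd (NeZero.ne q) _) _)).coactOp_eq (slot K r)
  lower j r := (h _ _ (isQM_raise (NeZero.ne q) j).transpose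
    (isUnit_qdet_bidiag_transpose (fun _ => isUnit_twistEnd (NeZero.ne q) _) _)).coactOp_eq
      (slot K r)

theorem isQM_sum (K : Type) [Field K] (q : K) [NeZero q] (m n t : ℕ) : IsQM q
    fun (i : Fin m) (j : Fin n) => ∑ k : Fin t,
      Algebra.TensorProduct.includeLeft (R := K) (S := K) (B := QMat K q n t) (Xm K q i k) *
        Algebra.TensorProduct.includeRight (R := K) (A := QMat K q m t) (Xm K q j k) :=
  ((isQM_Xm K q m t).map _).mul (NeZero.ne q) ((isQM_Xm K q n t).transpose.map _)
    fun i a b j => by simp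

/-- The comultiplication `X_{ij} ↦ ∑ X_{ik} ⊗ X_{jk}`. -/
def theta (K : Type) [Field K] (q : K) [NeZero q] (m n t : ℕ) :
    QMat K q m n →ₐ[K] QMat K q m t ⊗[K] QMat K q n t :=
  qlift (isQM_sum K q m n t)

theorem theta_Xm (i : Fin m) (j : Fin n) :
    theta K q m n t (Xm K q i j) = ∑ k, Xm K q i k ⊗ₜ Xm K q j k := by
  simp [theta]

theorem isInv_theta (x : QMat K q m n) : IsInv (theta K q m n t x) := by
  refine isInv_of_balanced fun R _ _ φ hφ _ => ?_
  have : (leftCoact hφ).comp (theta K q m n t) = (rightCoact hφ.transpose).comp (theta K q m n t) := by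
    refine QMat_hom_ext fun i j => ?_
    simp only [AlgHom.comp_apply, theta_Xm, map_sum, leftCoact_tmul, rightCoact_tmul, coact_Xm,
      TensorProduct.sum_tmul, TensorProduct.tmul_sum, TensorProduct.assoc_tmul,
      LinearMap.lTensor_tmul, LinearEquiv.coe_coe, TensorProduct.comm_tmul,
      TensorProduct.assoc_symm_tmul]
    exact Finset.sum_comm
  exact congrArg (fun f : QMat K q m n →ₐ[K] (QMat K q m t ⊗[K] QMat K q n t) ⊗[K] R => f x) this

end Invariants

section Injectivity

variable {K : Type} [Field K] {q : K} [NeZero q] {m n t : ℕ}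

/-- The coordinates on a tensor product with respect to ordered monomials. -/
def coordTmul (a : Fin m → Fin t → ℕ) (b : Fin n → Fin t → ℕ) :
    QMat K q m t ⊗[K] QMat K q n t →ₗ[K] K :=
  LinearMap.mul' K K ∘ₗ TensorProduct.map (coord a) (coord b)

@[simp] theorem coordTmul_tmul (a : Fin m → Fin t → ℕ) (b : Fin n → Fin t → ℕ) (x : QMat K q m t)
    (y : QMat K q n t) : coordTmul a b (x ⊗ₜ y) = coord a x * coord b y := by
  simp [coordTmul]

theorem tensor_basis_repr (w : QMat K q m t ⊗[K] QMat K q n t) (a b) :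
    ((pbwBasis K q m t).tensorProduct (pbwBasis K q n t)).repr w (a, b) = coordTmul a b w := by
  induction w using TensorProduct.induction_on with
  | zero => simp
  | add x y hx hy => simp only [map_add, Finsupp.add_apply, hx, hy]
  | tmul x y =>
    rw [Module.Basis.tensorProduct_repr_tmul_apply, pbwBasis_repr, pbwBasis_repr, coordTmul_tmul,
      smul_eq_mul, mul_comm]

theorem eq_of_coordTmul {w w' : QMat K q m t ⊗[K] QMat K q n t}
    (h : ∀ a b, coordTmul a b w = coordTmul a b w') : w = w' := by
  refine ((pbwBasis K q m t).tensorProduct (pbwBasis K q n t)).ext_elem fun i => ?_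
  rw [tensor_basis_repr w i.1 i.2, tensor_basis_repr w' i.1 i.2, h]

/-- The coefficient of an ordered monomial of the right factor. -/
def leftSlice (b : Fin n → Fin t → ℕ) : QMat K q m t ⊗[K] QMat K q n t →ₗ[K] QMat K q m t :=
  (TensorProduct.rid K _).toLinearMap ∘ₗ (coord b).lTensor _

theorem leftSlice_tmul (b : Fin n → Fin t → ℕ) (x : QMat K q m t) (y : QMat K q n t) :
    leftSlice b (x ⊗ₜ y) = coord b y • x := by
  simp [leftSlice]

/-- The coefficient of an ordered monomial of the left factor. -/
def rightSlice (a : Fin m → Fin t → ℕ) : QMat K q m t ⊗[K] QMat K q n t →ₗ[K] QMat K q n t :=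
  (TensorProduct.lid K _).toLinearMap ∘ₗ (coord a).rTensor _

theorem rightSlice_tmul (a : Fin m → Fin t → ℕ) (x : QMat K q m t) (y : QMat K q n t) :
    rightSlice a (x ⊗ₜ y) = coord a x • y := by
  simp [rightSlice]

theorem coord_leftSlice (a : Fin m → Fin t → ℕ) (b : Fin n → Fin t → ℕ)
    (w : QMat K q m t ⊗[K] QMat K q n t) : coord a (leftSlice b w) = coordTmul a b w := by
  induction w using TensorProduct.induction_on with
  | zero => simp
  | add x y hx hy => simp only [map_add, hx, hy]
  | tmul x y => simp [leftSlice_tmul, mul_comm]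

theorem coord_rightSlice (a : Fin m → Fin t → ℕ) (b : Fin n → Fin t → ℕ)
    (w : QMat K q m t ⊗[K] QMat K q n t) : coord b (rightSlice a w) = coordTmul a b w := by
  induction w using TensorProduct.induction_on with
  | zero => simp
  | add x y hx hy => simp only [map_add, hx, hy]
  | tmul x y => simp [rightSlice_tmul]

theorem leftSlice_rTensor (b : Fin n → Fin t → ℕ) (f : QMat K q m t →ₗ[K] QMat K q m t)
    (w : QMat K q m t ⊗[K] QMat K q n t) :
    leftSlice b (f.rTensor _ w) = f (leftSlice b w) := by
  induction w using TensorProduct.induction_on with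
  | zero => simp
  | add x y hx hy => simp only [map_add, hx, hy]
  | tmul x y => simp [leftSlice_tmul]

theorem rightSlice_lTensor (a : Fin m → Fin t → ℕ) (f : QMat K q n t →ₗ[K] QMat K q n t)
    (w : QMat K q m t ⊗[K] QMat K q n t) :
    rightSlice a (f.lTensor _ w) = f (rightSlice a w) := by
  induction w using TensorProduct.induction_on with
  | zero => simp
  | add x y hx hy => simp only [map_add, hx, hy]
  | tmul x y => simp [rightSlice_tmul]

theorem coordTmul_comm (a : Fin m → Fin t → ℕ) (b : Fin n → Fin t → ℕ)
    (w : QMat K q m t ⊗[K] QMat K q n t) :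
    coordTmul b a (TensorProduct.comm K _ _ w) = coordTmul a b w := by
  induction w using TensorProduct.induction_on with
  | zero => simp
  | add x y hx hy => simp only [map_add, hx, hy]
  | tmul x y => simp [mul_comm]

theorem leftSlice_comm (a : Fin m → Fin t → ℕ) (w : QMat K q m t ⊗[K] QMat K q n t) :
    leftSlice a (TensorProduct.comm K _ _ w) = rightSlice a w := by
  induction w using TensorProduct.induction_on with
  | zero => simp
  | add x y hx hy => simp only [map_add, hx, hy]
  | tmul x y => simp [leftSlice_tmul, rightSlice_tmul]

theorem IsInv.comm {w : QMat K q m t ⊗[K] QMat K q n t} (h : IsInv w) :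
    IsInv (TensorProduct.comm K _ _ w) := by
  have h₁ (f : QMat K q m t →ₗ[K] QMat K q m t) (w : QMat K q m t ⊗[K] QMat K q n t) :
      f.lTensor _ (TensorProduct.comm K _ _ w) = TensorProduct.comm K _ _ (f.rTensor _ w) := by
    induction w using TensorProduct.induction_on with
    | zero => simp
    | add x y hx hy => simp only [map_add, hx, hy]
    | tmul x y => simp
  have h₂ (f : QMat K q n t →ₗ[K] QMat K q n t) (w : QMat K q m t ⊗[K] QMat K q n t) :
      f.rTensor _ (TensorProduct.comm K _ _ w) = TensorProduct.comm K _ _ (f.lTensor _ w) := by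
    induction w using TensorProduct.induction_on with
    | zero => simp
    | add x y hx hy => simp only [map_add, hx, hy]
    | tmul x y => simp
  exact ⟨fun μ => by rw [h₁, h₂, h.torus], fun j r => by rw [h₁, h₂, h.lower],
    fun j r => by rw [h₁, h₂, h.raise]⟩

theorem IsInv.weight_eq {w : QMat K q m t ⊗[K] QMat K q n t} (h : IsInv w)
    {a : Fin m → Fin t → ℕ} {b : Fin n → Fin t → ℕ} (hab : coordTmul a b w ≠ 0) :
    weight a = weight b := by
  classical
  by_contra hne
  refine hab ?_
  have := congrArg (coordTmul a b) (h.torus (weight a))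
  rwa [← coord_leftSlice, leftSlice_rTensor, coord_weightProj, if_pos rfl, coord_leftSlice,
    ← coord_rightSlice a b (LinearMap.lTensor _ _ _), rightSlice_lTensor, coord_weightProj, if_neg (Ne.symm hne)] at this

theorem IsInv.hasWeight_leftSlice {w : QMat K q m t ⊗[K] QMat K q n t} (h : IsInv w)
    (b : Fin n → Fin t → ℕ) : HasWeight (weight b) (leftSlice b w) :=
  (hasWeight_iff _ _).2 fun a ha => h.weight_eq (by rwa [← coord_leftSlice])

theorem IsInv.hasWeight_rightSlice {w : QMat K q m t ⊗[K] QMat K q n t} (h : IsInv w)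
    (a : Fin m → Fin t → ℕ) : HasWeight (weight a) (rightSlice a w) :=
  (hasWeight_iff _ _).2 fun b hb => (h.weight_eq (by rwa [← coord_rightSlice])).symm

/-- The height of an exponent matrix. -/
def height (a : Fin m → Fin t → ℕ) : ℤ := ∑ l ∈ Finset.range t, (l : ℤ) * weight a l

theorem height_nonneg (a : Fin m → Fin t → ℕ) : 0 ≤ height a :=
  Finset.sum_nonneg fun _ _ => mul_nonneg (Int.natCast_nonneg _) (Int.natCast_nonneg _)

theorem height_eq_of_weight {a : Fin m → Fin t → ℕ} {b : Fin n → Fin t → ℕ}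
    (h : weight a = weight b) : height a = height b := by
  rw [height, h, height]

theorem height_eq_of_sub {a : Fin m → Fin t → ℕ} {b : Fin n → Fin t → ℕ} {j : ℕ} (hj : j + 1 < t)
    {r : ℤ} (h : weight b = weight a - r • simpleRoot j) : height b = height a + r := by
  have h₁ : ∑ l ∈ Finset.range t, (l : ℤ) * simpleRoot j l = -1 := by
    simp only [simpleRoot, Pi.sub_apply, mul_sub, Finset.sum_sub_distrib, Pi.single_apply, mul_ite,
      mul_one, mul_zero, Finset.sum_ite_eq', Finset.mem_range]
    rw [if_pos (by omega), if_pos hj]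
    push_cast
    ring
  simp only [height, h, Pi.sub_apply, Pi.smul_apply, smul_eq_mul, mul_sub, Finset.sum_sub_distrib,
    mul_left_comm _ r, ← Finset.mul_sum, h₁]
  ring

theorem IsInv.raiseOp_leftSlice {w : QMat K q m t ⊗[K] QMat K q n t} (h : IsInv w)
    {b : Fin n → Fin t → ℕ}
    (hb : ∀ (a : Fin m → Fin t → ℕ) (b' : Fin n → Fin t → ℕ), height b' < height b →
      coordTmul a b' w = 0) {j : ℕ} (hj : j + 1 < t) {r : ℤ} (hr : 1 ≤ r) :
    raiseOp j r (leftSlice b w) = 0 := by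
  classical
  refine eq_of_coord fun a => ?_
  rw [map_zero, ← leftSlice_rTensor, h.raise, coord_leftSlice, ← coord_rightSlice,
    rightSlice_lTensor, ← h.hasWeight_rightSlice a, ← weightProj_lowerOp hj, coord_weightProj]
  split_ifs with hw
  · have hh := height_eq_of_sub hj hw
    have : rightSlice a w = 0 := eq_of_coord fun b' => by
      rw [coord_rightSlice, map_zero]
      by_contra h'
      have h₁ := height_eq_of_weight (h.weight_eq h')
      exact h' (hb _ _ (by omega))
    rw [this, map_zero, map_zero]
  · rfl

/-- An invariant is determined by its semistandard coordinates. -/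
theorem IsInv.eq_zero {w : QMat K q m t ⊗[K] QMat K q n t} (h : IsInv w)
    (hw : ∀ (a : Fin m → Fin t → ℕ) (b : Fin n → Fin t → ℕ), IsStd a → IsStd b →
      colsum a = colsum b → coordTmul a b w = 0) : w = 0 := by
  suffices ∀ (d : ℕ) (a : Fin m → Fin t → ℕ) (b : Fin n → Fin t → ℕ), height b = d →
      coordTmul a b w = 0 from
    eq_of_coordTmul fun a b => by rw [map_zero, this _ a b (Int.toNat_of_nonneg (height_nonneg b)).symm]
  intro d
  induction d using Nat.strong_induction_on with
  | _ d ih =>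
    have hlow (a : Fin m → Fin t → ℕ) (b : Fin n → Fin t → ℕ) (hb : height b < d) :
        coordTmul a b w = 0 :=
      ih (height b).toNat (by have := height_nonneg b; omega) a b
        (Int.toNat_of_nonneg (height_nonneg b)).symm
    have hstd (a : Fin m → Fin t → ℕ) (b : Fin n → Fin t → ℕ) (hb : height b = d) (hbs : IsStd b) :
        coordTmul a b w = 0 := by
      rw [← coord_leftSlice]
      by_contra hne
      obtain ⟨a', ha', hne'⟩ := exists_isStd_coord_ne_zero (v := leftSlice b w)
        (fun h0 => hne (by rw [h0, map_zero])) (h.hasWeight_leftSlice b)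
        fun j hj r hr => h.raiseOp_leftSlice (fun a b' hb' => hlow a b' (hb ▸ hb')) hj hr
      rw [coord_leftSlice] at hne'
      refine hne' (hw a' b ha' hbs ?_)
      funext c
      exact Nat.cast_injective (R := ℤ) (congrFun (h.weight_eq hne') c)
    intro a b hb
    by_contra hne
    have hab := height_eq_of_weight (h.weight_eq hne)
    obtain ⟨b', hb', hne'⟩ := exists_isStd_coord_ne_zero (v := rightSlice a w)
      (fun h0 => hne (by rw [← coord_rightSlice, h0, map_zero])) (h.hasWeight_rightSlice a)
      fun j hj r hr => by
        rw [← leftSlice_comm]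
        refine h.comm.raiseOp_leftSlice (fun b' a' ha' => ?_) hj hr
        rw [coordTmul_comm]
        by_contra h'
        exact h' (hlow a' b' (by rw [← height_eq_of_weight (h.weight_eq h')]; omega))
    rw [coord_rightSlice] at hne'
    exact hne' (hstd a b' (by rw [← height_eq_of_weight (h.weight_eq hne')]; omega) hb')

end Injectivity

section RSK

/-- The sum of a finite family of rows. -/
def shape {u : ℕ} (a : Fin u → ℕ → ℕ) (c : ℕ) : ℕ := ∑ i, a i c

theorem shape_succ {u : ℕ} (a : Fin (u + 1) → ℕ → ℕ) (c : ℕ) :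
    shape a c = a 0 c + shape (Fin.tail a) c := Fin.sum_univ_succ _

/-- The skew shape `l / k` is a horizontal strip. -/
def Interlaces (k l : ℕ → ℕ) : Prop := ∀ c, k c ≤ l c ∧ l (c + 1) ≤ k c

/-- Chains of horizontal strips. -/
def IsChainStd : {u : ℕ} → (Fin u → ℕ → ℕ) → Prop
  | 0, _ => True
  | _ + 1, a => IsChainStd (Fin.tail a) ∧ Interlaces (shape (Fin.tail a)) (shape a)

/-- The local rule of the Robinson-Schensted-Knuth correspondence. -/
def localRule (k k' l : ℕ → ℕ) (c : ℕ) : ℕ :=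
  max (k (c + 1)) (k' (c + 1)) + min (k c) (k' c) - l (c + 1)

/-- The number recorded by the local rule. -/
def localCount (k k' l : ℕ → ℕ) : ℕ := l 0 - max (k 0) (k' 0)

section LocalRule

variable {k k' l : ℕ → ℕ}

theorem interlaces_localRule_left (h : Interlaces k l) (h' : Interlaces k' l) :
    Interlaces (localRule k k' l) k := fun c => by
  have := h c; have := h' c; have := h (c + 1); have := h' (c + 1)
  simp only [localRule]; omega

theorem interlaces_localRule_right (h : Interlaces k l) (h' : Interlaces k' l) :
    Interlaces (localRule k k' l) k' := fun c => by
  have := h c; have := h' c; have := h (c + 1); have := h' (c + 1)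
  simp only [localRule]; omega

theorem localRule_injective {l' : ℕ → ℕ} (h : Interlaces k l) (h' : Interlaces k' l)
    (hl : Interlaces k l') (hl' : Interlaces k' l') (e : localRule k k' l = localRule k k' l')
    (e' : localCount k k' l = localCount k k' l') : l = l' := by
  funext c
  cases c with
  | zero =>
    have := h 0; have := h' 0; have := hl 0; have := hl' 0
    simp only [localCount] at e'
    omega
  | succ c =>
    have := h c; have := h' c; have := h (c + 1); have := h' (c + 1)
    have := hl c; have := hl' c; have := hl (c + 1); have := hl' (c + 1)
    have e := congrFun e c
    simp only [localRule] at e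
    omega

theorem sum_localRule (h : Interlaces k l) (h' : Interlaces k' l) {M : ℕ} (hM : l M = 0) :
    (∑ c ∈ Finset.range M, l c) + ∑ c ∈ Finset.range M, localRule k k' l c =
      (∑ c ∈ Finset.range M, k c) + (∑ c ∈ Finset.range M, k' c) + localCount k k' l := by
  have key (M : ℕ) : (∑ c ∈ Finset.range (M + 1), l c) + ∑ c ∈ Finset.range M, localRule k k' l c =
      (∑ c ∈ Finset.range M, k c) + (∑ c ∈ Finset.range M, k' c) + localCount k k' l +
        max (k M) (k' M) := by
    induction M with
    | zero =>
      have := h 0; have := h' 0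
      simp [localCount]
      omega
    | succ M ih =>
      have := h M; have := h' M; have := h (M + 1); have := h' (M + 1)
      rw [Finset.sum_range_succ l, Finset.sum_range_succ (localRule k k' l),
        Finset.sum_range_succ k, Finset.sum_range_succ k']
      simp only [localRule] at ih ⊢
      omega
  have := key M
  have h₁ := h M
  have h₂ := h' M
  rw [Finset.sum_range_succ] at this
  omega

end LocalRule

/-- Growing a chain along a horizontal strip below its shape. -/
def rowInsert : {u : ℕ} → (Fin u → ℕ → ℕ) → (ℕ → ℕ) → (Fin u → ℕ → ℕ) × (Fin u → ℕ)
  | 0, a, _ => (a, 0)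
  | _ + 1, a, k =>
    let l := localRule (shape (Fin.tail a)) k (shape a)
    let r := rowInsert (Fin.tail a) l
    (Fin.cons (k - l) r.1, Fin.cons (localCount (shape (Fin.tail a)) k (shape a)) r.2)

theorem shape_rowInsert {u : ℕ} {a : Fin u → ℕ → ℕ} {k : ℕ → ℕ} (ha : IsChainStd a)
    (hk : Interlaces k (shape a)) : shape (rowInsert a k).1 = k := by
  induction u generalizing k with
  | zero =>
    funext c
    have := (hk c).1
    simp [shape] at this ⊢
    omega
  | succ u ih =>
    funext c
    rw [shape_succ, rowInsert]
    simp only [Fin.tail_cons, Fin.cons_zero]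
    rw [ih ha.1 (interlaces_localRule_left ha.2 hk), Pi.sub_apply]
    have := (interlaces_localRule_right ha.2 hk c).1
    omega

theorem isChainStd_rowInsert {u : ℕ} {a : Fin u → ℕ → ℕ} {k : ℕ → ℕ} (ha : IsChainStd a)
    (hk : Interlaces k (shape a)) : IsChainStd (rowInsert a k).1 := by
  induction u generalizing k with
  | zero => exact ha
  | succ u ih =>
    refine ⟨ih ha.1 (interlaces_localRule_left ha.2 hk), ?_⟩
    rw [shape_rowInsert ha hk]
    simp only [rowInsert, Fin.tail_cons]
    rw [shape_rowInsert ha.1 (interlaces_localRule_left ha.2 hk)]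
    exact interlaces_localRule_right ha.2 hk

theorem rowInsert_injective {u : ℕ} {a a' : Fin u → ℕ → ℕ} {k k' : ℕ → ℕ} (ha : IsChainStd a)
    (hk : Interlaces k (shape a)) (ha' : IsChainStd a') (hk' : Interlaces k' (shape a'))
    (h : rowInsert a k = rowInsert a' k') : a = a' ∧ k = k' := by
  have hkk : k = k' := by rw [← shape_rowInsert ha hk, h, shape_rowInsert ha' hk']
  refine ⟨?_, hkk⟩
  induction u generalizing k k' with
  | zero => exact Subsingleton.elim _ _
  | succ u ih =>
    subst hkk
    simp only [rowInsert, Prod.mk.injEq, Fin.cons_inj] at h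
    have hr : rowInsert (Fin.tail a) (localRule (shape (Fin.tail a)) k (shape a)) =
        rowInsert (Fin.tail a') (localRule (shape (Fin.tail a')) k (shape a')) :=
      Prod.ext h.1.2 h.2.2
    have hl : localRule (shape (Fin.tail a)) k (shape a) =
        localRule (shape (Fin.tail a')) k (shape a') := by
      rw [← shape_rowInsert ha.1 (interlaces_localRule_left ha.2 hk), hr,
        shape_rowInsert ha'.1 (interlaces_localRule_left ha'.2 hk')]
    have ht : Fin.tail a = Fin.tail a' := ih ha.1 (interlaces_localRule_left ha.2 hk) ha'.1
      (interlaces_localRule_left ha'.2 hk') hr hl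
    have hs : shape a = shape a' := by
      have h₁ := ha.2
      have h₂ := h.2.1
      rw [ht] at hl h₁ h₂
      exact localRule_injective h₁ hk ha'.2 hk' hl h₂
    rw [← Fin.cons_self_tail a, ← Fin.cons_self_tail a', ht]
    congr 1
    funext c
    have h₃ := congrFun hs c
    rw [shape_succ, shape_succ, ht] at h₃
    omega

theorem sum_rowInsert {u : ℕ} {a : Fin u → ℕ → ℕ} {k : ℕ → ℕ} (ha : IsChainStd a)
    (hk : Interlaces k (shape a)) {M : ℕ} (hM : shape a M = 0) :
    ∑ c ∈ Finset.range M, shape a c = (∑ c ∈ Finset.range M, k c) + ∑ i, (rowInsert a k).2 i := by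
  induction u generalizing k with
  | zero =>
    have h₁ (c : ℕ) : k c = 0 := Nat.le_zero.1 (hk c).1
    simp [h₁, shape]
  | succ u ih =>
    have h₁ := sum_localRule ha.2 hk hM
    have h₂ := ih ha.1 (interlaces_localRule_left ha.2 hk) (Nat.le_zero.1 (hM ▸ (ha.2 M).1))
    rw [Fin.sum_univ_succ]
    simp only [rowInsert, Fin.cons_zero, Fin.cons_succ]
    omega

/-- The Robinson-Schensted-Knuth correspondence, from pairs of tableaux to matrices. -/
def rsk {n : ℕ} : {m : ℕ} → (Fin m → ℕ → ℕ) → (Fin n → ℕ → ℕ) → Fin m → Fin n → ℕ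
  | 0, _, _ => fun i => i.elim0
  | _ + 1, a, b =>
    let r := rowInsert b (shape (Fin.tail a))
    Fin.cons r.2 (rsk (Fin.tail a) r.1)

theorem rsk_injective {m n : ℕ} {a a' : Fin m → ℕ → ℕ} {b b' : Fin n → ℕ → ℕ} (ha : IsChainStd a)
    (hb : IsChainStd b) (hab : shape a = shape b) (ha' : IsChainStd a') (hb' : IsChainStd b')
    (hab' : shape a' = shape b') (h : rsk a b = rsk a' b') : a = a' ∧ b = b' := by
  induction m generalizing b b' with
  | zero =>
    refine ⟨Subsingleton.elim _ _, ?_⟩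
    have h₁ {b : Fin n → ℕ → ℕ} {a : Fin 0 → ℕ → ℕ} (hab : shape a = shape b) (i c) : b i c = 0 :=
      Finset.sum_eq_zero_iff.1 (congrFun hab c).symm i (Finset.mem_univ i)
    funext i c
    rw [h₁ hab, h₁ hab']
  | succ m ih =>
    have hk : Interlaces (shape (Fin.tail a)) (shape b) := hab ▸ ha.2
    have hk' : Interlaces (shape (Fin.tail a')) (shape b') := hab' ▸ ha'.2
    simp only [rsk, Fin.cons_inj] at h
    obtain ⟨h₁, h₂⟩ := ih ha.1 (isChainStd_rowInsert hb hk) (shape_rowInsert hb hk).symm ha'.1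
      (isChainStd_rowInsert hb' hk') (shape_rowInsert hb' hk').symm h.2
    obtain ⟨h₃, -⟩ := rowInsert_injective hb hk hb' hk' (Prod.ext h₂ h.1)
    refine ⟨?_, h₃⟩
    rw [← Fin.cons_self_tail a, ← Fin.cons_self_tail a', h₁]
    congr 1
    funext c
    have h₄ := congrFun (hab.trans ((congrArg shape h₃).trans hab'.symm)) c
    rw [shape_succ, shape_succ, h₁] at h₄
    omega

theorem sum_rsk {m n : ℕ} {a : Fin m → ℕ → ℕ} {b : Fin n → ℕ → ℕ} (ha : IsChainStd a)
    (hb : IsChainStd b) (hab : shape a = shape b) {M : ℕ} (hM : shape a M = 0) :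
    ∑ i, ∑ j, rsk a b i j = ∑ c ∈ Finset.range M, shape a c := by
  induction m generalizing b with
  | zero => simp [shape]
  | succ m ih =>
    have hk : Interlaces (shape (Fin.tail a)) (shape b) := hab ▸ ha.2
    have h₁ := sum_rowInsert hb hk (hab ▸ hM)
    have h₂ := ih ha.1 (isChainStd_rowInsert hb hk) (shape_rowInsert hb hk).symm
      (Nat.le_zero.1 (hM ▸ (ha.2 M).1))
    rw [Fin.sum_univ_succ]
    simp only [rsk, Fin.cons_zero, Fin.cons_succ]
    rw [h₂, hab, h₁, add_comm]

end RSK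

section StdPairs

variable {u t : ℕ}

/-- The rows of an exponent matrix, extended by zero. -/
def extRows (a : Fin u → Fin t → ℕ) : Fin u → ℕ → ℕ := fun i => extZero (a i)

theorem extRows_injective : Function.Injective (extRows (u := u) (t := t)) := fun a a' h => by
  funext i c
  have := congrFun (congrFun h i) c
  simpa only [extRows, extZero_val] using this

theorem IsStd.isChainStd_extRows {a : Fin u → Fin t → ℕ} (h : IsStd a) :
    IsChainStd (extRows a) := by
  induction u with
  | zero => trivial
  | succ u ih =>
    refine ⟨ih h.1, fun c => ⟨?_, h.2 c⟩⟩
    exact le_of_le_of_eq (Nat.le_add_left _ _) (colsum_succ a c).symm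

end StdPairs

section Homogeneous

variable {K : Type} [Field K] {q : K} {u v : ℕ}

/-- Homogeneous elements: multiples of words of a given length. -/
inductive IsHomog : {u : ℕ} → ℕ → QMat K q u v → Prop
  | one {u : ℕ} : IsHomog (u := u) 0 1
  | mul {u : ℕ} {d : ℕ} {x : QMat K q u v} (i : Fin u) (j : Fin v) (h : IsHomog d x) :
      IsHomog (d + 1) (Xm K q i j * x)
  | smul {u : ℕ} {d : ℕ} {x : QMat K q u v} (c : K) (h : IsHomog d x) : IsHomog d (c • x)

theorem IsHomog.inclRow {d : ℕ} {x : QMat K q u v} (h : IsHomog d x) :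
    IsHomog d (inclRow x) := by
  induction h with
  | one => rw [map_one]; exact .one
  | mul i j _ ih => rw [map_mul, inclRow_Xm]; exact .mul _ _ ih
  | smul c _ ih => rw [map_smul]; exact .smul c ih

theorem IsHomog.rowmon_mul (hq : q ≠ 0) {d : ℕ} {x : QMat K q (u + 1) v} (h : IsHomog d x)
    (k : Fin v → ℕ) : IsHomog (d + ∑ j, k j) (rowmon (Xm K q 0) k * x) := by
  induction k using rowExp_induction with
  | zero => simpa using h
  | step c k ih =>
    rw [rowmon_Xm_step hq, smul_mul_assoc, mul_assoc]
    refine .smul _ ?_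
    have : d + ∑ j, (k + Pi.single c 1 : Fin v → ℕ) j = d + ∑ j, k j + 1 := by
      simp [Finset.sum_add_distrib, add_assoc]
    rw [this]
    exact .mul _ _ ih

theorem isHomog_pbw (hq : q ≠ 0) (a : Fin u → Fin v → ℕ) :
    IsHomog (∑ i, ∑ j, a i j) (pbw (K := K) (q := q) a) := by
  induction u with
  | zero => exact .one
  | succ u ih =>
    have : ∑ i, ∑ j, a i j = ∑ i, ∑ j, Fin.tail a i j + ∑ j, a 0 j := by
      rw [Fin.sum_univ_succ, add_comm]; rfl
    rw [this]
    exact (ih (Fin.tail a)).inclRow.rowmon_mul hq _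

variable [NeZero q] {m n t : ℕ}

theorem weightProj_rTensor_mul (μ : ℕ → ℤ) (i : Fin m) (c : Fin t) (y : QMat K q n t)
    (w : QMat K q m t ⊗[K] QMat K q n t) :
    (weightProj μ).rTensor _ ((Xm K q i c ⊗ₜ[K] y) * w) =
      (Xm K q i c ⊗ₜ[K] y) * (weightProj (μ - Pi.single (c : ℕ) 1)).rTensor _ w := by
  induction w using TensorProduct.induction_on with
  | zero => simp
  | add x y hx hy => simp only [mul_add, map_add, hx, hy]
  | tmul x y => simp [weightProj_Xm_mul]

theorem weightProj_theta_eq_zero {d : ℕ} {x : QMat K q m n} (h : IsHomog d x) {μ : ℕ → ℤ}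
    (hμ : ∑ c ∈ Finset.range t, μ c ≠ d) :
    (weightProj μ).rTensor _ (theta K q m n t x) = 0 := by
  induction h generalizing μ with
  | one =>
    rw [map_one, Algebra.TensorProduct.one_def, LinearMap.rTensor_tmul, weightProj_one, if_neg,
      TensorProduct.zero_tmul]
    rintro rfl
    simp at hμ
  | mul i j _ ih =>
    rw [map_mul, theta_Xm, Finset.sum_mul, map_sum]
    refine Finset.sum_eq_zero fun c _ => ?_
    rw [weightProj_rTensor_mul, ih, mul_zero]
    intro h
    refine hμ ?_
    simp only [Pi.sub_apply, Finset.sum_sub_distrib, Pi.single_apply, Finset.sum_ite_eq',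
      Finset.mem_range, c.2, if_true] at h
    push_cast
    linarith
  | smul c _ ih => rw [map_smul, map_smul, ih hμ, smul_zero]

theorem sum_colsum_eq {d : ℕ} {x : QMat K q m n} (h : IsHomog d x) {a : Fin m → Fin t → ℕ}
    {b : Fin n → Fin t → ℕ} (hab : coordTmul a b (theta K q m n t x) ≠ 0) :
    ∑ c ∈ Finset.range t, colsum a c = d := by
  by_contra hne
  refine hab ?_
  have := congrArg (coordTmul a b) (weightProj_theta_eq_zero (t := t) h (μ := weight a)
    (by simp only [weight]; exact_mod_cast hne))
  rwa [← coord_leftSlice, leftSlice_rTensor, coord_weightProj, if_pos rfl, coord_leftSlice,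
    map_zero] at this

end Homogeneous

section ThetaInjective

variable {K : Type} [Field K] {q : K} {m n : ℕ}

theorem isQM_scalarOne (q : K) (t : ℕ) :
    IsQM q (fun (i : Fin m) (k : Fin t) => if (i : ℕ) = k then (1 : K) else 0) := by
  refine ⟨?_, ?_, ?_, ?_⟩
  · intro i j k h
    have : ¬ ((i : ℕ) = j ∧ (i : ℕ) = k) := by have : (j : ℕ) < k := h; omega
    by_cases h1 : (i : ℕ) = j <;> by_cases h2 : (i : ℕ) = k <;> simp_all
  · intro i k j h
    have : ¬ ((i : ℕ) = j ∧ (k : ℕ) = j) := by have : (i : ℕ) < k := h; omega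
    by_cases h1 : (i : ℕ) = j <;> by_cases h2 : (k : ℕ) = j <;> simp_all
  · intro i k j l h h'
    exact mul_comm _ _
  · intro i k j l h h'
    have : ¬ ((i : ℕ) = l ∧ (k : ℕ) = j) := by
      have : (i : ℕ) < k := h
      have : (j : ℕ) < l := h'
      omega
    by_cases h1 : (i : ℕ) = l <;> by_cases h2 : (k : ℕ) = j <;> simp_all [mul_comm]

theorem isQM_partialTranspose (K : Type) [Field K] (q : K) (m n t : ℕ) :
    IsQM q (fun (j : Fin n) (k : Fin t) => if h : (k : ℕ) < m then Xm K q (⟨k, h⟩ : Fin m) j else 0) := by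
  have hX := (isQM_Xm K q m n).transpose
  refine ⟨fun {i j k} h => ?_, fun {i k j} h => ?_, fun {i k j l} h h' => ?_,
    fun {i k j l} h h' => ?_⟩
  · by_cases h₂ : (k : ℕ) < m
    · have h₁ : (j : ℕ) < m := lt_trans h h₂
      simp only [h₁, h₂, dif_pos]
      exact hX.row h
    · simp [h₂]
  · by_cases h₂ : (j : ℕ) < m
    · simp only [h₂, dif_pos]
      exact hX.col h
    · simp [h₂]
  · by_cases h₂ : (j : ℕ) < m
    · have h₁ : (l : ℕ) < m := lt_trans h' h₂
      simp only [h₁, h₂, dif_pos]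
      exact hX.comm h h'
    · simp [h₂]
  · by_cases h₂ : (l : ℕ) < m
    · have h₁ : (j : ℕ) < m := lt_trans h' h₂
      simp only [h₁, h₂, dif_pos]
      exact hX.quantum h h'
    · simp [h₂]

theorem theta_injective [NeZero q] {t : ℕ} (h : m ≤ t) : Function.Injective (theta K q m n t) := by
  let f : QMat K q m t →ₐ[K] QMat K q m n := (Algebra.ofId K _).comp (qlift (isQM_scalarOne q t))
  let g : QMat K q n t →ₐ[K] QMat K q m n := qlift (isQM_partialTranspose K q m n t)
  let F := Algebra.TensorProduct.lift f g fun x y => by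
    rw [AlgHom.comp_apply]
    exact Algebra.commutes _ _
  have : F.comp (theta K q m n t) = AlgHom.id K _ := QMat_hom_ext fun i j => by
    have hi : (i : ℕ) < t := i.2.trans_le h
    rw [AlgHom.comp_apply, theta_Xm, map_sum, Finset.sum_eq_single ⟨i, hi⟩]
    · simp [F, f, g]
    · intro k _ hk
      have : (i : ℕ) ≠ k := fun h => hk (Fin.ext h.symm)
      simp [F, f, g, this]
    · simp
  exact Function.LeftInverse.injective (g := F) fun x => DFunLike.congr_fun this x

end ThetaInjective
section Counting

variable {K : Type} [Field K] {q : K} {m n N : ℕ}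

/-- Exponent matrices of a given degree. -/
abbrev DegMat (m n d : ℕ) := {k : Fin m → Fin n → ℕ // ∑ i, ∑ j, k i j = d}

instance (m n d : ℕ) : Finite (DegMat m n d) := by
  refine Finite.of_injective (β := Fin m → Fin n → Fin (d + 1)) (fun k i j => ⟨k.1 i j, ?_⟩) ?_
  · refine Nat.lt_succ_of_le (le_of_le_of_eq ?_ k.2)
    exact (Finset.single_le_sum (f := fun j => k.1 i j) (fun _ _ => Nat.zero_le _)
      (Finset.mem_univ j)).trans (Finset.single_le_sum (f := fun i => ∑ j, k.1 i j)
        (fun _ _ => Nat.zero_le _) (Finset.mem_univ i))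
  · intro k k' h
    refine Subtype.ext (funext fun i => funext fun j => ?_)
    exact congrArg Fin.val (congrFun (congrFun h i) j)

/-- Pairs of semistandard exponent matrices with equal column sums and of a given degree. -/
abbrev StdPair (m n N d : ℕ) :=
  {p : (Fin m → Fin N → ℕ) × (Fin n → Fin N → ℕ) // IsStd p.1 ∧ IsStd p.2 ∧
    colsum p.1 = colsum p.2 ∧ ∑ c ∈ Finset.range N, colsum p.1 c = d}

/-- The Robinson-Schensted-Knuth correspondence on pairs of semistandard exponent matrices. -/
def stdRsk {d : ℕ} (p : StdPair m n N d) : DegMat m n d :=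
  ⟨rsk (extRows p.1.1) (extRows p.1.2), by
    rw [sum_rsk p.2.1.isChainStd_extRows p.2.2.1.isChainStd_extRows p.2.2.2.1
      (colsum_of_le _ le_rfl)]
    exact p.2.2.2.2⟩

theorem stdRsk_injective {d : ℕ} :
    Function.Injective (stdRsk : StdPair m n N d → DegMat m n d) := by
  intro p p' h
  obtain ⟨h₁, h₂⟩ := rsk_injective p.2.1.isChainStd_extRows p.2.2.1.isChainStd_extRows p.2.2.2.1
    p'.2.1.isChainStd_extRows p'.2.2.1.isChainStd_extRows p'.2.2.2.1 (congrArg Subtype.val h)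
  exact Subtype.ext (Prod.ext (extRows_injective h₁) (extRows_injective h₂))

variable [NeZero q]

theorem exists_theta_coord_of_degree (h : m ≤ N) (d : ℕ)
    (f : (Fin m → Fin N → ℕ) → (Fin n → Fin N → ℕ) → K) :
    ∃ x : QMat K q m n, ∀ a b, IsStd a → IsStd b → colsum a = colsum b →
      coordTmul a b (theta K q m n N x) =
        if ∑ c ∈ Finset.range N, colsum a c = d then f a b else 0 := by
  classical
  have := Fintype.ofFinite (DegMat m n d)
  have : Finite (StdPair m n N d) := Finite.of_injective _ stdRsk_injective
  have := Fintype.ofFinite (StdPair m n N d)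
  let mk : (DegMat m n d → K) →ₗ[K] QMat K q m n :=
    Fintype.linearCombination K fun k => pbw k.1
  let ev : (DegMat m n d → K) →ₗ[K] StdPair m n N d → K :=
    LinearMap.pi fun p => coordTmul p.1.1 p.1.2 ∘ₗ (theta K q m n N).toLinearMap ∘ₗ mk
  have hdeg (g : DegMat m n d → K) {a : Fin m → Fin N → ℕ} {b : Fin n → Fin N → ℕ}
      (hd : ∑ c ∈ Finset.range N, colsum a c ≠ d) :
      coordTmul a b (theta K q m n N (mk g)) = 0 := by
    simp only [mk, Fintype.linearCombination_apply, map_sum, map_smul]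
    refine Finset.sum_eq_zero fun k _ => ?_
    by_contra hne
    exact hd ((sum_colsum_eq (isHomog_pbw (NeZero.ne q) k.1)
      (right_ne_zero_of_smul hne)).trans k.2)
  have hinj : Function.Injective ev := by
    refine (injective_iff_map_eq_zero ev).2 fun g hg => ?_
    have h₁ : theta K q m n N (mk g) = 0 := by
      refine (isInv_theta _).eq_zero fun a b ha hb hab => ?_
      by_cases hd : ∑ c ∈ Finset.range N, colsum a c = d
      · exact congrFun hg ⟨(a, b), ha, hb, hab, hd⟩
      · exact hdeg g hd
    have h₂ : mk g = 0 := theta_injective h (h₁.trans (map_zero _).symm)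
    funext k
    have h₃ := congrArg (coord k.1) h₂
    simpa [mk, Fintype.linearCombination_apply, coord_pbw, Subtype.val_inj] using h₃
  have hcard : Module.finrank K (DegMat m n d → K) = Module.finrank K (StdPair m n N d → K) := by
    refine le_antisymm (LinearMap.finrank_le_finrank_of_injective hinj) ?_
    rw [Module.finrank_fintype_fun_eq_card, Module.finrank_fintype_fun_eq_card]
    exact Fintype.card_le_of_injective _ stdRsk_injective
  obtain ⟨g, hg⟩ := (LinearMap.injective_iff_surjective_of_finrank_eq_finrank hcard).1 hinj
    fun p => f p.1.1 p.1.2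
  refine ⟨mk g, fun a b ha hb hab => ?_⟩
  split_ifs with hd
  · exact congrFun hg ⟨(a, b), ha, hb, hab, hd⟩
  · exact hdeg g hd

theorem exists_theta_coord (h : m ≤ N) (S : Finset ℕ)
    (f : (Fin m → Fin N → ℕ) → (Fin n → Fin N → ℕ) → K) :
    ∃ x : QMat K q m n, ∀ a b, IsStd a → IsStd b → colsum a = colsum b →
      coordTmul a b (theta K q m n N x) =
        if ∑ c ∈ Finset.range N, colsum a c ∈ S then f a b else 0 := by
  choose x hx using fun d => exists_theta_coord_of_degree (q := q) h d f
  refine ⟨∑ d ∈ S, x d, fun a b ha hb hab => ?_⟩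
  simp only [map_sum, hx _ a b ha hb hab, Finset.sum_ite_eq]

end Counting

section Truncation

variable {K : Type} [Field K] {q : K} {u t M : ℕ}

theorem isQM_truncate (K : Type) [Field K] (q : K) (u t M : ℕ) :
    IsQM q (fun (i : Fin u) (c : Fin (t + M)) =>
      if h : (c : ℕ) < t then Xm K q i (⟨c, h⟩ : Fin t) else 0) := by
  have hX := isQM_Xm K q u t
  refine ⟨fun {i j k} h => ?_, fun {i k j} h => ?_, fun {i k j l} h h' => ?_,
    fun {i k j l} h h' => ?_⟩
  · by_cases h₂ : (k : ℕ) < t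
    · have h₁ : (j : ℕ) < t := lt_trans h h₂
      simp only [h₁, h₂, dif_pos]
      exact hX.row h
    · simp [h₂]
  · by_cases h₂ : (j : ℕ) < t
    · simp only [h₂, dif_pos]
      exact hX.col h
    · simp [h₂]
  · by_cases h₂ : (j : ℕ) < t
    · have h₁ : (l : ℕ) < t := lt_trans h' h₂
      simp only [h₁, h₂, dif_pos]
      exact hX.comm h h'
    · simp [h₂]
  · by_cases h₂ : (l : ℕ) < t
    · have h₁ : (j : ℕ) < t := lt_trans h' h₂
      simp only [h₁, h₂, dif_pos]
      exact hX.quantum h h'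
    · simp [h₂]

/-- The surjection `O_q(M_{u,t+M}) → O_q(M_{u,t})` killing the last `M` columns. -/
def truncate : QMat K q u (t + M) →ₐ[K] QMat K q u t := qlift (isQM_truncate K q u t M)

@[simp] theorem truncate_castAdd (i : Fin u) (c : Fin t) :
    truncate (Xm K q i (Fin.castAdd M c)) = Xm K q i c := by
  simp [truncate]

@[simp] theorem truncate_natAdd (i : Fin u) (c : Fin M) :
    truncate (t := t) (Xm K q i (Fin.natAdd t c)) = 0 := by
  simp [truncate]

/-- Padding an exponent matrix by zero columns. -/
def pad (M : ℕ) (a : Fin u → Fin t → ℕ) : Fin u → Fin (t + M) → ℕ := fun i => Fin.append (a i) 0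

theorem extZero_append (M : ℕ) (k : Fin t → ℕ) :
    extZero (Fin.append k (0 : Fin M → ℕ)) = extZero k := by
  funext c
  by_cases h : c < t
  · have : Fin.append k (0 : Fin M → ℕ) (Fin.castAdd M ⟨c, h⟩) = k ⟨c, h⟩ := Fin.append_left _ _ _
    simpa [extZero, h, Nat.lt_add_right] using this
  · by_cases h' : c < t + M
    · have : Fin.append k (0 : Fin M → ℕ) (Fin.natAdd t ⟨c - t, by omega⟩) = 0 :=
        Fin.append_right _ _ _
      have e : Fin.natAdd t ⟨c - t, by omega⟩ = (⟨c, h'⟩ : Fin (t + M)) :=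
        Fin.ext (Nat.add_sub_cancel' (not_lt.1 h))
      rw [e] at this
      simpa [extZero, h, h'] using this
    · simp [extZero, h, h']

theorem colsum_pad (M : ℕ) (a : Fin u → Fin t → ℕ) : colsum (pad M a) = colsum a := by
  funext c
  simp only [colsum, pad, extZero_append]

theorem IsStd.pad {a : Fin u → Fin t → ℕ} (h : IsStd a) (M : ℕ) : IsStd (pad M a) := by
  induction u with
  | zero => trivial
  | succ u ih =>
    refine ⟨ih h.1, fun j => ?_⟩
    have : Fin.tail (_root_.pad M a) = _root_.pad M (Fin.tail a) := rfl
    rw [this, colsum_pad, colsum_pad]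
    exact h.2 j

theorem rowmon_eq_zero_or_one {R : Type} [Ring R] {v : ℕ} (k : Fin v → ℕ) :
    rowmon (fun _ => (0 : R)) k = if k = 0 then 1 else 0 := by
  split_ifs with h
  · rw [h, rowmon_zero]
  · obtain ⟨j, hj⟩ := Function.ne_iff.1 h
    exact List.prod_eq_zero (List.mem_ofFn.2 ⟨j, zero_pow hj⟩)

theorem rowmon_add {R : Type} [Ring R] {s t : ℕ} (x : Fin (s + t) → R)
    (k : Fin (s + t) → ℕ) : rowmon x k = rowmon (fun c => x (Fin.castAdd t c))
      (fun c => k (Fin.castAdd t c)) * rowmon (fun c => x (Fin.natAdd s c))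
      (fun c => k (Fin.natAdd s c)) := by
  rw [rowmon, List.ofFn_add, List.prod_append]
  rfl

theorem truncate_inclRow (x : QMat K q u (t + M)) :
    truncate (inclRow x) = inclRow (truncate x) := by
  have : truncate.comp inclRow = inclRow.comp (truncate (K := K) (q := q) (u := u) (t := t) (M := M)) :=
    QMat_hom_ext fun i c => by
      induction c using Fin.addCases <;> simp
  exact DFunLike.congr_fun this x

theorem map_rowmon {R S : Type} [Ring R] [Ring S] (f : R →+* S) {v : ℕ} (x : Fin v → R)
    (k : Fin v → ℕ) : f (rowmon x k) = rowmon (fun j => f (x j)) k := by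
  simp [rowmon, map_list_prod, List.map_ofFn, Function.comp_def]

open Classical in
theorem truncate_pbw (b : Fin u → Fin (t + M) → ℕ) :
    truncate (K := K) (q := q) (pbw b) =
      if (∀ i c, b i (Fin.natAdd t c) = 0) then pbw (fun i c => b i (Fin.castAdd M c)) else 0 := by
  induction u with
  | zero => simp [pbw]
  | succ u ih =>
    rw [pbw, map_mul, truncate_inclRow, ih, ← AlgHom.coe_toRingHom, map_rowmon, rowmon_add]
    simp only [AlgHom.coe_toRingHom, truncate_castAdd, truncate_natAdd, rowmon_eq_zero_or_one]
    have h₁ : (∀ i c, b i (Fin.natAdd t c) = 0) ↔ (fun c => b 0 (Fin.natAdd t c)) = 0 ∧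
        ∀ i c, Fin.tail b i (Fin.natAdd t c) = 0 := by
      rw [Fin.forall_fin_succ, funext_iff]
      rfl
    by_cases h₂ : (fun c => b 0 (Fin.natAdd t c)) = 0 <;>
      by_cases h₃ : ∀ i c, Fin.tail b i (Fin.natAdd t c) = 0
    · rw [if_pos h₂, if_pos h₃, if_pos (h₁.2 ⟨h₂, h₃⟩), mul_one]
      rfl
    · rw [if_neg h₃, if_neg fun h => h₃ (h₁.1 h).2, map_zero, mul_zero]
    · rw [if_neg h₂, if_neg fun h => h₂ (h₁.1 h).1, mul_zero, zero_mul]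
    · rw [if_neg h₂, if_neg fun h => h₂ (h₁.1 h).1, mul_zero, zero_mul]

variable [NeZero q]

theorem coord_truncate (a : Fin u → Fin t → ℕ) (x : QMat K q u (t + M)) :
    coord a (truncate x) = coord (pad M a) x := by
  classical
  suffices coord a ∘ₗ truncate.toLinearMap = coord (pad M a) from LinearMap.congr_fun this x
  refine (pbwBasis K q u (t + M)).ext fun b => ?_
  rw [pbwBasis_apply, LinearMap.comp_apply, AlgHom.toLinearMap_apply, truncate_pbw, coord_pbw]
  by_cases h : ∀ i c, b i (Fin.natAdd t c) = 0
  · rw [if_pos h, coord_pbw]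
    refine if_congr ⟨fun e => ?_, fun e => ?_⟩ rfl rfl
    · funext i c
      induction c using Fin.addCases with
      | left c => simp [pad, ← e]
      | right c => simp [pad, h]
    · funext i c
      simp [e, pad]
  · rw [if_neg h, map_zero, if_neg]
    rintro rfl
    exact h fun i c => by simp [pad]

variable {m n : ℕ}

/-- Truncation of both factors. -/
def truncateTmul :
    QMat K q m (t + M) ⊗[K] QMat K q n (t + M) →ₐ[K] QMat K q m t ⊗[K] QMat K q n t :=
  Algebra.TensorProduct.map truncate truncate

theorem coordTmul_truncateTmul (a : Fin m → Fin t → ℕ) (b : Fin n → Fin t → ℕ)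
    (w : QMat K q m (t + M) ⊗[K] QMat K q n (t + M)) :
    coordTmul a b (truncateTmul w) = coordTmul (pad M a) (pad M b) w := by
  induction w using TensorProduct.induction_on with
  | zero => simp
  | add x y hx hy => simp only [map_add, hx, hy]
  | tmul x y => simp [truncateTmul, coord_truncate]

theorem truncateTmul_theta (x : QMat K q m n) :
    truncateTmul (theta K q m n (t + M) x) = theta K q m n t x := by
  have : truncateTmul.comp (theta K q m n (t + M)) = theta K q m n t := QMat_hom_ext fun i j => by
    simp [truncateTmul, theta_Xm, Fin.sum_univ_add]
  exact DFunLike.congr_fun this x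

/-- Every invariant lies in the image of the comultiplication map. -/
theorem IsInv.exists_theta_eq {w : QMat K q m t ⊗[K] QMat K q n t} (h : IsInv w) :
    ∃ x, theta K q m n t x = w := by
  classical
  let T := ((pbwBasis K q m t).tensorProduct (pbwBasis K q n t)).repr w
  let deg (a : Fin m → Fin t → ℕ) : ℕ := ∑ c ∈ Finset.range (t + m), colsum a c
  obtain ⟨x, hx⟩ := exists_theta_coord (q := q) (n := n) (Nat.le_add_left m t)
    (T.support.image fun p => deg p.1)
    fun a b => coordTmul (fun i c => a i (Fin.castAdd m c)) (fun i c => b i (Fin.castAdd m c)) w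
  refine ⟨x, sub_eq_zero.1 (((isInv_theta x).sub h).eq_zero fun a b ha hb hab => ?_)⟩
  rw [map_sub, sub_eq_zero, ← truncateTmul_theta (M := m), coordTmul_truncateTmul,
    hx _ _ (ha.pad m) (hb.pad m) (by rw [colsum_pad, colsum_pad, hab])]
  simp only [colsum_pad, pad, Fin.append_left]
  split_ifs with hS
  · rfl
  · by_contra hne
    refine hS (Finset.mem_image.2 ⟨(a, b), ?_, rfl⟩)
    rw [Finsupp.mem_support_iff, tensor_basis_repr]
    exact Ne.symm hne

end Truncation
section CoactionHoms

variable {K : Type} [Field K] {A B H : Type} [Ring A] [Algebra K A] [Ring B] [Algebra K B]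
  [Ring H] [HopfAlgebra K H]

/-- The algebra morphism `a ⊗ b ↦ ∑ a₀ ⊗ (a₁ ⊗ b)`. -/
def leftBalance (B : Type) [Ring B] [Algebra K B] (ρ : A →ₐ[K] A ⊗[K] H) :
    A ⊗[K] B →ₐ[K] A ⊗[K] (H ⊗[K] B) :=
  (Algebra.TensorProduct.assoc K K K A H B).toAlgHom.comp
    (Algebra.TensorProduct.map ρ (AlgHom.id K B))

/-- The algebra morphism `a ⊗ b ↦ ∑ a ⊗ (b₋₁ ⊗ b₀)`. -/
def rightBalance (A : Type) [Ring A] [Algebra K A] (lam : B →ₐ[K] H ⊗[K] B) :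
    A ⊗[K] B →ₐ[K] A ⊗[K] (H ⊗[K] B) :=
  Algebra.TensorProduct.map (AlgHom.id K A) lam

theorem leftBalance_tmul (ρ : A →ₐ[K] A ⊗[K] H) (a : A) (b : B) :
    leftBalance B ρ (a ⊗ₜ b) = TensorProduct.assoc K A H B (ρ a ⊗ₜ b) := rfl

theorem rightBalance_tmul (lam : B →ₐ[K] H ⊗[K] B) (a : A) (b : B) :
    rightBalance A lam (a ⊗ₜ b) = a ⊗ₜ lam b := rfl

/-- Coinvariance as an equality of two coactions; the comodule laws only have to be checked on
algebra generators. -/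
theorem gammaMap_eq_iff_balance {ρ : A →ₐ[K] A ⊗[K] H} (lam : B →ₐ[K] H ⊗[K] B)
    (hcoassoc : (leftBalance H ρ).comp ρ =
      (rightBalance A (Bialgebra.comulAlgHom K H)).comp ρ)
    (hcounit : (Algebra.TensorProduct.rid K K A).toAlgHom.comp
      ((Algebra.TensorProduct.map (AlgHom.id K A) (Bialgebra.counitAlgHom K H)).comp ρ) =
        AlgHom.id K A) (w : A ⊗[K] B) :
    gammaMap K A B H ρ lam w = 1 ⊗ₜ w ↔ leftBalance B ρ w = rightBalance A lam w :=
  gammaMap_eq_iff lam (fun a => DFunLike.congr_fun hcoassoc a)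
    (fun a => DFunLike.congr_fun hcounit a) w

end CoactionHoms

section GeneratorCoactions

variable {K : Type} [Field K] {q : K} {m n t : ℕ} {G : Type} [Ring G] [HopfAlgebra K G]
  {T : Fin t → Fin t → G} {ρ : OqM K q m t →ₐ[K] OqM K q m t ⊗[K] G}
  {lam : OqM K q t n →ₐ[K] G ⊗[K] OqM K q t n}

theorem leftBalance_comp_coaction (hΔ : ∀ i j, Coalgebra.comul (R := K) (T i j) =
      ∑ k, T i k ⊗ₜ[K] T k j) (hρ : ∀ i j, ρ (Xg K q i j) = ∑ k, Xg K q i k ⊗ₜ[K] T k j) :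
    (leftBalance G ρ).comp ρ = (rightBalance _ (Bialgebra.comulAlgHom K G)).comp ρ := by
  refine OqM_hom_ext fun i j => ?_
  simp only [AlgHom.comp_apply, hρ, map_sum, leftBalance_tmul, rightBalance_tmul,
    TensorProduct.sum_tmul, TensorProduct.assoc_tmul, Bialgebra.comulAlgHom_apply, hΔ,
    TensorProduct.tmul_sum]
  exact Finset.sum_comm

theorem counit_comp_coaction (hε : ∀ i j, Coalgebra.counit (R := K) (T i j) =
      if i = j then (1 : K) else 0) (hρ : ∀ i j, ρ (Xg K q i j) = ∑ k, Xg K q i k ⊗ₜ[K] T k j) :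
    (Algebra.TensorProduct.rid K K (OqM K q m t)).toAlgHom.comp
      ((Algebra.TensorProduct.map (AlgHom.id K _) (Bialgebra.counitAlgHom K G)).comp ρ) =
        AlgHom.id K _ := by
  refine OqM_hom_ext fun i j => ?_
  simp [hρ, hε]

theorem balance_eq_of_generator (hρ : ∀ i j, ρ (Xg K q i j) = ∑ k, Xg K q i k ⊗ₜ[K] T k j)
    (hlam : ∀ i j, lam (Xg K q i j) = ∑ k, T i k ⊗ₜ[K] Xg K q k j) (i : Fin m) (j : Fin n) :
    leftBalance _ ρ (∑ k, Xg K q i k ⊗ₜ[K] Xg K q k j) =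
      rightBalance _ lam (∑ k, Xg K q i k ⊗ₜ[K] Xg K q k j) := by
  simp only [map_sum, leftBalance_tmul, rightBalance_tmul, hρ, hlam, TensorProduct.sum_tmul,
    TensorProduct.assoc_tmul, TensorProduct.tmul_sum]
  exact Finset.sum_comm

/-- Transposition `O_q(M_{t,n}) ≃ O_q(M_{n,t})`. -/
def transposeEquiv (K : Type) [Field K] (q : K) (t n : ℕ) : OqM K q t n ≃ₐ[K] QMat K q n t :=
  AlgEquiv.ofAlgHom (oqLift (isQM_Xm K q n t).transpose) (qlift (isQM_Xg K q t n).transpose)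
    (QMat_hom_ext fun i j => by simp [oqLift_Xg])
    (OqM_hom_ext fun i j => by simp [oqLift_Xg])

theorem transposeEquiv_Xg (i : Fin t) (j : Fin n) :
    transposeEquiv K q t n (Xg K q i j) = Xm K q j i :=
  oqLift_Xg _ _ _

/-- The identification of `O_q(V)` with a tensor product of matrices with `t` columns. -/
def pairEquiv (K : Type) [Field K] (q : K) (m n t : ℕ) :
    OqM K q m t ⊗[K] OqM K q t n ≃ₐ[K] QMat K q m t ⊗[K] QMat K q n t :=
  Algebra.TensorProduct.congr (qmatEquiv K q m t) (transposeEquiv K q t n)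

theorem pairEquiv_tmul (x : OqM K q m t) (y : OqM K q t n) :
    pairEquiv K q m n t (x ⊗ₜ y) = qmatEquiv K q m t x ⊗ₜ transposeEquiv K q t n y := rfl

/-- Pushing the middle factor of `A ⊗ (G ⊗ B)` to the right along an algebra morphism. -/
def pushMiddle {R : Type} [Ring R] [Algebra K R] (g : G →ₐ[K] R) :
    OqM K q m t ⊗[K] (G ⊗[K] OqM K q t n) →ₐ[K] (QMat K q m t ⊗[K] QMat K q n t) ⊗[K] R :=
  (Algebra.TensorProduct.assoc K K K _ _ _).symm.toAlgHom.comp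
    (Algebra.TensorProduct.map (qmatEquiv K q m t).toAlgHom
      ((Algebra.TensorProduct.map (transposeEquiv K q t n).toAlgHom g).comp
        (Algebra.TensorProduct.comm K G (OqM K q t n)).toAlgHom))

theorem pushMiddle_tmul {R : Type} [Ring R] [Algebra K R] (g : G →ₐ[K] R) (x : OqM K q m t)
    (h : G) (y : OqM K q t n) : pushMiddle g (x ⊗ₜ (h ⊗ₜ y)) =
      (qmatEquiv K q m t x ⊗ₜ transposeEquiv K q t n y) ⊗ₜ g h := rfl

variable [NeZero q]

theorem pairEquiv_sum (i : Fin m) (j : Fin n) :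
    pairEquiv K q m n t (∑ k, Xg K q i k ⊗ₜ[K] Xg K q k j) = theta K q m n t (Xm K q i j) := by
  simp only [map_sum, pairEquiv_tmul, qmatEquiv_Xg, transposeEquiv_Xg, theta_Xm]

variable {R : Type} [Ring R] [Algebra K R] {φ : Fin t → Fin t → R} {g : G →ₐ[K] R}

theorem pushMiddle_leftBalance (hρ : ∀ i j, ρ (Xg K q i j) = ∑ k, Xg K q i k ⊗ₜ[K] T k j)
    (hφ : IsQM q φ) (hg : ∀ i j, g (T i j) = φ i j) (w : OqM K q m t ⊗[K] OqM K q t n) :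
    pushMiddle g (leftBalance _ ρ w) = leftCoact hφ (pairEquiv K q m n t w) := by
  suffices (pushMiddle g).comp (leftBalance _ ρ) =
    (leftCoact hφ).comp (pairEquiv K q m n t).toAlgHom from DFunLike.congr_fun this w
  refine Algebra.TensorProduct.ext ?_ ?_
  · refine OqM_hom_ext fun i j => ?_
    change pushMiddle g (leftBalance _ ρ (Xg K q i j ⊗ₜ 1)) = leftCoact hφ (pairEquiv K q m n t (Xg K q i j ⊗ₜ 1))
    simp only [leftBalance_tmul, pairEquiv_tmul, leftCoact_tmul, pushMiddle_tmul, hρ, hg, coact_Xm,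
      map_one, map_sum, qmatEquiv_Xg, TensorProduct.sum_tmul, TensorProduct.assoc_tmul,
      TensorProduct.assoc_symm_tmul, LinearMap.lTensor_tmul, LinearEquiv.coe_coe,
      TensorProduct.comm_tmul]
  · refine OqM_hom_ext fun i j => ?_
    change pushMiddle g (leftBalance _ ρ (1 ⊗ₜ Xg K q i j)) = leftCoact hφ (pairEquiv K q m n t (1 ⊗ₜ Xg K q i j))
    simp only [leftBalance_tmul, pairEquiv_tmul, leftCoact_tmul, pushMiddle_tmul, map_one,
      transposeEquiv_Xg, Algebra.TensorProduct.one_def, TensorProduct.assoc_tmul,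
      TensorProduct.assoc_symm_tmul, LinearMap.lTensor_tmul, LinearEquiv.coe_coe,
      TensorProduct.comm_tmul]

theorem pushMiddle_rightBalance (hlam : ∀ i j, lam (Xg K q i j) = ∑ k, T i k ⊗ₜ[K] Xg K q k j)
    (hφ : IsQM q φ) (hg : ∀ i j, g (T i j) = φ i j) (w : OqM K q m t ⊗[K] OqM K q t n) :
    pushMiddle g (rightBalance _ lam w) = rightCoact hφ.transpose (pairEquiv K q m n t w) := by
  suffices (pushMiddle g).comp (rightBalance _ lam) =
    (rightCoact hφ.transpose).comp (pairEquiv K q m n t).toAlgHom from DFunLike.congr_fun this w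
  refine Algebra.TensorProduct.ext ?_ ?_
  · refine OqM_hom_ext fun i j => ?_
    change pushMiddle g (rightBalance _ lam (Xg K q i j ⊗ₜ 1)) = rightCoact hφ.transpose (pairEquiv K q m n t (Xg K q i j ⊗ₜ 1))
    simp only [rightBalance_tmul, pairEquiv_tmul, rightCoact_tmul, pushMiddle_tmul, map_one, qmatEquiv_Xg,
      Algebra.TensorProduct.one_def, TensorProduct.assoc_symm_tmul]
  · refine OqM_hom_ext fun i j => ?_
    change pushMiddle g (rightBalance _ lam (1 ⊗ₜ Xg K q i j)) = rightCoact hφ.transpose (pairEquiv K q m n t (1 ⊗ₜ Xg K q i j))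
    simp only [rightBalance_tmul, pairEquiv_tmul, rightCoact_tmul, pushMiddle_tmul, hlam, hg, coact_Xm,
      map_one, map_sum, transposeEquiv_Xg, TensorProduct.tmul_sum, TensorProduct.assoc_symm_tmul]

end GeneratorCoactions
/-- First Fundamental Theorem for `O_q(GL_t)`-coinvariants: for arbitrary
positive integers `m, n, t`, the set of `γ*_q`-coinvariants in
`O_q(V) = O_q(M_{m,t}) ⊗ O_q(M_{t,n})` equals the image of
`μ*_q : O_q(M_{m,n}^{≤ t}) → O_q(V)`. -/
theorem stmt5 (K : Type) [Field K] (q : K) (hq : q ≠ 0) (m n t : ℕ)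
    (hm : 0 < m) (hn : 0 < n) (ht : 0 < t)
    -- `G` is the Hopf algebra `O_q(GL_t)`, the localization of `O_q(M_t)` at the central
    -- quantum determinant `d_T`:
    (G : Type) [Ring G] [HopfAlgebra K G]
    (ιG : OqM K q t t →ₐ[K] G)
    (hcentral : ∀ g : G, ιG (qdet K q t) * g = g * ιG (qdet K q t))
    (hunit : IsUnit (ιG (qdet K q t)))
    (huniv : ∀ (C : Type) [Ring C] [Algebra K C] (f : OqM K q t t →ₐ[K] C),
      IsUnit (f (qdet K q t)) → ∃! g : G →ₐ[K] C, g.comp ιG = f)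
    -- the Hopf structure of `G` on the generators `T_{ij} = ιG X_{ij}`:
    (hΔT : ∀ i j : Fin t, Coalgebra.comul (R := K) (ιG (Xg K q i j)) =
      ∑ k : Fin t, ιG (Xg K q i k) ⊗ₜ[K] ιG (Xg K q k j))
    (hεT : ∀ i j : Fin t, Coalgebra.counit (R := K) (ιG (Xg K q i j)) =
      if i = j then (1 : K) else 0)
    -- the right coaction `ρ*_q` of `G` on `O_q(M_{m,t})`, `Y_{ij} ↦ Σ_k Y_{ik} ⊗ T_{kj}`:
    (ρ : OqM K q m t →ₐ[K] OqM K q m t ⊗[K] G)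
    (hρ : ∀ (i : Fin m) (j : Fin t),
      ρ (Xg K q i j) = ∑ k : Fin t, Xg K q i k ⊗ₜ[K] ιG (Xg K q k j))
    -- the left coaction `λ*_q` of `G` on `O_q(M_{t,n})`, `Z_{ij} ↦ Σ_k T_{ik} ⊗ Z_{kj}`:
    (lam : OqM K q t n →ₐ[K] G ⊗[K] OqM K q t n)
    (hlam : ∀ (i : Fin t) (j : Fin n),
      lam (Xg K q i j) = ∑ k : Fin t, ιG (Xg K q i k) ⊗ₜ[K] Xg K q k j)
    -- `μ*_q : O_q(M_{m,n}^{≤ t}) → O_q(V)`, induced by `X_{ij} ↦ Σ_k Y_{ik} ⊗ Z_{kj}`: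
    (μ : OqMle K q m n t →ₐ[K] OqM K q m t ⊗[K] OqM K q t n)
    (hμ : ∀ (i : Fin m) (j : Fin n),
      μ (mkle K q m n t (Xg K q i j)) = ∑ k : Fin t, Xg K q i k ⊗ₜ[K] Xg K q k j) :
    {w : OqM K q m t ⊗[K] OqM K q t n |
        gammaMap K (OqM K q m t) (OqM K q t n) G ρ lam w = (1 : G) ⊗ₜ[K] w} =
      Set.range μ := by
  have : NeZero q := ⟨hq⟩
  have hmk : (pairEquiv K q m n t).toAlgHom.comp (μ.comp (mkle K q m n t)) =
      (theta K q m n t).comp (qmatEquiv K q m n).toAlgHom := OqM_hom_ext fun i j =>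
    (congrArg (pairEquiv K q m n t) (hμ i j)).trans (pairEquiv_sum i j)
  ext w
  rw [Set.mem_ofPred_eq, gammaMap_eq_iff_balance lam (leftBalance_comp_coaction hΔT hρ)
    (counit_comp_coaction hεT hρ)]
  constructor
  · intro h
    have hinv : IsInv (pairEquiv K q m n t w) := isInv_of_balanced fun R _ _ φ hφ hu => by
      obtain ⟨g, hg, -⟩ := huniv R (oqLift hφ) hu
      have hgT (i j : Fin t) : g (ιG (Xg K q i j)) = φ i j :=
        (DFunLike.congr_fun hg _).trans (oqLift_Xg hφ i j)
      rw [IsBalanced, ← pushMiddle_leftBalance hρ hφ hgT, h, pushMiddle_rightBalance hlam hφ hgT]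
    obtain ⟨x, hx⟩ := hinv.exists_theta_eq
    exact ⟨mkle K q m n t ((qmatEquiv K q m n).symm x), (pairEquiv K q m n t).injective
      ((DFunLike.congr_fun hmk _).trans hx)⟩
  · rintro ⟨y, rfl⟩
    obtain ⟨x, rfl⟩ := RingQuot.mkAlgHom_surjective K (DetRel K q m n t) y
    have : (leftBalance _ ρ).comp (μ.comp (mkle K q m n t)) =
        (rightBalance _ lam).comp (μ.comp (mkle K q m n t)) := OqM_hom_ext fun i j => by
      simp only [AlgHom.comp_apply, hμ]
      exact balance_eq_of_generator hρ hlam i j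
    exact DFunLike.congr_fun this x

end
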